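/- Let X be a geodesic metric space which admits a disc-thickening with a quadratic isoperimetric inequality. Suppose there exist ε>0 and s₀>0 such that every Lipschitz loop γ in X with length(γ) ≥ s₀ bounds a singular Lipschitz disc of area at most ((1−ε)/(4π))·length(γ)² in L^∞(X). Then X is Gromov hyperbolic. -/

import Mathlib

open scoped NNReal ENNReal
open MeasureTheory Filter

universe u v

namespace SharpIsop

/-- The closed unit disc `D² ⊂ ℝ²`. -/
def D2 : Set (ℝ × ℝ) := {p | p.1 ^ 2 + p.2 ^ 2 ≤ 1}

/-- The length (total variation over `[0,1]`) of a curve `γ : [0,1] → X`. -/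
noncomputable def loopLength {X : Type u} [PseudoEMetricSpace X] (γ : ℝ → X) : ℝ :=
  (eVariationOn γ (Set.Icc 0 1)).toReal

/-- A Lipschitz loop in `X`: a Lipschitz map `γ : [0,1] → X` with `γ 0 = γ 1`. -/
def IsLipLoop {X : Type u} [PseudoEMetricSpace X] (γ : ℝ → X) : Prop :=
  (∃ K : ℝ≥0, LipschitzOnWith K γ (Set.Icc 0 1)) ∧ γ 0 = γ 1

/-- The metric (directional) derivative of `φ : ℝ² → X` at `x` in direction `v`,
defined via a `limsup` so that it is everywhere defined (and agrees a.e. with the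
limit when the latter exists). -/
noncomputable def mder {X : Type u} [PseudoMetricSpace X] (φ : ℝ × ℝ → X)
    (x v : ℝ × ℝ) : ℝ :=
  Filter.limsup (fun r : ℝ => dist (φ (x + r • v)) (φ x) / r) (nhdsWithin 0 (Set.Ioi 0))

/-- The Jacobian of a (semi)norm `s` on `ℝ²`:  `π / Leb²({v : s v ≤ 1})` if this set
has finite measure, `0` otherwise. -/
noncomputable def jac2 (s : ℝ × ℝ → ℝ) : ℝ :=
  if volume {v : ℝ × ℝ | s v ≤ 1} < ⊤ then
    Real.pi / (volume {v : ℝ × ℝ | s v ≤ 1}).toReal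
  else 0

/-- The parametrized (Hausdorff) area of a map `φ : D² → X`. -/
noncomputable def lipArea {X : Type u} [PseudoMetricSpace X] (φ : ℝ × ℝ → X) : ℝ :=
  ∫ x in D2, jac2 (mder φ x)

/-- `φ : D² → X` is a singular Lipschitz disc bounding the loop `γ : [0,1] → X`. -/
def BoundsLoop {X : Type u} [PseudoMetricSpace X] (φ : ℝ × ℝ → X) (γ : ℝ → X) : Prop :=
  (∃ K : ℝ≥0, LipschitzOnWith K φ D2) ∧
    ∀ s ∈ Set.Icc (0:ℝ) 1, φ (Real.cos (2 * Real.pi * s), Real.sin (2 * Real.pi * s)) = γ s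

/-- `g : [0, d x y] → X` is a geodesic from `x` to `y`. -/
def IsGeodesicSeg {X : Type u} [MetricSpace X] (x y : X) (g : ℝ → X) : Prop :=
  g 0 = x ∧ g (dist x y) = y ∧
    ∀ s ∈ Set.Icc (0:ℝ) (dist x y), ∀ t ∈ Set.Icc (0:ℝ) (dist x y),
      dist (g s) (g t) = |s - t|

/-- A geodesic metric space: any two points are joined by a geodesic. -/
def GeodesicSpace (X : Type u) [MetricSpace X] : Prop :=
  ∀ x y : X, ∃ g : ℝ → X, IsGeodesicSeg x y g

/-- Gromov hyperbolicity via δ-slim geodesic triangles. -/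
def GromovHyperbolic (X : Type u) [MetricSpace X] : Prop :=
  ∃ δ : ℝ, 0 ≤ δ ∧
    ∀ x y z : X, ∀ gxy gyz gzx : ℝ → X,
      IsGeodesicSeg x y gxy → IsGeodesicSeg y z gyz → IsGeodesicSeg z x gzx →
      ∀ s ∈ Set.Icc (0:ℝ) (dist x y),
        ∃ p ∈ gyz '' Set.Icc (0:ℝ) (dist y z) ∪ gzx '' Set.Icc (0:ℝ) (dist z x),
          dist (gxy s) p ≤ δ

/-- `L^∞(X)`: the Banach space of bounded real functions on `X` with sup norm. -/
abbrev Linfty (X : Type u) : Type u := lp (fun _ : X => ℝ) ⊤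

/-- The Kuratowski embedding `x ↦ d(x,·) − d(x₀,·)` of `X` into `L^∞(X)`. -/
noncomputable def kuratowski (X : Type u) [MetricSpace X] (x₀ : X) (x : X) : Linfty X :=
  ⟨fun y => dist x y - dist x₀ y, memℓp_infty ⟨dist x x₀, by
    rintro t ⟨y, rfl⟩
    simpa [Real.norm_eq_abs] using abs_dist_sub_le x x₀ y⟩⟩

/-- `Y` admits a quadratic isoperimetric inequality for curves (with singular
Lipschitz discs as fillings). -/
def QuadIsopSpace (Y : Type u) [MetricSpace Y] : Prop :=
  ∃ C > (0:ℝ), ∀ c : ℝ → Y, IsLipLoop c →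
    ∃ φ : ℝ × ℝ → Y, BoundsLoop φ c ∧ lipArea φ ≤ C * (loopLength c) ^ 2

/-- `X` admits a disc-thickening with a quadratic isoperimetric inequality. -/
def HasDiscThickeningQII (X : Type u) [MetricSpace X] : Prop :=
  ∃ (X' : Type u) (m : MetricSpace X') (ι : X → X'),
    letI := m
    CompleteSpace X' ∧ Isometry ι ∧
      EMetric.hausdorffEdist (Set.range ι) (Set.univ : Set X') ≠ ⊤ ∧
      QuadIsopSpace X'

local notation "RR" => (ℝ × ℝ)
local notation "rg" => Finset.range
local notation "sn" => Real.sin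
local notation "cs" => Real.cos
local notation "pp" => Real.pi
local notation "Ic" => Set.Icc
local notation "eR" => ENNReal.ofReal

def wd (u v : RR) : ℝ := u.1 * v.2 - u.2 * v.1
def dt (u v : RR) : ℝ := u.1 * v.1 + u.2 * v.2
noncomputable def grad (a : RR → ℝ) (x : RR) : RR :=
  (fderiv ℝ a x (1, 0), fderiv ℝ a x (0, 1))
lemma dt_grad (a : RR → ℝ) (x v : RR) : dt (grad a x) v = fderiv ℝ a x v := by
  have : v = v.1 • (1, 0) + v.2 • ((0, 1) : RR) := by ext <;> simp
  conv_rhs => rw [this]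
  simp only [map_add, map_smul, dt, grad, smul_eq_mul]; ring
lemma measurable_grad (a : RR → ℝ) : Measurable (grad a) :=
  (measurable_fderiv_apply_const ℝ a (1, 0)).prodMk (measurable_fderiv_apply_const ℝ a (0, 1))
lemma norm_grad_le {a : RR → ℝ} {K : ℝ≥0} (ha : LipschitzWith K a) (x : RR) :
    |(grad a x).1| ≤ K ∧ |(grad a x).2| ≤ K := by
  have h := norm_fderiv_le_of_lipschitz ℝ ha (x₀ := x)
  constructor
  · have := (fderiv ℝ a x).le_of_opNorm_le h (1, 0)
    simpa [grad, Prod.norm_def] using this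
  · have := (fderiv ℝ a x).le_of_opNorm_le h (0, 1)
    simpa [grad, Prod.norm_def] using this
lemma measurable_wd_grad (a b : RR → ℝ) : Measurable fun x => wd (grad a x) (grad b x) := by
  have h1 := measurable_grad a
  have h2 := measurable_grad b
  unfold wd
  exact (h1.fst.mul h2.snd).sub (h1.snd.mul h2.fst)
section rect
variable (b : RR → ℝ)
noncomputable def pE (e : ℝ) (z : RR) : ℝ :=
  (e ^ 2)⁻¹ * ∫ s in z.1..z.1 + e, (b (s, z.2 + e) - b (s, z.2))
noncomputable def qE (e : ℝ) (z : RR) : ℝ :=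
  (e ^ 2)⁻¹ * ∫ t in z.2..z.2 + e, (b (z.1 + e, t) - b (z.1, t))
noncomputable def dE (e : ℝ) (z : RR) : ℝ :=
  (e ^ 2)⁻¹ * (b (z.1 + e, z.2 + e) - b (z.1 + e, z.2) - b (z.1, z.2 + e) + b z)
variable {b}
lemma pE_hasDeriv (hb : Continuous b) (e x y : ℝ) :
    HasDerivAt (fun x => pE b e (x, y)) (dE b e (x, y)) x := by
  have hc : Continuous fun s => b (s, y + e) - b (s, y) := by fun_prop
  have h0 : ∀ x, HasDerivAt (fun u => ∫ s in (0:ℝ)..u, (b (s, y + e) - b (s, y)))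
      (b (x, y + e) - b (x, y)) x := fun x =>
    intervalIntegral.integral_hasDerivAt_right (hc.intervalIntegrable _ _)
      (hc.stronglyMeasurableAtFilter _ _) hc.continuousAt
  have h1 := ((h0 (x + e)).comp_add_const x e).sub (h0 x)
  have h2 := h1.const_mul ((e ^ 2)⁻¹)
  refine (h2.congr_deriv ?_).congr_of_eventuallyEq (Eventually.of_forall fun u => ?_)
  · simp only [dE]; ring
  · simp only [pE, Pi.sub_apply]
    rw [intervalIntegral.integral_interval_sub_left (hc.intervalIntegrable _ _)
      (hc.intervalIntegrable _ _)]
lemma qE_hasDeriv (hb : Continuous b) (e x y : ℝ) :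
    HasDerivAt (fun y => qE b e (x, y)) (dE b e (x, y)) y := by
  have hc : Continuous fun s => b (x + e, s) - b (x, s) := by fun_prop
  have h0 : ∀ y, HasDerivAt (fun u => ∫ s in (0:ℝ)..u, (b (x + e, s) - b (x, s)))
      (b (x + e, y) - b (x, y)) y := fun y =>
    intervalIntegral.integral_hasDerivAt_right (hc.intervalIntegrable _ _)
      (hc.stronglyMeasurableAtFilter _ _) hc.continuousAt
  have h1 := ((h0 (y + e)).comp_add_const y e).sub (h0 y)
  have h2 := h1.const_mul ((e ^ 2)⁻¹)
  refine (h2.congr_deriv ?_).congr_of_eventuallyEq (Eventually.of_forall fun u => ?_)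
  · simp only [dE]; ring
  · simp only [qE, Pi.sub_apply]
    rw [intervalIntegral.integral_interval_sub_left (hc.intervalIntegrable _ _)
      (hc.intervalIntegrable _ _)]
lemma pE_cont (hb : Continuous b) (e : ℝ) : Continuous (pE b e) := by
  have : pE b e = fun z => (e ^ 2)⁻¹ * ∫ s in (0:ℝ)..e, (b (s + z.1, z.2 + e) - b (s + z.1, z.2)) := by
    ext z; simp only [pE]
    rw [intervalIntegral.integral_comp_add_right (fun s => b (s, z.2 + e) - b (s, z.2))]
    simp [add_comm]
  rw [this]
  apply Continuous.mul continuous_const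
  apply intervalIntegral.continuous_parametric_intervalIntegral_of_continuous'
  fun_prop
lemma qE_cont (hb : Continuous b) (e : ℝ) : Continuous (qE b e) := by
  have : qE b e = fun z => (e ^ 2)⁻¹ * ∫ s in (0:ℝ)..e, (b (z.1 + e, s + z.2) - b (z.1, s + z.2)) := by
    ext z; simp only [qE]
    rw [intervalIntegral.integral_comp_add_right (fun s => b (z.1 + e, s) - b (z.1, s))]
    simp [add_comm]
  rw [this]
  apply Continuous.mul continuous_const
  apply intervalIntegral.continuous_parametric_intervalIntegral_of_continuous'
  fun_prop
lemma pE_bound {K : ℝ≥0} (hb : LipschitzWith K b) {e : ℝ} (he : 0 < e) (z : RR) :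
    |pE b e z| ≤ K := by
  have : ‖∫ s in z.1..z.1 + e, (b (s, z.2 + e) - b (s, z.2))‖ ≤ (K * e) * |z.1 + e - z.1| := by
    apply intervalIntegral.norm_integral_le_of_norm_le_const
    intro s _
    have := hb.dist_le_mul (s, z.2 + e) (s, z.2)
    simpa [Real.dist_eq, Prod.dist_eq, abs_of_pos he, he.le] using this
  rw [pE, abs_mul, abs_of_pos (by positivity), inv_mul_le_iff₀ (by positivity)]
  rw [Real.norm_eq_abs, add_sub_cancel_left, abs_of_pos he] at this
  linarith [this]
lemma qE_bound {K : ℝ≥0} (hb : LipschitzWith K b) {e : ℝ} (he : 0 < e) (z : RR) :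
    |qE b e z| ≤ K := by
  have : ‖∫ s in z.2..z.2 + e, (b (z.1 + e, s) - b (z.1, s))‖ ≤ (K * e) * |z.2 + e - z.2| := by
    apply intervalIntegral.norm_integral_le_of_norm_le_const
    intro s _
    have := hb.dist_le_mul (z.1 + e, s) (z.1, s)
    simpa [Real.dist_eq, Prod.dist_eq, abs_of_pos he, he.le] using this
  rw [qE, abs_mul, abs_of_pos (by positivity), inv_mul_le_iff₀ (by positivity)]
  rw [Real.norm_eq_abs, add_sub_cancel_left, abs_of_pos he] at this
  linarith [this]
lemma diff_est {z : RR} (hd : DifferentiableAt ℝ b z) {η : ℝ} (hη : 0 < η) :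
    ∀ᶠ e in nhdsWithin (0:ℝ) (Set.Ioi 0), ∀ w w', ‖w‖ ≤ e → ‖w'‖ ≤ e →
      |b (z + w) - b (z + w') - fderiv ℝ b z (w - w')| ≤ η * e := by
  have h1 := hd.hasFDerivAt.isLittleO
  have h2 := h1.def (half_pos hη)
  rw [Metric.eventually_nhds_iff_ball] at h2
  obtain ⟨ρ, hρ, h⟩ := h2
  have : ∀ᶠ e in nhdsWithin (0:ℝ) (Set.Ioi 0), e ∈ Set.Ioo 0 ρ := Ioo_mem_nhdsGT hρ
  filter_upwards [this] with e he w w' hw hw'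
  have k1 := h (z + w) (by simpa using lt_of_le_of_lt hw he.2)
  have k2 := h (z + w') (by simpa using lt_of_le_of_lt hw' he.2)
  simp only [add_sub_cancel_left, Real.norm_eq_abs] at k1 k2
  rw [map_sub]
  rw [abs_le] at *
  constructor <;> nlinarith [hw, hw']
lemma pE_tendsto (hb : Continuous b) {z : RR} (hd : DifferentiableAt ℝ b z) :
    Tendsto (fun e => pE b e z) (nhdsWithin 0 (Set.Ioi 0)) (nhds (grad b z).2) := by
  rw [Metric.tendsto_nhds]
  intro η hη
  filter_upwards [diff_est hd (half_pos hη), self_mem_nhdsWithin] with e he he0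
  have he0 : 0 < e := he0
  have : ‖∫ s in z.1..z.1 + e, (b (s, z.2 + e) - b (s, z.2) - e * (grad b z).2)‖
      ≤ (η / 2 * e) * |z.1 + e - z.1| := by
    apply intervalIntegral.norm_integral_le_of_norm_le_const
    intro s hs
    rw [Set.uIoc_of_le (by linarith)] at hs
    have h1 : |s - z.1| ≤ e := by rw [abs_le]; constructor <;> linarith [hs.1, hs.2]
    have := he (s - z.1, e) (s - z.1, 0) (by simp [Prod.norm_def, h1, abs_of_pos he0])
      (by simp [Prod.norm_def, h1])
    rw [Real.norm_eq_abs]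
    convert this using 2
    have e1 : z + (s - z.1, e) = (s, z.2 + e) := by ext <;> simp
    have e2 : z + (s - z.1, 0) = (s, z.2) := by ext <;> simp
    have e3 : ((s - z.1, e) - (s - z.1, 0) : RR) = e • (0, 1) := by ext <;> simp
    rw [e1, e2, e3, map_smul]; rfl
  rw [intervalIntegral.integral_sub (Continuous.intervalIntegrable (by fun_prop) _ _)
    (Continuous.intervalIntegrable (by fun_prop) _ _)] at this
  simp only [intervalIntegral.integral_const, add_sub_cancel_left, smul_eq_mul, abs_of_pos he0,
    Real.norm_eq_abs] at this
  rw [Real.dist_eq, pE]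
  set I := ∫ s in z.1..z.1 + e, (b (s, z.2 + e) - b (s, z.2))
  have h3 : (e ^ 2)⁻¹ * I - (grad b z).2 = (e ^ 2)⁻¹ * (I - e * (e * (grad b z).2)) := by
    field_simp
  rw [h3, abs_mul, abs_of_pos (by positivity), inv_mul_lt_iff₀ (by positivity)]
  nlinarith [mul_pos he0 he0]
lemma qE_tendsto (hb : Continuous b) {z : RR} (hd : DifferentiableAt ℝ b z) :
    Tendsto (fun e => qE b e z) (nhdsWithin 0 (Set.Ioi 0)) (nhds (grad b z).1) := by
  rw [Metric.tendsto_nhds]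
  intro η hη
  filter_upwards [diff_est hd (half_pos hη), self_mem_nhdsWithin] with e he he0
  have he0 : 0 < e := he0
  have : ‖∫ s in z.2..z.2 + e, (b (z.1 + e, s) - b (z.1, s) - e * (grad b z).1)‖
      ≤ (η / 2 * e) * |z.2 + e - z.2| := by
    apply intervalIntegral.norm_integral_le_of_norm_le_const
    intro s hs
    rw [Set.uIoc_of_le (by linarith)] at hs
    have h1 : |s - z.2| ≤ e := by rw [abs_le]; constructor <;> linarith [hs.1, hs.2]
    have := he (e, s - z.2) (0, s - z.2) (by simp [Prod.norm_def, h1, abs_of_pos he0])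
      (by simp [Prod.norm_def, h1])
    rw [Real.norm_eq_abs]
    convert this using 2
    have e1 : z + (e, s - z.2) = (z.1 + e, s) := by ext <;> simp
    have e2 : z + (0, s - z.2) = (z.1, s) := by ext <;> simp
    have e3 : ((e, s - z.2) - (0, s - z.2) : RR) = e • (1, 0) := by ext <;> simp
    rw [e1, e2, e3, map_smul]; rfl
  rw [intervalIntegral.integral_sub (Continuous.intervalIntegrable (by fun_prop) _ _)
    (Continuous.intervalIntegrable (by fun_prop) _ _)] at this
  simp only [intervalIntegral.integral_const, add_sub_cancel_left, smul_eq_mul, abs_of_pos he0,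
    Real.norm_eq_abs] at this
  rw [Real.dist_eq, qE]
  set I := ∫ s in z.2..z.2 + e, (b (z.1 + e, s) - b (z.1, s))
  have h3 : (e ^ 2)⁻¹ * I - (grad b z).1 = (e ^ 2)⁻¹ * (I - e * (e * (grad b z).1)) := by
    field_simp
  rw [h3, abs_mul, abs_of_pos (by positivity), inv_mul_lt_iff₀ (by positivity)]
  nlinarith [mul_pos he0 he0]
end rect
lemma slice_diff_x {a : RR → ℝ} {z : RR} (h : DifferentiableAt ℝ a z) :
    deriv (fun x => a (x, z.2)) z.1 = (grad a z).1 := by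
  have h1 : HasDerivAt (fun x : ℝ => (x, z.2)) ((1, 0) : RR) z.1 :=
    (hasDerivAt_id z.1).prodMk (hasDerivAt_const _ _)
  exact (HasFDerivAt.comp_hasDerivAt z.1 (l := a) (f := fun x : ℝ => (x, z.2)) h.hasFDerivAt h1).deriv
lemma slice_diff_y {a : RR → ℝ} {z : RR} (h : DifferentiableAt ℝ a z) :
    deriv (fun y => a (z.1, y)) z.2 = (grad a z).2 := by
  have h1 : HasDerivAt (fun y : ℝ => (z.1, y)) ((0, 1) : RR) z.2 :=
    (hasDerivAt_const _ _).prodMk (hasDerivAt_id z.2)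
  exact (HasFDerivAt.comp_hasDerivAt z.2 (l := a) (f := fun y : ℝ => (z.1, y)) h.hasFDerivAt h1).deriv
lemma lip_slice_x {a : RR → ℝ} {K : ℝ≥0} (h : LipschitzWith K a) (y : ℝ) :
    LipschitzWith K fun x => a (x, y) := by
  apply LipschitzWith.of_dist_le_mul
  intro x x'
  simpa [Prod.dist_eq] using h.dist_le_mul (x, y) (x', y)
lemma lip_slice_y {a : RR → ℝ} {K : ℝ≥0} (h : LipschitzWith K a) (x : ℝ) :
    LipschitzWith K fun y => a (x, y) := by
  apply LipschitzWith.of_dist_le_mul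
  intro y y'
  simpa [Prod.dist_eq] using h.dist_le_mul (x, y) (x, y')
lemma ibp {f g g' : ℝ → ℝ} {K : ℝ≥0} (hf : LipschitzWith K f)
    (hg : ∀ x, HasDerivAt g (g' x) x) (hg' : Continuous g') (u v : ℝ) :
    ∫ x in u..v, deriv f x * g x = f v * g v - f u * g u - ∫ x in u..v, f x * g' x := by
  have e : deriv g = g' := funext fun x => (hg x).deriv
  have h1 : AbsolutelyContinuousOnInterval g u v := by
    apply ContDiffOn.absolutelyContinuousOnInterval
    apply ContDiff.contDiffOn
    rw [contDiff_one_iff_deriv]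
    exact ⟨fun x => (hg x).differentiableAt, e ▸ hg'⟩
  have := h1.integral_mul_deriv_eq_deriv_mul
    (hf.lipschitzOnWith (s := Set.uIcc u v)).absolutelyContinuousOnInterval
  rw [e] at this
  simp only [mul_comm (deriv f _), mul_comm (f _)]
  linarith
lemma rect_eps {a b : RR → ℝ} {K : ℝ≥0} (ha : LipschitzWith K a) (hb : LipschitzWith K b)
    {x0 x1 y0 y1 : ℝ} (hx : x0 ≤ x1) (hy : y0 ≤ y1) {e : ℝ} (he : 0 < e) :
    ∫ z in Set.Ioc x0 x1 ×ˢ Set.Ioc y0 y1, ((grad a z).1 * pE b e z - (grad a z).2 * qE b e z) =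
    (∫ y in y0..y1, (a (x1, y) * pE b e (x1, y) - a (x0, y) * pE b e (x0, y))) -
    ∫ x in x0..x1, (a (x, y1) * qE b e (x, y1) - a (x, y0) * qE b e (x, y0)) := by
  set R := Set.Ioc x0 x1 ×ˢ Set.Ioc y0 y1
  have hR : volume R < ⊤ := by
    rw [Measure.volume_eq_prod, Measure.prod_prod]
    simp [ENNReal.mul_lt_top]
  have : IsFiniteMeasure (volume.restrict R) := ⟨by simpa using hR⟩
  have hca := ha.continuous
  have hcb := hb.continuous
  have hp := pE_cont hcb e
  have hq := qE_cont hcb e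
  have hcd : Continuous (dE b e) := by unfold dE; fun_prop
  have i1 : Integrable (fun z => (grad a z).1 * pE b e z) (volume.restrict R) := by
    refine Integrable.of_bound (C := K * K)
      ((measurable_grad a).fst.mul hp.measurable).aestronglyMeasurable (ae_of_all _ fun z => ?_)
    rw [Real.norm_eq_abs, abs_mul]
    exact mul_le_mul (norm_grad_le ha z).1 (pE_bound hb he z) (abs_nonneg _) K.2
  have i2 : Integrable (fun z => (grad a z).2 * qE b e z) (volume.restrict R) := by
    refine Integrable.of_bound (C := K * K)
      ((measurable_grad a).snd.mul hq.measurable).aestronglyMeasurable (ae_of_all _ fun z => ?_)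
    rw [Real.norm_eq_abs, abs_mul]
    exact mul_le_mul (norm_grad_le ha z).2 (qE_bound hb he z) (abs_nonneg _) K.2
  have i3 : IntegrableOn (fun z => a z * dE b e z) R := by
    have : IntegrableOn (fun z => a z * dE b e z) (Ic x0 x1 ×ˢ Ic y0 y1) :=
      (by fun_prop : Continuous fun z => a z * dE b e z).continuousOn.integrableOn_compact
        (isCompact_Icc.prod isCompact_Icc)
    exact this.mono_set (Set.prod_mono Set.Ioc_subset_Icc_self Set.Ioc_subset_Icc_self)
  rw [integral_sub i1 i2]
  have had := ha.ae_differentiableAt (μ := volume)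
  have c1 : (fun z => (grad a z).1 * pE b e z) =ᵐ[volume.restrict R]
      fun z => deriv (fun x => a (x, z.2)) z.1 * pE b e (z.1, z.2) := by
    filter_upwards [ae_restrict_of_ae had] with z hz
    rw [slice_diff_x hz]
  have c2 : (fun z => (grad a z).2 * qE b e z) =ᵐ[volume.restrict R]
      fun z => deriv (fun y => a (z.1, y)) z.2 * qE b e (z.1, z.2) := by
    filter_upwards [ae_restrict_of_ae had] with z hz
    rw [slice_diff_y hz]
  have hvol : (volume.restrict R : Measure RR) =
      (volume.restrict (Set.Ioc x0 x1)).prod (volume.restrict (Set.Ioc y0 y1)) := by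
    rw [Measure.prod_restrict]; rfl
  have j1 := i1.congr c1
  have j2 := i2.congr c2
  rw [integral_congr_ae c1, integral_congr_ae c2]
  rw [hvol] at j1 j2 ⊢
  have i3' : Integrable (fun z => a z * dE b e z)
    ((volume.restrict (Set.Ioc x0 x1)).prod (volume.restrict (Set.Ioc y0 y1))) := hvol ▸ i3
  rw [integral_prod_symm _ j1, integral_prod _ j2]
  simp only
  simp_rw [← intervalIntegral.integral_of_le hx, ← intervalIntegral.integral_of_le hy]
  have k1 : ∀ y, ∫ x in x0..x1, deriv (fun x => a (x, y)) x * pE b e (x, y) =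
      a (x1, y) * pE b e (x1, y) - a (x0, y) * pE b e (x0, y) - ∫ x in x0..x1, a (x, y) * dE b e (x, y) :=
    fun y => ibp (lip_slice_x ha y) (fun x => pE_hasDeriv hcb e x y) (by fun_prop) _ _
  have k2 : ∀ x, ∫ y in y0..y1, deriv (fun y => a (x, y)) y * qE b e (x, y) =
      a (x, y1) * qE b e (x, y1) - a (x, y0) * qE b e (x, y0) - ∫ y in y0..y1, a (x, y) * dE b e (x, y) :=
    fun x => ibp (lip_slice_y ha x) (fun y => qE_hasDeriv hcb e x y) (by fun_prop) _ _
  simp_rw [k1, k2]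
  have m1 : Continuous fun y => ∫ x in x0..x1, a (x, y) * dE b e (x, y) := by
    apply intervalIntegral.continuous_parametric_intervalIntegral_of_continuous'
    fun_prop
  have m2 : Continuous fun x => ∫ y in y0..y1, a (x, y) * dE b e (x, y) := by
    apply intervalIntegral.continuous_parametric_intervalIntegral_of_continuous'
    fun_prop
  rw [intervalIntegral.integral_sub (Continuous.intervalIntegrable (by fun_prop) _ _)
    (m1.intervalIntegrable _ _),
    intervalIntegral.integral_sub (Continuous.intervalIntegrable (by fun_prop) _ _)
    (m2.intervalIntegrable _ _)]
  have fub : (∫ y in y0..y1, ∫ x in x0..x1, a (x, y) * dE b e (x, y)) =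
      ∫ x in x0..x1, ∫ y in y0..y1, a (x, y) * dE b e (x, y) := by
    have f1 := integral_prod _ i3'
    have f2 := integral_prod_symm _ i3'
    simp_rw [intervalIntegral.integral_of_le hx, intervalIntegral.integral_of_le hy]
    exact f2.symm.trans f1
  rw [fub]; ring
lemma stokes_rect {a b : RR → ℝ} {K : ℝ≥0} (ha : LipschitzWith K a) (hb : LipschitzWith K b)
    {y0 y1 : ℝ} (hy : y0 ≤ y1)
    (hpa : ∀ x, a (x, y1) = a (x, y0)) (hpb : ∀ x y, b (x, y + (y1 - y0)) = b (x, y))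
    (hl : ∀ x ≤ 0, ∀ y, b (x, y) = b (0, 0)) (hr : ∀ x ≥ 1, ∀ y, b (x, y) = b (1, y)) :
    ∫ z in Set.Ioc (-1) 2 ×ˢ Set.Ioc y0 y1, wd (grad a z) (grad b z) =
    ∫ y in y0..y1, a (2, y) * deriv (fun y => b (1, y)) y := by
  have hca := ha.continuous
  have hcb := hb.continuous
  set R := Set.Ioc (-1:ℝ) 2 ×ˢ Set.Ioc y0 y1
  have hR : volume R < ⊤ := by
    rw [Measure.volume_eq_prod, Measure.prod_prod]
    simp [ENNReal.mul_lt_top]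
  have : IsFiniteMeasure (volume.restrict R) := ⟨by simpa using hR⟩
  have t1 : Tendsto (fun e => ∫ z in R, ((grad a z).1 * pE b e z - (grad a z).2 * qE b e z))
      (nhdsWithin 0 (Set.Ioi 0)) (nhds (∫ z in R, wd (grad a z) (grad b z))) := by
    apply tendsto_integral_filter_of_dominated_convergence (fun _ => (K * K + K * K : ℝ))
    · refine Eventually.of_forall fun e => ?_
      exact (((measurable_grad a).fst.mul (pE_cont hcb e).measurable).sub
        ((measurable_grad a).snd.mul (qE_cont hcb e).measurable)).aestronglyMeasurable
    · filter_upwards [self_mem_nhdsWithin] with e he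
      refine ae_of_all _ fun z => ?_
      rw [Real.norm_eq_abs]
      refine (abs_sub _ _).trans ?_
      rw [abs_mul, abs_mul]
      have h1 := norm_grad_le ha z
      exact add_le_add (mul_le_mul h1.1 (pE_bound hb he z) (abs_nonneg _) K.2)
        (mul_le_mul h1.2 (qE_bound hb he z) (abs_nonneg _) K.2)
    · exact integrable_const _
    · filter_upwards [ae_restrict_of_ae (hb.ae_differentiableAt (μ := volume))] with z hz
      exact ((pE_tendsto hcb hz).const_mul _).sub ((qE_tendsto hcb hz).const_mul _)
  have t2 : Tendsto (fun e => ∫ y in y0..y1, a (2, y) * pE b e (2, y))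
      (nhdsWithin 0 (Set.Ioi 0)) (nhds (∫ y in y0..y1, a (2, y) * deriv (fun y => b (1, y)) y)) := by
    obtain ⟨C, hC⟩ := (isCompact_uIcc (a := y0) (b := y1)).exists_bound_of_continuousOn
      (f := fun y => a (2, y)) (by fun_prop)
    apply intervalIntegral.tendsto_integral_filter_of_dominated_convergence (fun _ => (C * K : ℝ))
    · refine Eventually.of_forall fun e => ?_
      have := pE_cont hcb e
      exact (by fun_prop : Continuous fun y => a (2, y) * pE b e (2, y)).aestronglyMeasurable
    · filter_upwards [self_mem_nhdsWithin] with e he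
      refine ae_of_all _ fun y hy => ?_
      rw [norm_mul]
      have := hC y (Set.uIoc_subset_uIcc hy)
      exact mul_le_mul this (pE_bound hb he _) (abs_nonneg _) ((norm_nonneg _).trans this)
    · exact intervalIntegrable_const
    · filter_upwards [(lip_slice_y hb 1).ae_differentiableAt_real] with y hd _
      apply Tendsto.const_mul
      have h1 := hd.hasDerivAt.tendsto_slope_zero_right
      refine h1.congr' ?_
      filter_upwards [self_mem_nhdsWithin] with e he
      have he : 0 < e := he
      have : ∫ s in (2:ℝ)..2 + e, (b (s, y + e) - b (s, y)) =
          ∫ s in (2:ℝ)..2 + e, (b (1, y + e) - b (1, y)) := by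
        apply intervalIntegral.integral_congr
        intro s hs
        rw [Set.uIcc_of_le (by linarith)] at hs
        simp only
        rw [hr s (by linarith [hs.1]), hr s (by linarith [hs.1])]
      rw [pE, this, intervalIntegral.integral_const]
      simp only [add_sub_cancel_left, smul_eq_mul]
      field_simp
  refine tendsto_nhds_unique t1 (t2.congr' ?_)
  filter_upwards [Ioo_mem_nhdsGT (show (0:ℝ) < 1 by norm_num)] with e he
  rw [rect_eps ha hb (by norm_num) hy he.1]
  have z1 : ∀ y, pE b e (-1, y) = 0 := by
    intro y
    have : ∫ s in (-1:ℝ)..-1 + e, (b (s, y + e) - b (s, y)) = ∫ s in (-1:ℝ)..-1 + e, (0:ℝ) := by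
      apply intervalIntegral.integral_congr
      intro s hs
      rw [Set.uIcc_of_le (by linarith [he.1])] at hs
      simp only
      rw [hl s (by linarith [hs.2, he.2]), hl s (by linarith [hs.2, he.2]), sub_self]
    simp [pE, this]
  have z2 : ∀ x, qE b e (x, y1) = qE b e (x, y0) := by
    intro x
    simp only [qE]
    congr 1
    have := intervalIntegral.integral_comp_add_right (a := y0) (b := y0 + e)
      (fun t => b (x + e, t) - b (x, t)) (y1 - y0)
    rw [show y0 + (y1 - y0) = y1 by ring, show y0 + e + (y1 - y0) = y1 + e by ring] at this
    rw [← this]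
    simp only [hpb]
  simp [z1, z2, hpa]
noncomputable def circ (s : ℝ) : RR := (cs (2 * pp * s), sn (2 * pp * s))
noncomputable def clampP (p : RR) : RR :=
  (max 0 (min p.1 1) * cs p.2, max 0 (min p.1 1) * sn p.2)
lemma clampP_lip : LipschitzWith 2 clampP := by
  apply LipschitzWith.of_dist_le_mul
  intro p q
  have h0 : ∀ t : ℝ, 0 ≤ max 0 (min t 1) ∧ max 0 (min t 1) ≤ 1 := fun t => ⟨by simp, by simp⟩
  have h1 : |max 0 (min p.1 1) - max 0 (min q.1 1)| ≤ dist p q := by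
    refine (abs_max_sub_max_le_max _ _ _ _).trans ?_
    simp only [sub_self, abs_zero]
    refine max_le dist_nonneg ((abs_min_sub_min_le_max _ _ _ _).trans ?_)
    simp only [sub_self, abs_zero]
    refine max_le ?_ dist_nonneg
    rw [Prod.dist_eq]; exact le_max_left _ _
  have h2 : |p.2 - q.2| ≤ dist p q := by rw [Prod.dist_eq]; exact le_max_right _ _
  have key : ∀ k k' c c' D : ℝ, 0 ≤ k' → k' ≤ 1 → |c| ≤ 1 → |k - k'| ≤ D → |c - c'| ≤ D →
      |k * c - k' * c'| ≤ 2 * D := by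
    intro k k' c c' D a1 a2 a3 a4 a5
    have : k * c - k' * c' = (k - k') * c + k' * (c - c') := by ring
    rw [this]
    refine (abs_add_le _ _).trans ?_
    rw [abs_mul, abs_mul, abs_of_nonneg a1]
    have := abs_nonneg (k - k')
    have := abs_nonneg (c - c')
    nlinarith [abs_nonneg c]
  rw [Prod.dist_eq]
  refine max_le ?_ ?_
  · exact key _ _ _ _ _ (h0 _).1 (h0 _).2 (Real.abs_cos_le_one _) h1
      ((Real.abs_cos_sub_cos_le _ _).trans h2)
  · exact key _ _ _ _ _ (h0 _).1 (h0 _).2 (Real.abs_sin_le_one _) h1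
      ((Real.abs_sin_sub_sin_le _ _).trans h2)
lemma polar_grad {a : RR → ℝ} {p : RR} (h0 : 0 < p.1) (h1 : p.1 < 1)
    (hd : DifferentiableAt ℝ a (polarCoord.symm p)) :
    grad (fun q => a (clampP q)) p =
      ((grad a (polarCoord.symm p)).1 * cs p.2 + (grad a (polarCoord.symm p)).2 * sn p.2,
       p.1 * (-(grad a (polarCoord.symm p)).1 * sn p.2 +
        (grad a (polarCoord.symm p)).2 * cs p.2)) := by
  have ev : (fun q => a (clampP q)) =ᶠ[nhds p] fun q => a (polarCoord.symm q) := by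
    have : ∀ᶠ q : RR in nhds p, 0 < q.1 ∧ q.1 < 1 :=
      ((isOpen_lt continuous_const continuous_fst).inter
        (isOpen_lt continuous_fst continuous_const)).mem_nhds ⟨h0, h1⟩
    filter_upwards [this] with q hq
    simp [clampP, polarCoord, min_eq_left hq.2.le, max_eq_right hq.1.le]
  have hc := hd.hasFDerivAt.comp p (hasFDerivAt_polarCoord_symm p)
  have e : fderiv ℝ (fun q => a (clampP q)) p =
    (fderiv ℝ a (polarCoord.symm p)).comp (fderivPolarCoordSymm p) := by
    rw [ev.fderiv_eq]; exact hc.fderiv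
  unfold grad
  rw [e]
  simp only [ContinuousLinearMap.comp_apply, ← dt_grad a]
  simp [fderivPolarCoordSymm, dt, grad, Matrix.toLin_finTwoProd_toContinuousLinearMap]
  ring
lemma grad_fst_zero {a : RR → ℝ} {p : RR}
    (h : ∀ᶠ t in nhds p.1, a (t, p.2) = a p) : (grad a p).1 = 0 := by
  by_cases hd : DifferentiableAt ℝ a p
  · rw [← slice_diff_x hd]
    have : (fun x => a (x, p.2)) =ᶠ[nhds p.1] fun _ => a p := h
    rw [this.deriv_eq]; simp
  · simp [grad, fderiv_zero_of_not_differentiableAt hd]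
lemma ae_polar {N : RR → Prop} (h : ∀ᵐ z, N z) :
    ∀ᵐ p, p ∈ polarCoord.target → N (polarCoord.symm p) := by
  have h1 : ∫⁻ z, ({z | ¬ N z} : Set RR).indicator (fun _ => (1:ℝ≥0∞)) z = 0 := by
    rw [lintegral_eq_zero_of_ae_eq_zero]
    filter_upwards [h] with z hz
    simp [hz]
  set S := toMeasurable volume {z | ¬ N z} with hS
  have h2 : ∫⁻ z, S.indicator (fun _ => (1:ℝ≥0∞)) z = 0 := by
    rw [lintegral_indicator (measurableSet_toMeasurable _ _)]
    simp [hS, ae_iff.1 h]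
  rw [← lintegral_comp_polarCoord_symm] at h2
  have hm : Measurable fun p : RR => eR p.1 • S.indicator (fun _ => (1:ℝ≥0∞))
      (polarCoord.symm p) := by
    have := (Measurable.indicator (mβ := inferInstance) (measurable_const (a := (1:ℝ≥0∞))) (measurableSet_toMeasurable volume {z | ¬ N z}))
    exact (ENNReal.measurable_ofReal.comp measurable_fst).smul
      (this.comp continuous_polarCoord_symm.measurable)
  rw [lintegral_eq_zero_iff hm] at h2
  have h3 := (ae_restrict_iff' polarCoord.open_target.measurableSet).1 h2
  filter_upwards [h3] with p hp hpt
  by_contra hN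
  have := hp hpt
  have hs : polarCoord.symm p ∈ S := subset_toMeasurable _ _ hN
  rw [Pi.zero_apply, Set.indicator_of_mem hs] at this
  simp at this
  exact absurd hpt.1 (not_lt.2 this)
lemma measurableSet_D2 : MeasurableSet D2 := by
  have : IsClosed D2 := by
    unfold D2; exact isClosed_le (by fun_prop) (by fun_prop)
  exact this.measurableSet
lemma stokes_angle {a b : RR → ℝ} {K : ℝ≥0} (ha : LipschitzWith K a) (hb : LipschitzWith K b) :
    ∫ z in D2, wd (grad a z) (grad b z) =
      ∫ θ in -Real.pi..Real.pi, a (cs θ, sn θ) *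
        deriv (fun θ => b (cs θ, sn θ)) θ := by
  have hpi := Real.pi_pos
  have S := stokes_rect (a := fun q => a (clampP q)) (b := fun q => b (clampP q))
    (ha.comp clampP_lip) (hb.comp clampP_lip) (y0 := -pp) (y1 := pp) (by linarith)
    (by intro x; simp [clampP])
    (by intro x y; rw [show pp - -pp = 2 * pp by ring]; simp [clampP])
    (by intro x hx y; simp [clampP, hx])
    (by intro x hx y; simp [clampP, min_eq_right hx])
  have e1 : ∀ θ, clampP (1, θ) = (cs θ, sn θ) := by intro θ; simp [clampP]
  have e2 : ∀ θ, clampP (2, θ) = (cs θ, sn θ) := by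
    intro θ; simp [clampP]
  simp only [e1, e2] at S
  rw [← S, ← integral_indicator measurableSet_D2, ← integral_comp_polarCoord_symm,
    ← integral_indicator polarCoord.open_target.measurableSet,
    ← integral_indicator (measurableSet_Ioc.prod measurableSet_Ioc)]
  apply integral_congr_ae
  have n1 : ∀ c : ℝ, ∀ᵐ p : RR, p.1 ≠ c := fun c =>
    (Measure.quasiMeasurePreserving_fst (μ := (volume : Measure ℝ)) (ν := (volume : Measure ℝ))).ae
      (Measure.ae_ne volume c)
  have n2 : ∀ c : ℝ, ∀ᵐ p : RR, p.2 ≠ c := fun c =>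
    (Measure.quasiMeasurePreserving_snd (μ := (volume : Measure ℝ)) (ν := (volume : Measure ℝ))).ae
      (Measure.ae_ne volume c)
  filter_upwards [n1 0, n1 1, n2 pp, ae_polar (ha.ae_differentiableAt (μ := volume)),
    ae_polar (hb.ae_differentiableAt (μ := volume))] with p h0 h1 h2 h3 h4
  rcases lt_or_gt_of_ne h0 with h0 | h0
  · have z : ∀ a : RR → ℝ, (grad (fun q => a (clampP q)) p) = 0 := by
      intro a
      have : (fun q => a (clampP q)) =ᶠ[nhds p] fun _ => a (0, 0) := by
        filter_upwards [(isOpen_lt continuous_fst continuous_const).mem_nhds h0] with q hq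
        have : min q.1 1 ≤ 0 := min_le_iff.2 (Or.inl (le_of_lt hq))
        simp [clampP, max_eq_left this]
      simp [grad, this.fderiv_eq]
    rw [Set.indicator_of_notMem (by simp [polarCoord, h0.le])]
    simp only [Set.indicator, z, wd]
    simp
  rcases lt_or_gt_of_ne h1 with h1 | h1
  · by_cases hp : p ∈ polarCoord.target
    · have hp' : p ∈ Set.Ioc (-1:ℝ) 2 ×ˢ Set.Ioc (-pp) pp :=
        ⟨⟨by linarith, by linarith⟩, ⟨hp.2.1, hp.2.2.le⟩⟩
      have hD : polarCoord.symm p ∈ D2 := by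
        simp only [polarCoord, D2, Set.mem_ofPred_eq]
        simp only [OpenPartialHomeomorph.coe_mk_symm, PartialEquiv.coe_symm_mk]
        have : (p.1 * cs p.2) ^ 2 + (p.1 * sn p.2) ^ 2 = p.1 ^ 2 := by
          linear_combination p.1 ^ 2 * Real.cos_sq_add_sin_sq p.2
        rw [this]; nlinarith
      rw [Set.indicator_of_mem hp, Set.indicator_of_mem hp', Set.indicator_of_mem hD,
        polar_grad h0 h1 (h3 hp), polar_grad h0 h1 (h4 hp)]
      simp only [wd, smul_eq_mul]
      linear_combination (-p.1 * ((grad a (polarCoord.symm p)).1 * (grad b (polarCoord.symm p)).2 - (grad a (polarCoord.symm p)).2 * (grad b (polarCoord.symm p)).1)) * Real.cos_sq_add_sin_sq p.2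
    · rw [Set.indicator_of_notMem hp, Set.indicator_of_notMem]
      intro hp'
      exact hp ⟨h0, hp'.2.1, lt_of_le_of_ne hp'.2.2 h2⟩
  · have z : ∀ a : RR → ℝ, (grad (fun q => a (clampP q)) p).1 = 0 := by
      intro a
      apply grad_fst_zero
      filter_upwards [lt_mem_nhds h1] with t ht
      simp [clampP, min_eq_right ht.le, min_eq_right h1.le]
    have hD : polarCoord.symm p ∉ D2 := by
      simp only [polarCoord, D2, Set.mem_ofPred_eq]
      simp only [OpenPartialHomeomorph.coe_mk_symm, PartialEquiv.coe_symm_mk]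
      have : (p.1 * cs p.2) ^ 2 + (p.1 * sn p.2) ^ 2 = p.1 ^ 2 := by
        linear_combination p.1 ^ 2 * Real.cos_sq_add_sin_sq p.2
      rw [this]; nlinarith
    simp only [Set.indicator, hD, wd, z]
    simp
lemma stokes {a b : RR → ℝ} {K : ℝ≥0} (ha : LipschitzWith K a) (hb : LipschitzWith K b) :
    ∫ z in D2, wd (grad a z) (grad b z) =
      ∫ s in (0:ℝ)..1, a (circ s) * deriv (fun s => b (circ s)) s := by
  have hpi := Real.pi_pos
  rw [stokes_angle ha hb]
  set G := fun θ => a (cs θ, sn θ) * deriv (fun θ => b (cs θ, sn θ)) θ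
  have hper : Function.Periodic G (2 * pp) := by
    intro θ
    have e : (fun θ => b (cs θ, sn θ)) =
      fun θ => (fun θ => b (cs θ, sn θ)) (θ + 2 * pp) := by ext; simp
    simp only [G]
    congr 1
    · simp
    · conv_rhs => rw [e]
      exact (deriv_comp_add_const (fun θ => b (cs θ, sn θ)) (2 * pp) θ).symm
  have h1 := hper.intervalIntegral_add_eq (-pp) 0
  rw [show -pp + 2 * pp = pp by ring, zero_add] at h1
  rw [h1]
  have h2 := intervalIntegral.mul_integral_comp_mul_left (a := 0) (b := 1) (f := G) (c := 2 * pp)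
  rw [mul_zero, mul_one] at h2
  rw [← h2, ← intervalIntegral.integral_const_mul]
  apply intervalIntegral.integral_congr
  intro s _
  simp only [G, circ]
  have := deriv_comp_mul_left (2 * pp) (fun θ => b (cs θ, sn θ)) s
  simp only [smul_eq_mul] at this
  rw [this]; ring
lemma neg_type {ι : Type*} [Fintype ι] (x c : ι → ℝ) (hc : ∑ i, c i = 0) :
    ∑ i, ∑ j, c i * c j * |x i - x j| ≤ 0 := by
  have key : ∀ a b : ℝ, Integrable (fun t => (Set.Ico (min a b) (max a b)).indicator (fun _ => (1:ℝ)) t) ∧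
      |a - b| = ∫ t, (Set.Ico (min a b) (max a b)).indicator (fun _ => (1:ℝ)) t := by
    intro a b
    constructor
    · exact (integrable_indicator_iff measurableSet_Ico).2 (by simp)
    · rw [integral_indicator measurableSet_Ico]
      simp [max_sub_min_eq_abs, abs_sub_comm]
  have h2 : ∀ a b t : ℝ, (Set.Ico (min a b) (max a b)).indicator (fun _ => (1:ℝ)) t
      = ((if a ≤ t then 1 else 0) - (if b ≤ t then 1 else 0)) ^ 2 := by
    intro a b t
    simp only [Set.indicator_apply, Set.mem_Ico, min_le_iff, lt_max_iff]
    by_cases h1 : a ≤ t <;> by_cases h2 : b ≤ t <;> simp [h1, h2] <;> grind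
  have e1 : ∑ i, ∑ j, c i * c j * |x i - x j| = ∫ t, ∑ i, ∑ j, c i * c j *
      (Set.Ico (min (x i) (x j)) (max (x i) (x j))).indicator (fun _ => (1:ℝ)) t := by
    rw [integral_finsetSum]
    · refine Finset.sum_congr rfl fun i _ => ?_
      rw [integral_finsetSum]
      · refine Finset.sum_congr rfl fun j _ => ?_
        rw [integral_const_mul, (key _ _).2]
      · exact fun j _ => (key _ _).1.const_mul _
    · exact fun i _ => integrable_finsetSum _ fun j _ => (key _ _).1.const_mul _
  rw [e1]
  refine integral_nonpos fun t => ?_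
  simp only [h2, Pi.zero_apply]
  set z : ι → ℝ := fun i => if x i ≤ t then 1 else 0
  have : ∑ i, ∑ j, c i * c j * (z i - z j) ^ 2 = 2 * (∑ i, c i * z i ^ 2) * (∑ j, c j)
      - 2 * (∑ i, c i * z i) ^ 2 := by
    rw [pow_two (∑ i, c i * z i), mul_assoc, Finset.sum_mul_sum, Finset.sum_mul_sum, Finset.mul_sum, Finset.mul_sum]
    have h3 : ∑ i, ∑ j, c i * c j * (z i - z j) ^ 2 = ∑ i, ∑ j, (c i * z i ^ 2 * c j) + ∑ i, ∑ j, c j * z j ^ 2 * c i - ∑ i, ∑ j, 2 * (c i * z i * (c j * z j)) := by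
      rw [← Finset.sum_add_distrib, ← Finset.sum_sub_distrib]
      refine Finset.sum_congr rfl fun i _ => ?_
      rw [← Finset.sum_add_distrib, ← Finset.sum_sub_distrib]
      refine Finset.sum_congr rfl fun j _ => ?_
      ring
    rw [h3, Finset.sum_comm (f := fun i j => c j * z j ^ 2 * c i)]
    simp only [Finset.mul_sum, two_mul, Finset.sum_add_distrib]
  show ∑ i, ∑ j, c i * c j * (z i - z j) ^ 2 ≤ 0
  rw [this, hc]
  nlinarith [sq_nonneg (∑ i, c i * z i)]
lemma exists_slope (s : Finset RR) : ∃ t : ℝ, ∀ w ∈ s, w ≠ 0 → w.1 + t * w.2 ≠ 0 := by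
  classical
  obtain ⟨t, ht⟩ := Infinite.exists_notMem_finset (s.image fun w => - w.1 / w.2)
  refine ⟨t, fun w hw h0 h => ht (Finset.mem_image.2 ⟨w, hw, ?_⟩)⟩
  by_cases h2 : w.2 = 0
  · exact absurd (Prod.ext (by simpa [h2] using h) h2) h0
  · field_simp; linarith
lemma neg_wd {ι : Type*} [Fintype ι] (w : ι → RR) (c : ι → ℝ) (t : ℝ)
    (ht : ∀ i, w i ≠ 0 → (w i).1 + t * (w i).2 ≠ 0)
    (hc : ∑ i, c i * |(w i).1 + t * (w i).2| = 0) :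
    ∑ i, ∑ j, c i * c j * |wd (w i) (w j)| ≤ 0 := by
  have := neg_type (fun i => (w i).2 / ((w i).1 + t * (w i).2)) _ hc
  refine le_of_eq_of_le ?_ this
  refine Finset.sum_congr rfl fun i _ => Finset.sum_congr rfl fun j _ => ?_
  by_cases hi : w i = 0
  · simp [hi, wd]
  by_cases hj : w j = 0
  · simp [hj, wd]
  have h1 := ht i hi
  have h2 := ht j hj
  have : wd (w i) (w j) = ((w i).1 + t * (w i).2) * ((w j).1 + t * (w j).2) *
    ((w j).2 / ((w j).1 + t * (w j).2) - (w i).2 / ((w i).1 + t * (w i).2)) := by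
    field_simp; simp only [wd]; ring
  rw [this, abs_mul, abs_mul, abs_sub_comm]; ring
lemma rev_cs {ι κ : Type*} [Fintype ι] [Fintype κ] (w : ι → RR) (p : ι → ℝ)
    (e : κ → RR) :
    (∑ i, ∑ j, p i * p j * |wd (w i) (w j)|) * (∑ k, ∑ l, |wd (e k) (e l)|) ≤
      (∑ i, ∑ k, p i * |wd (w i) (e k)|) ^ 2 := by
  classical
  obtain ⟨t, ht⟩ := exists_slope (Finset.univ.image (Sum.elim w e))
  have ht' : ∀ i, Sum.elim w e i ≠ 0 → (Sum.elim w e i).1 + t * (Sum.elim w e i).2 ≠ 0 :=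
    fun i => ht _ (Finset.mem_image_of_mem _ (Finset.mem_univ _))
  set b : ℝ := ∑ k, |(e k).1 + t * (e k).2| with hb
  by_cases hb0 : b = 0
  · have : ∀ k, e k = 0 := by
      intro k
      have h1 := (Finset.sum_eq_zero_iff_of_nonneg (fun _ _ => abs_nonneg _)).1 (hb ▸ hb0) k (Finset.mem_univ _)
      by_contra h2
      exact ht' (Sum.inr k) h2 (abs_eq_zero.1 h1)
    simp [this, wd]
  set a : ℝ := ∑ i, p i * |(w i).1 + t * (w i).2|
  have h := neg_wd (Sum.elim w e) (Sum.elim p fun _ => - (a / b)) t ht' (by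
    simp only [Fintype.sum_sum_type, Sum.elim_inl, Sum.elim_inr]
    rw [← Finset.mul_sum, ← hb]; field_simp; simp [a])
  simp only [Fintype.sum_sum_type, Sum.elim_inl, Sum.elim_inr] at h
  set A := ∑ i, ∑ j, p i * p j * |wd (w i) (w j)|
  set E := ∑ k, ∑ l, |wd (e k) (e l)| with hE
  set C := ∑ i, ∑ k, p i * |wd (w i) (e k)| with hC
  set s := a / b
  have hE0 : 0 ≤ E := Finset.sum_nonneg fun _ _ => Finset.sum_nonneg fun _ _ => abs_nonneg _
  have e1 : ∑ i, (∑ j, p i * p j * |wd (w i) (w j)| + ∑ k, p i * -s * |wd (w i) (e k)|) = A - s * C := by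
    rw [Finset.sum_add_distrib, hC, Finset.mul_sum, sub_eq_add_neg, ← Finset.sum_neg_distrib]
    congr 1
    refine Finset.sum_congr rfl fun i _ => ?_
    rw [Finset.mul_sum, ← Finset.sum_neg_distrib]
    exact Finset.sum_congr rfl fun k _ => by ring
  have e2 : ∑ k, (∑ i, -s * p i * |wd (e k) (w i)| + ∑ l, -s * -s * |wd (e k) (e l)|) = - s * C + s ^ 2 * E := by
    rw [Finset.sum_add_distrib, hC, hE, Finset.mul_sum, Finset.mul_sum, Finset.sum_comm]
    congr 1
    · refine Finset.sum_congr rfl fun i _ => ?_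
      rw [Finset.mul_sum]
      refine Finset.sum_congr rfl fun k _ => ?_
      have : |wd (e k) (w i)| = |wd (w i) (e k)| := by
        rw [← abs_neg]; congr 1; simp only [wd]; ring
      rw [this]; ring
    · refine Finset.sum_congr rfl fun k _ => ?_
      rw [Finset.mul_sum]
      exact Finset.sum_congr rfl fun l _ => by ring
  rw [e1, e2] at h
  nlinarith [sq_nonneg (s * E - C), mul_nonneg hE0 (sub_nonneg.2 h)]
lemma edges_lower (v : ℕ → RR) (m : ℕ) :
    2 * ∑ k ∈ rg m, wd (v k - v 0) (v (k + 1) - v k) ≤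
      ∑ k ∈ rg m, ∑ l ∈ rg m, |wd (v (k + 1) - v k) (v (l + 1) - v l)| := by
  induction m with
  | zero => simp
  | succ m ih =>
    rw [Finset.sum_range_succ, Finset.sum_range_succ]
    simp only [Finset.sum_range_succ _ m, Finset.sum_add_distrib]
    have h1 : |wd (v m - v 0) (v (m + 1) - v m)| ≤ ∑ k ∈ rg m, |wd (v (k + 1) - v k) (v (m + 1) - v m)| := by
      have : wd (v m - v 0) (v (m + 1) - v m) = ∑ k ∈ rg m, wd (v (k + 1) - v k) (v (m + 1) - v m) := by
        have hs := Finset.sum_range_sub v m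
        rw [← hs]
        simp only [wd, Prod.fst_sum, Prod.snd_sum]
        rw [Finset.sum_sub_distrib, Finset.sum_mul, Finset.sum_mul]
      rw [this]; exact Finset.abs_sum_le_sum_abs _ _
    have h2 : ∑ k ∈ rg m, |wd (v (m + 1) - v m) (v (k + 1) - v k)| = ∑ k ∈ rg m, |wd (v (k + 1) - v k) (v (m + 1) - v m)| := by
      refine Finset.sum_congr rfl fun k _ => ?_
      rw [← abs_neg]; congr 1; simp only [wd]; ring
    have := le_abs_self (wd (v m - v 0) (v (m + 1) - v m))
    have h3 : (0:ℝ) ≤ |wd (v (m + 1) - v m) (v (m + 1) - v m)| := abs_nonneg _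
    rw [h2]
    linarith
noncomputable def ev (t : ℝ) : RR := (cs t, sn t)
structure IsNm (N : RR → ℝ) : Prop where
  pos : ∀ x, x ≠ 0 → 0 < N x
  add : ∀ x y, N (x + y) ≤ N x + N y
  smul : ∀ (t : ℝ) x, N (t • x) = |t| * N x
  cont : Continuous N
lemma ev_ne (t : ℝ) : ev t ≠ 0 := by
  intro h
  have h1 : cs t = 0 := congrArg Prod.fst h
  have h2 : sn t = 0 := congrArg Prod.snd h
  nlinarith [Real.sin_sq_add_cos_sq t]
lemma ev_pi (t : ℝ) : ev (t + pp) = - ev t := by simp [ev]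
lemma ev_cont : Continuous ev := by unfold ev; fun_prop
lemma wd_ev (s t : ℝ) : wd (ev s) (ev t) = sn (t - s) := by
  simp only [wd, ev, Real.sin_sub]; ring
lemma ev_three (a b c : ℝ) : sn (c - a) • ev b = sn (c - b) • ev a + sn (b - a) • ev c := by
  simp only [ev, Real.sin_sub]
  have := Real.sin_sq_add_cos_sq a
  have := Real.sin_sq_add_cos_sq c
  ext <;> simp <;> ring_nf
variable {N : RR → ℝ}
lemma IsNm.ev_pos (hN : IsNm N) (t : ℝ) : 0 < N (ev t) := hN.pos _ (ev_ne t)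
lemma IsNm.neg (hN : IsNm N) (x : RR) : N (-x) = N x := by
  have := hN.smul (-1) x
  simpa using this
lemma dt_add (g x y : RR) : dt g (x + y) = dt g x + dt g y := by simp [dt]; ring
lemma dt_sub (g x y : RR) : dt g (x - y) = dt g x - dt g y := by simp [dt]; ring
lemma dt_smul (g x : RR) (t : ℝ) : dt g (t • x) = t * dt g x := by simp [dt]; ring
lemma dt_neg (g x : RR) : dt g (-x) = - dt g x := by simp [dt]; ring
lemma mono_step (hN : IsNm N) {g : RR} {s t u : ℝ} (hst : s < t) (htu : t < u) (hus : u - s < pp)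
    (h : |dt g (ev u)| / N (ev u) ≤ dt g (ev s) / N (ev s)) :
    dt g (ev u) / N (ev u) ≤ dt g (ev t) / N (ev t) := by
  have hs := hN.ev_pos s
  have ht := hN.ev_pos t
  have hu := hN.ev_pos u
  have s1 : 0 < sn (u - s) := Real.sin_pos_of_pos_of_lt_pi (by linarith) hus
  have s2 : 0 < sn (u - t) := Real.sin_pos_of_pos_of_lt_pi (by linarith) (by linarith)
  have s3 : 0 < sn (t - s) := Real.sin_pos_of_pos_of_lt_pi (by linarith) (by linarith)
  have id := ev_three s t u
  have n1 : sn (u - s) * N (ev t) ≤ sn (u - t) * N (ev s) + sn (t - s) * N (ev u) := by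
    have := hN.add (sn (u - t) • ev s) (sn (t - s) • ev u)
    rw [← id] at this
    simpa only [hN.smul, abs_of_pos, s1, s2, s3] using this
  have n2 : sn (t - s) * N (ev u) ≤ sn (u - s) * N (ev t) + sn (u - t) * N (ev s) := by
    have := hN.add (sn (u - s) • ev t) (-(sn (u - t) • ev s))
    rw [id, add_neg_cancel_comm, hN.neg] at this
    have h2 := hN.smul (sn (u - s)) (ev t)
    rw [id] at h2
    rw [h2] at this
    simpa only [hN.smul, abs_of_pos, s1, s2, s3] using this
  have d : sn (u - s) * dt g (ev t) = sn (u - t) * dt g (ev s) + sn (t - s) * dt g (ev u) := by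
    have := congrArg (dt g) id
    simpa only [dt_add, dt_smul] using this
  set A := dt g (ev s) / N (ev s) with hA
  set B := dt g (ev t) / N (ev t) with hB
  set C := dt g (ev u) / N (ev u) with hC
  have eA : dt g (ev s) = A * N (ev s) := by rw [hA]; field_simp
  have eB : dt g (ev t) = B * N (ev t) := by rw [hB]; field_simp
  have eC : dt g (ev u) = C * N (ev u) := by rw [hC]; field_simp
  have hCA : |C| ≤ A := by rw [hC, abs_div, abs_of_pos hu]; exact h
  rw [eA, eB, eC] at d
  set P := sn (u - s) * N (ev t)
  set Q := sn (u - t) * N (ev s)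
  set R := sn (t - s) * N (ev u)
  have hP : 0 < P := mul_pos s1 ht
  have hQ : 0 < Q := mul_pos s2 hs
  have hR : 0 < R := mul_pos s3 hu
  have d' : P * B = Q * A + R * C := by simp only [P, Q, R]; linarith
  refine le_of_mul_le_mul_left ?_ hP
  rw [d']
  rcases abs_cases C with ⟨h1, h2⟩ | ⟨h1, h2⟩
  · nlinarith
  · nlinarith
lemma sum_shift {F : ℕ → ℝ} {m : ℕ} (hF : ∀ k, F (k + m) = F k) (k0 : ℕ) :
    ∑ k ∈ rg m, F (k0 + k) = ∑ k ∈ rg m, F k := by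
  induction k0 with
  | zero => simp
  | succ n ih =>
    rw [← ih]
    have h1 := Finset.sum_range_succ (fun k => F (n + k)) m
    have h2 := Finset.sum_range_succ' (fun k => F (n + k)) m
    rw [h2] at h1
    simp only [hF, add_zero] at h1
    have : ∀ k, F (n + 1 + k) = F (n + (k + 1)) := fun k => by congr 1; ring
    simp only [this]
    linarith
lemma tv_half (hN : IsNm N) {g : RR} (hg : ∀ x, |dt g x| ≤ N x) {m : ℕ} (hm : 0 < m) (t0 : ℝ) :
    ∑ k ∈ rg m, |dt g (ev (t0 + (k + 1 : ℕ) * (pp / m))) / N (ev (t0 + (k + 1 : ℕ) * (pp / m)))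
      - dt g (ev (t0 + k * (pp / m))) / N (ev (t0 + k * (pp / m)))| ≤ 2 := by
  set a : ℕ → ℝ := fun k => dt g (ev (t0 + k * (pp / m))) / N (ev (t0 + k * (pp / m))) with ha
  show ∑ k ∈ rg m, |a (k + 1) - a k| ≤ 2
  have hm' : (0:ℝ) < m := by exact_mod_cast hm
  have hpi := Real.pi_pos
  have aper : ∀ k, a (k + m) = - a k := by
    intro k
    have : t0 + (k + m : ℕ) * (pp / m) = t0 + k * (pp / m) + pp := by
      push_cast; field_simp; ring
    simp only [ha, this, ev_pi, dt_neg, hN.neg, neg_div]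
  have ab : ∀ k, |a k| ≤ 1 := fun k => by
    simp only [ha, abs_div, abs_of_pos (hN.ev_pos _)]
    exact (div_le_one (hN.ev_pos _)).2 (hg _)
  obtain ⟨k0, -, hk0⟩ := Finset.exists_max_image (rg m) (fun k => |a k|) ⟨0, by simpa⟩
  have hmax : ∀ k, |a k| ≤ |a k0| := by
    intro k
    have h1 : ∀ j r, |a (r + m * j)| = |a r| := by
      intro j
      induction j with
      | zero => simp
      | succ j ih =>
        intro r
        have : r + m * (j + 1) = (r + m * j) + m := by ring
        rw [this, aper, abs_neg, ih]
    have := h1 (k / m) (k % m)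
    rw [Nat.mod_add_div] at this
    rw [this]
    exact hk0 _ (Finset.mem_range.2 (Nat.mod_lt _ hm))
  rw [← sum_shift (F := fun k => |a (k + 1) - a k|) (m := m) (fun k => by
    show |a (k + m + 1) - a (k + m)| = _
    rw [show k + m + 1 = k + 1 + m by ring, aper, aper, ← abs_neg]; congr 1; ring) k0]
  show ∑ k ∈ rg m, |a (k0 + k + 1) - a (k0 + k)| ≤ 2
  have hlt : ∀ i j : ℕ, i < j → t0 + i * (pp / m) < t0 + j * (pp / m) := by
    intro i j hij
    have : (i:ℝ) < j := by exact_mod_cast hij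
    have := mul_lt_mul_of_pos_right this (div_pos hpi hm')
    linarith
  have hspan : ∀ k, k + 1 < m → t0 + (k0 + k + 1 : ℕ) * (pp / m) - (t0 + k0 * (pp / m)) < pp := by
    intro k hk
    have h1 : ((k:ℝ) + 1) < m := by exact_mod_cast hk
    have : t0 + (k0 + k + 1 : ℕ) * (pp / m) - (t0 + k0 * (pp / m)) = (k + 1) * (pp / m) := by
      push_cast; ring
    rw [this]
    calc ((k:ℝ) + 1) * (pp / m) < m * (pp / m) := by gcongr
      _ = pp := by field_simp
  rcases le_total 0 (a k0) with h0 | h0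
  · have hmono : ∀ k < m, a (k0 + k + 1) ≤ a (k0 + k) := by
      intro k hk
      rcases Nat.eq_zero_or_pos k with rfl | hkp
      · have := hmax (k0 + 0 + 1); rw [abs_of_nonneg h0] at this
        exact (le_abs_self _).trans this
      rcases Nat.lt_or_ge (k + 1) m with h1 | h1
      · refine mono_step hN (g := g) (hlt k0 (k0 + k) (by omega)) (hlt (k0 + k) (k0 + k + 1) (by omega)) (hspan k h1) ?_
        have := hmax (k0 + k + 1); rw [abs_of_nonneg h0] at this
        simpa only [ha, abs_div, abs_of_pos (hN.ev_pos _)] using this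
      · have : k0 + k + 1 = k0 + m := by omega
        rw [this, aper]
        have := hmax (k0 + k); rw [abs_of_nonneg h0] at this
        exact neg_le_of_abs_le this
    calc _ = ∑ k ∈ rg m, (a (k0 + k) - a (k0 + (k + 1))) := by
          refine Finset.sum_congr rfl fun k hk => ?_
          rw [abs_of_nonpos (sub_nonpos.2 (hmono k (Finset.mem_range.1 hk))), neg_sub, add_assoc]
      _ = a k0 - a (k0 + m) := by rw [Finset.sum_range_sub' (fun k => a (k0 + k)) m]; rfl
      _ ≤ 2 := by rw [aper]; have := (abs_le.1 (ab k0)).2; linarith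
  · have hmono : ∀ k < m, a (k0 + k) ≤ a (k0 + k + 1) := by
      intro k hk
      rcases Nat.eq_zero_or_pos k with rfl | hkp
      · have := hmax (k0 + 0 + 1); rw [abs_of_nonpos h0] at this
        show a k0 ≤ _
        linarith [neg_le_of_abs_le this]
      rcases Nat.lt_or_ge (k + 1) m with h1 | h1
      · have := mono_step hN (g := -g) (hlt k0 (k0 + k) (by omega)) (hlt (k0 + k) (k0 + k + 1) (by omega)) (hspan k h1) (by
          have := hmax (k0 + k + 1); rw [abs_of_nonpos h0] at this
          simp only [ha, abs_div, abs_of_pos (hN.ev_pos _)] at this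
          have e : ∀ x, dt (-g) x = - dt g x := fun x => by simp [dt]; ring
          rw [e, e, abs_neg, neg_div]
          exact this)
        have e : ∀ x, dt (-g) x = - dt g x := fun x => by simp [dt]; ring
        rw [e, e, neg_div, neg_div] at this
        exact neg_le_neg_iff.1 this
      · have : k0 + k + 1 = k0 + m := by omega
        rw [this, aper]
        have := hmax (k0 + k); rw [abs_of_nonpos h0] at this
        exact (le_abs_self _).trans this
    calc _ = ∑ k ∈ rg m, (a (k0 + (k + 1)) - a (k0 + k)) := by
          refine Finset.sum_congr rfl fun k hk => ?_
          rw [abs_of_nonneg (sub_nonneg.2 (hmono k (Finset.mem_range.1 hk))), add_assoc]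
      _ = a (k0 + m) - a k0 := by rw [Finset.sum_range_sub (fun k => a (k0 + k)) m]; rfl
      _ ≤ 2 := by rw [aper]; have := (abs_le.1 (ab k0)).1; linarith
variable {N : RR → ℝ}
lemma wd_smul (a b : ℝ) (x y : RR) : wd (a • x) (b • y) = a * b * wd x y := by
  simp only [wd, Prod.smul_fst, Prod.smul_snd, smul_eq_mul]; ring
lemma calib_poly (hN : IsNm N) {ι : Type*} [Fintype ι] (g : ι → RR) (p : ι → ℝ) (hp : ∀ i, 0 ≤ p i)
    (hp1 : ∑ i, p i = 1) (hg : ∀ i x, |dt (g i) x| ≤ N x) {m : ℕ} (hm : 0 < m) (t0 : ℝ) :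
    (∑ i, ∑ j, p i * p j * |wd (g i) (g j)|) * (sn (pp / m) * ∑ k ∈ rg m,
      (N (ev (t0 + k * (pp / m))))⁻¹ * (N (ev (t0 + k * (pp / m) + pp / m)))⁻¹) ≤ 2 := by
  set v : ℕ → RR := fun k => (N (ev (t0 + k * (pp / m))))⁻¹ • ev (t0 + k * (pp / m)) with hv
  have hm' : (0:ℝ) < m := by exact_mod_cast hm
  set A := ∑ i, ∑ j, p i * p j * |wd (g i) (g j)|
  have hA : 0 ≤ A := Finset.sum_nonneg fun i _ => Finset.sum_nonneg fun j _ =>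
    mul_nonneg (mul_nonneg (hp i) (hp j)) (abs_nonneg _)
  have h1 := rev_cs (fun i => ((g i).2, -(g i).1)) p (fun k : Fin m => v (k + 1) - v k)
  have e1 : ∀ i j, wd ((g i).2, -(g i).1) ((g j).2, -(g j).1) = wd (g i) (g j) := by
    intro i j; simp only [wd]; ring
  have e2 : ∀ i x, wd ((g i).2, -(g i).1) x = dt (g i) x := by
    intro i x; simp only [wd, dt]; ring
  simp only [e1, e2] at h1
  have h2 := edges_lower v m
  have vm : v m = - v 0 := by
    have : t0 + (m:ℝ) * (pp / m) = t0 + pp := by field_simp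
    simp only [hv, this, ev_pi, hN.neg]; simp
  have hS : ∑ k ∈ rg m, wd (v k - v 0) (v (k + 1) - v k) = ∑ k ∈ rg m, wd (v k) (v (k + 1)) := by
    have : ∀ k, wd (v k - v 0) (v (k + 1) - v k) = wd (v k) (v (k + 1)) - (wd (v 0) (v (k + 1)) - wd (v 0) (v k)) := by
      intro k; simp only [wd, Prod.fst_sub, Prod.snd_sub]; ring
    simp only [this]
    rw [Finset.sum_sub_distrib, Finset.sum_range_sub (fun k => wd (v 0) (v k)), vm]
    simp only [wd, Prod.fst_neg, Prod.snd_neg]; ring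
  have hS2 : sn (pp / m) * ∑ k ∈ rg m,
      (N (ev (t0 + k * (pp / m))))⁻¹ * (N (ev (t0 + k * (pp / m) + pp / m)))⁻¹ =
      ∑ k ∈ rg m, wd (v k) (v (k + 1)) := by
    rw [Finset.mul_sum]
    refine Finset.sum_congr rfl fun k _ => ?_
    have : t0 + ((k + 1 : ℕ):ℝ) * (pp / m) = t0 + k * (pp / m) + pp / m := by push_cast; ring
    simp only [hv, this]
    have h3 := wd_ev (t0 + k * (pp / m)) (t0 + k * (pp / m) + pp / m)
    rw [add_sub_cancel_left] at h3
    rw [wd_smul, h3]; ring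
  rw [hS2]
  rw [hS] at h2
  set S := ∑ k ∈ rg m, wd (v k) (v (k + 1))
  rw [Finset.sum_range] at h2
  simp only [Finset.sum_range] at h2
  have hC : ∑ i, ∑ k : Fin m, p i * |dt (g i) (v (k + 1) - v k)| ≤ 2 := by
    calc _ ≤ ∑ i, p i * 2 := by
          refine Finset.sum_le_sum fun i _ => ?_
          rw [← Finset.mul_sum]
          refine mul_le_mul_of_nonneg_left ?_ (hp i)
          have := tv_half hN (hg i) hm t0
          rw [Finset.sum_range] at this
          refine le_of_eq_of_le (Finset.sum_congr rfl fun k _ => ?_) this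
          simp only [hv, dt_sub, dt_smul, div_eq_inv_mul]
      _ = 2 := by rw [← Finset.sum_mul, hp1, one_mul]
  have hC0 : 0 ≤ ∑ i, ∑ k : Fin m, p i * |dt (g i) (v (k + 1) - v k)| :=
    Finset.sum_nonneg fun i _ => Finset.sum_nonneg fun j _ => mul_nonneg (hp i) (abs_nonneg _)
  have := mul_le_mul_of_nonneg_left h2 hA
  nlinarith
lemma calib_int (hN : IsNm N) {ι : Type*} [Fintype ι] (g : ι → RR) (p : ι → ℝ) (hp : ∀ i, 0 ≤ p i)
    (hp1 : ∑ i, p i = 1) (hg : ∀ i x, |dt (g i) x| ≤ N x) :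
    (∑ i, ∑ j, p i * p j * |wd (g i) (g j)|) * ∫ t in -Real.pi..Real.pi, (N (ev t))⁻¹ ^ 2 ≤ 4 := by
  set A := ∑ i, ∑ j, p i * p j * |wd (g i) (g j)|
  set ρ : ℝ → ℝ := fun t => (N (ev t))⁻¹ with hρ
  have hc : Continuous ρ := (hN.cont.comp ev_cont).inv₀ fun t => (hN.ev_pos t).ne'
  have hper : ∀ t, ρ (t + 2 * pp) = ρ t := by
    intro t
    have : ev (t + 2 * pp) = ev t := by simp [ev]
    simp only [hρ, this]
  set I : ℝ → ℝ := fun d => ∫ t in -Real.pi..Real.pi, ρ t * ρ (t + d) with hI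
  have hIc : Continuous I := by
    refine intervalIntegral.continuous_parametric_intervalIntegral_of_continuous' (f := fun d t => ρ t * ρ (t + d)) ?_ _ _
    fun_prop
  have step : ∀ m : ℕ, 0 < m → A * (Real.sinc (pp / m) * I (pp / m)) ≤ 4 := by
    intro m hm
    have hm' : (0:ℝ) < m := by exact_mod_cast hm
    set d := pp / m with hd
    have hd0 : d ≠ 0 := (div_pos Real.pi_pos hm').ne'
    have h1 : ∫ t in -Real.pi..Real.pi, A * (sn d * ∑ k ∈ rg m, ρ (t + k * d) * ρ (t + k * d + d)) ≤ ∫ t in -Real.pi..Real.pi, (2:ℝ) := by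
      refine intervalIntegral.integral_mono_on (by linarith [Real.pi_pos]) ?_ ?_ fun t _ => calib_poly hN g p hp hp1 hg hm t
      · exact Continuous.intervalIntegrable (by fun_prop) _ _
      · exact Continuous.intervalIntegrable (by fun_prop) _ _
    rw [intervalIntegral.integral_const_mul, intervalIntegral.integral_const_mul, intervalIntegral.integral_finsetSum] at h1
    · have h2 : ∀ k : ℕ, ∫ t in -Real.pi..Real.pi, ρ (t + k * d) * ρ (t + k * d + d) = I d := by
        intro k
        rw [intervalIntegral.integral_comp_add_right (fun t => ρ t * ρ (t + d))]
        have hp : Function.Periodic (fun t => ρ t * ρ (t + d)) (2 * pp) := fun t => by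
          show ρ (t + 2 * pp) * ρ (t + 2 * pp + d) = _
          rw [hper, show t + 2 * pp + d = t + d + 2 * pp by ring, hper]
        have := hp.intervalIntegral_add_eq (-pp + k * d) (-pp)
        rw [show -pp + k * d + 2 * pp = pp + k * d by ring, show -pp + 2 * pp = pp by ring] at this
        exact this
      simp only [h2, Finset.sum_const, Finset.card_range, nsmul_eq_mul, intervalIntegral.integral_const, smul_eq_mul] at h1
      rw [Real.sinc_of_ne_zero hd0]
      have : A * (sn d * (m * I d)) = (A * (sn d / d * I d)) * pp := by
        rw [hd]; field_simp
      rw [this] at h1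
      nlinarith [Real.pi_pos]
    · intro k _
      exact Continuous.intervalIntegrable (by fun_prop) _ _
  have hlim : Tendsto (fun m : ℕ => pp / m) atTop (nhds 0) := tendsto_const_div_atTop_nhds_zero_nat _
  have hlim2 : Tendsto (fun m : ℕ => A * (Real.sinc (pp / m) * I (pp / m))) atTop (nhds (A * (Real.sinc 0 * I 0))) := by
    have : Continuous fun d => A * (Real.sinc d * I d) := by
      have := Real.continuous_sinc
      fun_prop
    exact (this.tendsto 0).comp hlim
  have := le_of_tendsto hlim2 (eventually_atTop.2 ⟨1, fun m hm => step m hm⟩)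
  simpa [hI, pow_two] using this
lemma vol_polar (hN : IsNm N) : volume {x | N x ≤ 1} =
    eR ((∫ t in -Real.pi..Real.pi, (N (ev t))⁻¹ ^ 2) / 2) := by
  have hms : MeasurableSet {x | N x ≤ 1} := (isClosed_le hN.cont continuous_const).measurableSet
  rw [← lintegral_indicator_one hms, ← lintegral_comp_polarCoord_symm]
  have hc : Continuous fun t => (N (ev t))⁻¹ := (hN.cont.comp ev_cont).inv₀ fun t => (hN.ev_pos t).ne'
  have e1 : ∫⁻ p in polarCoord.target, eR p.1 • (Set.indicator {x | N x ≤ 1} 1 (polarCoord.symm p) : ℝ≥0∞) =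
      ∫⁻ p in Set.Ioi (0:ℝ) ×ˢ Set.Ioo (-pp) pp, Set.indicator {p : RR | p.1 ≤ (N (ev p.2))⁻¹} (fun p => eR p.1) p := by
    rw [polarCoord_target]
    refine setLIntegral_congr_fun (measurableSet_Ioi.prod measurableSet_Ioo) fun p hp => ?_
    have h0 : 0 < p.1 := hp.1
    have : polarCoord.symm p = p.1 • ev p.2 := by simp [polarCoord, ev]
    simp only [this, Set.indicator_apply, Set.mem_ofPred_eq, hN.smul, abs_of_pos h0]
    have hiff : p.1 * N (ev p.2) ≤ 1 ↔ p.1 ≤ (N (ev p.2))⁻¹ := by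
      rw [← le_div_iff₀ (hN.ev_pos _), one_div]
    simp only [hiff]
    split_ifs <;> simp
  rw [e1, Measure.volume_eq_prod, ← Measure.prod_restrict, lintegral_prod_symm]
  · have e2 : ∀ y, ∫⁻ x in Set.Ioi (0:ℝ), Set.indicator {p : RR | p.1 ≤ (N (ev p.2))⁻¹} (fun p => eR p.1) (x, y)
        = eR ((N (ev y))⁻¹ ^ 2 / 2) := by
      intro y
      set r := (N (ev y))⁻¹ with hr
      have hr0 : 0 ≤ r := inv_nonneg.2 (hN.ev_pos y).le
      have : (fun x => Set.indicator {p : RR | p.1 ≤ (N (ev p.2))⁻¹} (fun p => eR p.1) (x, y)) =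
        Set.indicator (Set.Iic r) (fun x => eR x) := by
        ext x; simp [Set.indicator_apply, hr]
      rw [this, lintegral_indicator measurableSet_Iic, Measure.restrict_restrict measurableSet_Iic,
        Set.inter_comm, Set.Ioi_inter_Iic, ← ofReal_integral_eq_lintegral_ofReal, ← intervalIntegral.integral_of_le hr0]
      · simp
      · exact (continuous_id.integrableOn_Icc (a := 0) (b := r)).mono_set Set.Ioc_subset_Icc_self
      · exact (ae_restrict_iff' measurableSet_Ioc).2 (Eventually.of_forall fun x hx => hx.1.le)
    simp only [e2]
    rw [restrict_Ioo_eq_restrict_Ioc, ← ofReal_integral_eq_lintegral_ofReal, ← intervalIntegral.integral_of_le (by linarith [Real.pi_pos]), intervalIntegral.integral_div]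
    · exact (Continuous.integrableOn_Icc (a := -pp) (b := pp) (by fun_prop)).mono_set Set.Ioc_subset_Icc_self
    · exact Eventually.of_forall fun x => by positivity
  · refine Measurable.aemeasurable ?_
    refine Measurable.indicator (mβ := inferInstance) (ENNReal.measurable_ofReal.comp measurable_fst) ?_
    exact (isClosed_le continuous_fst (hc.comp continuous_snd)).measurableSet
lemma calib {ι : Type*} [Fintype ι] (g : ι → RR) (p : ι → ℝ) (hp : ∀ i, 0 ≤ p i)
    (hp1 : ∑ i, p i = 1) {B : Set RR} (hB : ∀ i, ∀ x ∈ B, |dt (g i) x| ≤ 1) :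
    eR (∑ i, ∑ j, p i * p j * |wd (g i) (g j)|) * volume B ≤ 2 := by
  by_cases h0 : ∀ i j, wd (g i) (g j) = 0
  · simp [h0]
  push Not at h0
  obtain ⟨i0, j0, h0⟩ := h0
  set N : RR → ℝ := fun x => ‖fun i => dt (g i) x‖ with hNd
  have hN : IsNm N := by
    refine ⟨fun x hx => norm_pos_iff.2 fun h => hx ?_, fun x y => ?_, fun t x => ?_, ?_⟩
    · have h1 : dt (g i0) x = 0 := congrFun h i0
      have h2 : dt (g j0) x = 0 := congrFun h j0
      simp only [dt] at h1 h2
      have e1 : wd (g i0) (g j0) * x.1 = 0 := by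
        simp only [wd]; linear_combination (g j0).2 * h1 - (g i0).2 * h2
      have e2 : wd (g i0) (g j0) * x.2 = 0 := by
        simp only [wd]; linear_combination (g i0).1 * h2 - (g j0).1 * h1
      exact Prod.ext ((mul_eq_zero.1 e1).resolve_left h0) ((mul_eq_zero.1 e2).resolve_left h0)
    · simp only [hNd, dt_add]; exact norm_add_le (fun i => dt (g i) x) (fun i => dt (g i) y)
    · simp only [hNd, dt_smul]; exact norm_smul t (fun i => dt (g i) x)
    · simp only [hNd, dt]; fun_prop
  have h1 := calib_int hN g p hp hp1 fun i x => norm_le_pi_norm (fun i => dt (g i) x) i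
  calc _ ≤ eR (∑ i, ∑ j, p i * p j * |wd (g i) (g j)|) * volume {x | N x ≤ 1} := by
        gcongr
        intro x hx
        exact (pi_norm_le_iff_of_nonneg zero_le_one).2 fun i => hB i x hx
    _ = eR ((∑ i, ∑ j, p i * p j * |wd (g i) (g j)|) * ((∫ t in -Real.pi..Real.pi, (N (ev t))⁻¹ ^ 2) / 2)) := by
        rw [vol_polar hN, ENNReal.ofReal_mul]
        exact Finset.sum_nonneg fun i _ => Finset.sum_nonneg fun j _ =>
          mul_nonneg (mul_nonneg (hp i) (hp j)) (abs_nonneg _)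
    _ ≤ eR 2 := ENNReal.ofReal_le_ofReal (by linarith)
    _ = 2 := by simp
noncomputable def ret (z : RR) : RR := (max 1 ‖(⟨z.1, z.2⟩ : ℂ)‖)⁻¹ • z
lemma mem_D2_iff (z : RR) : z ∈ D2 ↔ ‖(⟨z.1, z.2⟩ : ℂ)‖ ≤ 1 := by
  have h0 := norm_nonneg (⟨z.1, z.2⟩ : ℂ)
  have h := Complex.sq_norm (⟨z.1, z.2⟩ : ℂ)
  simp only [Complex.normSq_mk] at h
  show z.1 ^ 2 + z.2 ^ 2 ≤ 1 ↔ _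
  rw [show z.1 ^ 2 + z.2 ^ 2 = ‖(⟨z.1, z.2⟩ : ℂ)‖ ^ 2 by rw [h]; ring]
  constructor
  · intro h; nlinarith
  · intro h; nlinarith
lemma ret_eq {z : RR} (hz : z ∈ D2) : ret z = z := by
  rw [mem_D2_iff] at hz
  simp [ret, max_eq_left hz]
lemma ret_mem (z : RR) : ret z ∈ D2 := by
  rw [mem_D2_iff]
  have h : (⟨(ret z).1, (ret z).2⟩ : ℂ) = (max 1 ‖(⟨z.1, z.2⟩ : ℂ)‖)⁻¹ • (⟨z.1, z.2⟩ : ℂ) := by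
    apply Complex.ext <;> simp [ret]
  have h1 : (0:ℝ) < max 1 ‖(⟨z.1, z.2⟩ : ℂ)‖ := lt_max_of_lt_left one_pos
  rw [h, norm_smul, norm_inv, Real.norm_of_nonneg h1.le, inv_mul_le_iff₀ h1, mul_one]
  exact le_max_right _ _
lemma ret_lip : LipschitzWith 3 ret := by
  refine LipschitzWith.of_dist_le_mul fun z w => ?_
  set n : RR → ℝ := fun z => ‖(⟨z.1, z.2⟩ : ℂ)‖ with hn
  have hn2 : |n z - n w| ≤ 2 * ‖z - w‖ := by
    have h1 := abs_norm_sub_norm_le (⟨z.1, z.2⟩ : ℂ) ⟨w.1, w.2⟩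
    have h2 := Complex.norm_le_abs_re_add_abs_im ((⟨z.1, z.2⟩ : ℂ) - ⟨w.1, w.2⟩)
    have h3 := norm_fst_le (z - w)
    have h4 := norm_snd_le (z - w)
    simp only [Complex.sub_re, Complex.sub_im, Prod.fst_sub, Prod.snd_sub, Real.norm_eq_abs] at *
    linarith
  have hwn : ‖w‖ ≤ n w := by
    rw [Prod.norm_def]
    exact max_le (Complex.abs_re_le_norm ⟨w.1, w.2⟩) (Complex.abs_im_le_norm ⟨w.1, w.2⟩)
  set a := max 1 (n z) with ha
  set b := max 1 (n w) with hb
  have ha1 : 1 ≤ a := le_max_left _ _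
  have hb1 : 1 ≤ b := le_max_left _ _
  have hab : |b - a| ≤ 2 * ‖z - w‖ := by
    have := abs_max_sub_max_le_abs (n w) (n z) 1
    rw [max_comm (n w), max_comm (n z), abs_sub_comm (n w)] at this
    exact this.trans hn2
  have e : ret z - ret w = a⁻¹ • (z - w) + (a⁻¹ - b⁻¹) • w := by
    simp only [ret, ha, hb, hn]; module
  rw [dist_eq_norm, dist_eq_norm, e]
  have h1 : ‖a⁻¹ • (z - w)‖ ≤ ‖z - w‖ := by
    rw [norm_smul, Real.norm_of_nonneg (by positivity)]
    exact mul_le_of_le_one_left (norm_nonneg _) (inv_le_one_of_one_le₀ ha1)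
  have h2 : ‖(a⁻¹ - b⁻¹) • w‖ ≤ 2 * ‖z - w‖ := by
    have : a⁻¹ - b⁻¹ = (b - a) / (a * b) := by field_simp
    rw [norm_smul, this, Real.norm_eq_abs, abs_div, abs_of_pos (by positivity : 0 < a * b), div_mul_eq_mul_div, div_le_iff₀ (by positivity)]
    have hw : ‖w‖ ≤ a * b := by
      have : n w ≤ b := le_max_right _ _
      nlinarith [norm_nonneg w]
    exact mul_le_mul hab hw (norm_nonneg _) (by positivity)
  have := norm_add_le (a⁻¹ • (z - w)) ((a⁻¹ - b⁻¹) • w)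
  push_cast
  linarith
lemma convex_D2 : Convex ℝ D2 := by
  intro x hx y hy a b ha hb hab
  have hx' : x.1 ^ 2 + x.2 ^ 2 ≤ 1 := hx
  have hy' : y.1 ^ 2 + y.2 ^ 2 ≤ 1 := hy
  show (a • x + b • y).1 ^ 2 + (a • x + b • y).2 ^ 2 ≤ 1
  have : b = 1 - a := by linarith
  subst this
  simp only [Prod.fst_add, Prod.snd_add, Prod.smul_fst, Prod.smul_snd, smul_eq_mul]
  nlinarith [mul_nonneg ha hb, mul_nonneg (mul_nonneg ha hb) (sq_nonneg (x.1 - y.1)), mul_nonneg (mul_nonneg ha hb) (sq_nonneg (x.2 - y.2))]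
lemma ae_interior : ∀ᵐ x ∂(volume.restrict D2), x ∈ interior D2 := by
  rw [ae_restrict_iff' measurableSet_D2]
  have h := convex_D2.addHaar_frontier volume
  have : ∀ᵐ x : RR, x ∉ frontier D2 := measure_eq_zero_iff_ae_notMem.1 h
  filter_upwards [this] with x hx hD
  by_contra hi
  exact hx ⟨subset_closure hD, hi⟩
section
variable {Y : Type*} [PseudoMetricSpace Y]
lemma quot_le {Φ : RR → Y} {L : ℝ≥0} (hΦ : LipschitzWith L Φ) (x v : RR) {r : ℝ} (hr : 0 < r) :
    dist (Φ (x + r • v)) (Φ x) / r ≤ L * ‖v‖ := by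
  rw [div_le_iff₀ hr]
  have := hΦ.dist_le_mul (x + r • v) x
  simp only [dist_eq_norm, add_sub_cancel_left, norm_smul, Real.norm_of_nonneg hr.le] at this
  calc _ ≤ _ := this
    _ = _ := by ring
lemma bdd_quot {Φ : RR → Y} {L : ℝ≥0} (hΦ : LipschitzWith L Φ) (x v : RR) :
    IsBoundedUnder (· ≤ ·) (nhdsWithin 0 (Set.Ioi 0)) (fun r : ℝ => dist (Φ (x + r • v)) (Φ x) / r) :=
  ⟨L * ‖v‖, by
    rw [eventually_map]
    filter_upwards [self_mem_nhdsWithin] with r hr using quot_le hΦ x v hr⟩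
lemma cobdd_quot {Φ : RR → Y} (x v : RR) :
    IsCoboundedUnder (· ≤ ·) (nhdsWithin 0 (Set.Ioi 0)) (fun r : ℝ => dist (Φ (x + r • v)) (Φ x) / r) := by
  refine IsBoundedUnder.isCoboundedUnder_le ⟨0, ?_⟩
  rw [eventually_map]
  filter_upwards [self_mem_nhdsWithin] with r hr
  have : 0 < r := hr
  positivity
lemma mder_le_iff {Φ : RR → Y} {L : ℝ≥0} (hΦ : LipschitzWith L Φ) (x v : RR) (c : ℝ) :
    mder Φ x v ≤ c ↔ ∀ y > c, ∀ᶠ r in nhdsWithin (0:ℝ) (Set.Ioi 0), dist (Φ (x + r • v)) (Φ x) / r < y :=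
  limsup_le_iff (cobdd_quot x v) (bdd_quot hΦ x v)
lemma mder_le {Φ : RR → Y} {L : ℝ≥0} (hΦ : LipschitzWith L Φ) (x v : RR) :
    mder Φ x v ≤ L * ‖v‖ := by
  rw [mder_le_iff hΦ]
  intro y hy
  filter_upwards [self_mem_nhdsWithin] with r hr using (quot_le hΦ x v hr).trans_lt hy
lemma measurable_mderSet {Φ : RR → Y} {L : ℝ≥0} (hΦ : LipschitzWith L Φ) :
    MeasurableSet {q : (RR) × (RR) | mder Φ q.1 q.2 ≤ 1} := by
  have : {q : (RR) × (RR) | mder Φ q.1 q.2 ≤ 1} = ⋂ n : ℕ, ⋃ k : ℕ, ⋂ r ∈ Set.Ioo (0:ℝ) (1 / (k + 1)),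
      {q | dist (Φ (q.1 + r • q.2)) (Φ q.1) / r ≤ 1 + 1 / ((n:ℝ) + 1)} := by
    ext q
    simp only [Set.mem_ofPred_eq, Set.mem_iInter, Set.mem_iUnion, mder_le_iff hΦ]
    constructor
    · intro h n
      have h1 := h (1 + 1 / ((n:ℝ) + 1)) (by have : (0:ℝ) < 1 / ((n:ℝ) + 1) := by positivity
                                             linarith)
      rw [eventually_nhdsWithin_iff, Metric.eventually_nhds_iff] at h1
      obtain ⟨ε, hε, h1⟩ := h1
      obtain ⟨k, hk⟩ := exists_nat_one_div_lt hε
      refine ⟨k, fun r hr => (h1 ?_ hr.1).le⟩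
      rw [Real.dist_eq, sub_zero, abs_of_pos hr.1]
      exact hr.2.trans hk
    · intro h y hy
      obtain ⟨n, hn⟩ := exists_nat_one_div_lt (sub_pos.2 hy)
      obtain ⟨k, hk⟩ := h n
      filter_upwards [Ioo_mem_nhdsGT (show (0:ℝ) < 1 / ((k:ℝ) + 1) by positivity)] with r hr
      have := hk r hr
      linarith
  rw [this]
  refine MeasurableSet.iInter fun n => MeasurableSet.iUnion fun k => IsClosed.measurableSet ?_
  refine isClosed_biInter fun r _ => isClosed_le ?_ continuous_const
  have := hΦ.continuous
  fun_prop
lemma vol_lower {Φ : RR → Y} {L : ℝ≥0} (hΦ : LipschitzWith L Φ) (x : RR) :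
    volume (Metric.ball (0 : RR) (1 / (L + 1))) ≤ volume {v | mder Φ x v ≤ 1} := by
  refine measure_mono fun v hv => (mder_le hΦ x v).trans ?_
  rw [mem_ball_zero_iff, lt_div_iff₀ (by positivity)] at hv
  nlinarith [norm_nonneg v]
lemma jac_bounds {Φ : RR → Y} {L : ℝ≥0} (hΦ : LipschitzWith L Φ) (x : RR) :
    0 ≤ jac2 (mder Φ x) ∧ jac2 (mder Φ x) ≤ pp / (volume (Metric.ball (0 : RR) (1 / (L + 1)))).toReal := by
  have h0 := vol_lower hΦ x
  have hpos : 0 < volume (Metric.ball (0 : RR) (1 / (L + 1))) := Metric.measure_ball_pos _ _ (by positivity)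
  have hpi := Real.pi_pos
  unfold jac2
  split_ifs with h
  · refine ⟨by positivity, ?_⟩
    gcongr
    · exact ENNReal.toReal_pos hpos.ne' (h0.trans_lt h).ne
    · exact h.ne
  · exact ⟨le_rfl, by positivity⟩
lemma jac_integrable {Φ : RR → Y} {L : ℝ≥0} (hΦ : LipschitzWith L Φ) :
    IntegrableOn (fun x => jac2 (mder Φ x)) D2 := by
  have hm : Measurable fun x => volume {v | mder Φ x v ≤ 1} :=
    measurable_measure_prodMk_left (ν := (volume : Measure RR)) (measurable_mderSet hΦ)
  have hmeas : Measurable fun x => jac2 (mder Φ x) := by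
    unfold jac2
    refine Measurable.ite (measurableSet_lt hm measurable_const) ?_ measurable_const
    exact measurable_const.div hm.ennreal_toReal
  have hfin : volume D2 < ⊤ := by
    refine (measure_mono (t := Metric.closedBall (0 : RR) 1) fun x hx => ?_).trans_lt measure_closedBall_lt_top
    have hx' : x.1 ^ 2 + x.2 ^ 2 ≤ 1 := hx
    rw [mem_closedBall_zero_iff, Prod.norm_def]
    refine max_le ?_ ?_ <;> rw [Real.norm_eq_abs, abs_le_one_iff_mul_self_le_one] <;> nlinarith [sq_nonneg x.1, sq_nonneg x.2]
  refine Measure.integrableOn_of_bounded hfin.ne hmeas.aestronglyMeasurable (M := pp / (volume (Metric.ball (0 : RR) (1 / (L + 1)))).toReal) ?_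
  exact Eventually.of_forall fun x => by
    rw [Real.norm_of_nonneg (jac_bounds hΦ x).1]; exact (jac_bounds hΦ x).2
lemma dt_grad_le {Φ : RR → Y} {L : ℝ≥0} (hΦ : LipschitzWith L Φ) {u : RR → ℝ}
    (hu : ∀ z w, |u z - u w| ≤ dist (Φ z) (Φ w)) {x : RR} (hd : DifferentiableAt ℝ u x) (v : RR) :
    |dt (grad u x) v| ≤ mder Φ x v := by
  rw [dt_grad]
  have h1 : HasDerivAt (fun r : ℝ => u (x + r • v)) (fderiv ℝ u x v) 0 := by
    have h2 : HasDerivAt (fun r : ℝ => x + r • v) v 0 := by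
      simpa using ((hasDerivAt_id (0:ℝ)).smul_const v).const_add x
    have h3 : HasFDerivAt u (fderiv ℝ u x) (x + (0:ℝ) • v) := by simpa using hd.hasFDerivAt
    exact h3.comp_hasDerivAt 0 h2
  have h4 := (h1.tendsto_slope_zero_right).abs
  by_contra hlt
  push Not at hlt
  obtain ⟨y, hy1, hy2⟩ := exists_between hlt
  have h5 := (mder_le_iff hΦ x v (mder Φ x v)).1 le_rfl y hy1
  have h6 := h4.eventually (lt_mem_nhds hy2)
  obtain ⟨r, ⟨h7, h8⟩, hr⟩ := ((h5.and h6).and self_mem_nhdsWithin).exists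
  have hr : 0 < r := hr
  have h9 := hu (x + r • v) x
  simp only [zero_add, zero_smul, add_zero, smul_eq_mul, abs_mul, abs_inv, abs_of_pos hr] at h8
  rw [div_lt_iff₀ hr] at h7
  rw [← div_eq_inv_mul, lt_div_iff₀ hr] at h8
  linarith
lemma jac_ge {Φ : RR → Y} {L : ℝ≥0} (hΦ : LipschitzWith L Φ) {ι : Type*} [Fintype ι] {u : ι → RR → ℝ}
    (hu : ∀ i z w, |u i z - u i w| ≤ dist (Φ z) (Φ w)) (p : ι → ℝ) (hp : ∀ i, 0 ≤ p i)
    (hp1 : ∑ i, p i = 1) {x : RR} (hd : ∀ i, DifferentiableAt ℝ (u i) x) :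
    pp / 2 * ∑ i, ∑ j, p i * p j * |wd (grad (u i) x) (grad (u j) x)| ≤ jac2 (mder Φ x) := by
  have h := calib (fun i => grad (u i) x) p hp hp1 (B := {v | mder Φ x v ≤ 1})
    fun i v hv => (dt_grad_le hΦ (hu i) (hd i) v).trans hv
  set A := ∑ i, ∑ j, p i * p j * |wd (grad (u i) x) (grad (u j) x)|
  have hA : 0 ≤ A := Finset.sum_nonneg fun i _ => Finset.sum_nonneg fun j _ =>
    mul_nonneg (mul_nonneg (hp i) (hp j)) (abs_nonneg _)
  have hpi := Real.pi_pos
  unfold jac2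
  split_ifs with hv
  · have hpos : 0 < (volume {v | mder Φ x v ≤ 1}).toReal :=
      ENNReal.toReal_pos ((Metric.measure_ball_pos _ _ (by positivity : (0:ℝ) < 1 / (L + 1))).trans_le (vol_lower hΦ x)).ne' hv.ne
    rw [le_div_iff₀ hpos]
    have := ENNReal.toReal_mono (by simp) h
    rw [ENNReal.toReal_mul, ENNReal.toReal_ofReal hA] at this
    simp only [ENNReal.toReal_ofNat] at this
    nlinarith
  · rw [not_lt_top_iff.1 hv] at h
    by_cases hA0 : A = 0
    · simp [hA0]
    · rw [ENNReal.mul_top (by simpa using lt_of_le_of_ne hA (Ne.symm hA0))] at h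
      exact absurd h (by simp)
lemma jac_ge2 {Φ : RR → Y} {L : ℝ≥0} (hΦ : LipschitzWith L Φ) {u v : RR → ℝ}
    (hu : ∀ z w, |u z - u w| ≤ dist (Φ z) (Φ w)) (hv : ∀ z w, |v z - v w| ≤ dist (Φ z) (Φ w))
    {x : RR} (hdu : DifferentiableAt ℝ u x) (hdv : DifferentiableAt ℝ v x) :
    |wd (grad u x) (grad v x)| ≤ 2 * jac2 (mder Φ x) := by
  have h := jac_ge hΦ (ι := Bool) (u := fun b => if b then u else v) (by
    intro b; cases b; exacts [hv, hu]) (fun _ => 1 / 2) (by intro; norm_num) (by simp) (x := x) (by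
    intro b; cases b <;> simpa)
  simp only [Fintype.sum_bool, if_true, Bool.false_eq_true, if_false] at h
  have e1 : ∀ a, wd a a = 0 := fun a => by simp only [wd]; ring
  have e2 : |wd (grad v x) (grad u x)| = |wd (grad u x) (grad v x)| := by
    rw [← abs_neg]; congr 1; simp only [wd]; ring
  rw [e1, e1, e2, abs_zero] at h
  nlinarith [Real.pi_gt_three, abs_nonneg (wd (grad u x) (grad v x))]
lemma disc_ext {φ : RR → Y} {K : ℝ≥0} (hφ : LipschitzOnWith K φ D2) :
    ∃ (Φ : RR → Y) (L : ℝ≥0), LipschitzWith L Φ ∧ (∀ z ∈ D2, Φ z = φ z) ∧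
      lipArea φ = ∫ x in D2, jac2 (mder Φ x) := by
  have heq : ∀ z ∈ D2, (φ ∘ ret) z = φ z := fun z hz => by simp [ret_eq hz]
  refine ⟨φ ∘ ret, K * 3, ?_, heq, ?_⟩
  · have := hφ.comp (ret_lip.lipschitzOnWith (s := Set.univ)) (fun z _ => ret_mem z)
    exact lipschitzOnWith_univ.1 this
  · refine integral_congr_ae ?_
    filter_upwards [ae_interior] with x hx
    congr 1
    ext v
    unfold mder
    refine limsup_congr ?_
    have hc : Tendsto (fun r : ℝ => x + r • v) (nhdsWithin 0 (Set.Ioi 0)) (nhds x) := by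
      have : Continuous fun r : ℝ => x + r • v := by fun_prop
      have := this.tendsto 0
      simp only [zero_smul, add_zero] at this
      exact this.mono_left nhdsWithin_le_nhds
    filter_upwards [hc.eventually (mem_interior_iff_mem_nhds.1 hx)] with r hr
    rw [heq _ hr, heq _ (interior_subset hx)]
end
lemma circ_mem (s : ℝ) : circ s ∈ D2 := by
  show cs _ ^ 2 + sn _ ^ 2 ≤ 1
  rw [Real.cos_sq_add_sin_sq]
lemma area_lower {Y : Type*} [PseudoMetricSpace Y] {φ : RR → Y} {γ : ℝ → Y} (hb : BoundsLoop φ γ)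
    {ι : Type*} [Fintype ι] (f : ι → Y → ℝ) (hf : ∀ i, LipschitzWith 1 (f i)) (p : ι → ℝ) (hp : ∀ i, 0 ≤ p i)
    (hp1 : ∑ i, p i = 1) (e : ι → ι → ℝ) (he : ∀ i j, |e i j| ≤ 1) :
    pp / 2 * ∑ i, ∑ j, p i * p j * (e i j * ∫ s in (0:ℝ)..1, f i (γ s) * deriv (fun s => f j (γ s)) s) ≤ lipArea φ := by
  obtain ⟨⟨K, hK⟩, hγ⟩ := hb
  obtain ⟨Φ, L, hΦ, heq, harea⟩ := disc_ext hK
  have hfl : ∀ i, LipschitzWith L (fun z => f i (Φ z)) := fun i => by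
    have := (hf i).comp hΦ; rw [one_mul] at this; exact this
  have hcg : ∀ s ∈ Ic (0:ℝ) 1, Φ (circ s) = γ s := fun s hs => by
    rw [heq _ (circ_mem s)]; exact hγ s hs
  have hint : ∀ i j, ∫ s in (0:ℝ)..1, f i (γ s) * deriv (fun s => f j (γ s)) s =
      ∫ z in D2, wd (grad (fun z => f i (Φ z)) z) (grad (fun z => f j (Φ z)) z) := by
    intro i j
    rw [stokes (hfl i) (hfl j)]
    refine intervalIntegral.integral_congr_ae ?_
    filter_upwards [Measure.ae_ne volume (1:ℝ)] with s h1 hs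
    rw [Set.uIoc_of_le zero_le_one] at hs
    have hs' : s ∈ Set.Ioo (0:ℝ) 1 := ⟨hs.1, lt_of_le_of_ne hs.2 h1⟩
    rw [hcg s (Set.Ioo_subset_Icc_self hs')]
    congr 1
    refine EventuallyEq.deriv_eq ?_
    filter_upwards [isOpen_Ioo.mem_nhds hs'] with t ht
    rw [hcg t (Set.Ioo_subset_Icc_self ht)]
  have hwi : ∀ i j, IntegrableOn (fun z => wd (grad (fun z => f i (Φ z)) z) (grad (fun z => f j (Φ z)) z)) D2 := by
    intro i j
    refine Integrable.mono' ((jac_integrable hΦ).const_mul 2) (measurable_wd_grad _ _).aestronglyMeasurable ?_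
    refine ae_restrict_of_ae ?_
    filter_upwards [(hfl i).ae_differentiableAt (μ := volume), (hfl j).ae_differentiableAt (μ := volume)] with z h1 h2
    refine jac_ge2 hΦ (fun z w => ?_) (fun z w => ?_) h1 h2
    · simpa [Real.dist_eq] using (hf i).dist_le_mul (Φ z) (Φ w)
    · simpa [Real.dist_eq] using (hf j).dist_le_mul (Φ z) (Φ w)
  simp only [hint]
  have hI : ∀ i j, Integrable (fun z => p i * p j * (e i j * wd (grad (fun z => f i (Φ z)) z) (grad (fun z => f j (Φ z)) z))) (volume.restrict D2) :=
    fun i j => ((hwi i j).const_mul _).const_mul _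
  have e1 : pp / 2 * ∑ i, ∑ j, p i * p j * (e i j * ∫ z in D2, wd (grad (fun z => f i (Φ z)) z) (grad (fun z => f j (Φ z)) z)) =
      ∫ z in D2, pp / 2 * ∑ i, ∑ j, p i * p j * (e i j * wd (grad (fun z => f i (Φ z)) z) (grad (fun z => f j (Φ z)) z)) := by
    rw [integral_const_mul, integral_finsetSum _ fun i _ => integrable_finsetSum _ fun j _ => hI i j]
    congr 1
    refine Finset.sum_congr rfl fun i _ => ?_
    rw [integral_finsetSum _ fun j _ => hI i j]
    refine Finset.sum_congr rfl fun j _ => ?_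
    rw [integral_const_mul, integral_const_mul]
  rw [e1, harea]
  refine integral_mono_ae ?_ (jac_integrable hΦ) ?_
  · exact (integrable_finsetSum _ fun i _ => integrable_finsetSum _ fun j _ => hI i j).const_mul _
  · refine ae_restrict_of_ae ?_
    have hd : ∀ᵐ z : RR, ∀ i, DifferentiableAt ℝ (fun z => f i (Φ z)) z :=
      ae_all_iff.2 fun i => (hfl i).ae_differentiableAt (μ := volume)
    filter_upwards [hd] with z hz
    refine le_trans ?_ (jac_ge hΦ (u := fun i z => f i (Φ z)) (fun i z w => ?_) p hp hp1 hz)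
    · refine mul_le_mul_of_nonneg_left ?_ (by positivity)
      refine Finset.sum_le_sum fun i _ => Finset.sum_le_sum fun j _ => ?_
      refine mul_le_mul_of_nonneg_left ?_ (mul_nonneg (hp i) (hp j))
      refine (le_abs_self _).trans ?_
      rw [abs_mul]
      exact mul_le_of_le_one_left (abs_nonneg _) (he i j)
    · simpa [Real.dist_eq] using (hf i).dist_le_mul (Φ z) (Φ w)
lemma wirt0 {m : ℕ} (hm : 2 ≤ m) {y : ℕ → ℝ} (h0 : y 0 = 0) (hm0 : y m = 0) :
    ∑ k ∈ rg m, (y k * y (k + 1) - cs (pp / m) * y k ^ 2) ≤ 0 := by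
  have hm' : (0:ℝ) < m := by positivity
  set d := pp / m with hd
  have hd0 : 0 < d := div_pos Real.pi_pos hm'
  have hs : ∀ k : ℕ, 0 < k → k < m → 0 < sn (k * d) := by
    intro k h1 h2
    have h1' : (0:ℝ) < k := by exact_mod_cast h1
    have h2' : (k:ℝ) < m := by exact_mod_cast h2
    refine Real.sin_pos_of_pos_of_lt_pi (by positivity) ?_
    calc (k:ℝ) * d < m * d := by gcongr
      _ = pp := by rw [hd]; field_simp
  have hrec : ∀ k : ℕ, sn ((k + 2 : ℕ) * d) = 2 * cs d * sn ((k + 1 : ℕ) * d) - sn (k * d) := by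
    intro k
    have e1 : ((k + 2 : ℕ):ℝ) * d = (k + 1 : ℕ) * d + d := by push_cast; ring
    have e2 : (k:ℝ) * d = (k + 1 : ℕ) * d - d := by push_cast; ring
    rw [e1, e2, Real.sin_add, Real.sin_sub]; ring
  have key : ∀ n, n + 1 < m → (∑ k ∈ rg (n + 1), (2 * y k * y (k + 1) - 2 * cs d * y (k + 1) ^ 2)) * sn ((n + 1 : ℕ) * d)
      ≤ - (sn ((n + 2 : ℕ) * d) * y (n + 1) ^ 2) := by
    intro n
    induction n with
    | zero =>
      intro h
      have := hrec 0
      simp only [Nat.cast_zero, zero_mul, Real.sin_zero, sub_zero] at this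
      rw [this]
      simp [h0]; linarith
    | succ n ih =>
      intro h
      have ih := ih (by omega)
      have s1 := hs (n + 1) (by omega) (by omega)
      have s2 := hs (n + 2) (by omega) (by omega)
      rw [Finset.sum_range_succ]
      have r := hrec (n + 1)
      set T := ∑ k ∈ rg (n + 1), (2 * y k * y (k + 1) - 2 * cs d * y (k + 1) ^ 2)
      show (T + (2 * y (n + 1) * y (n + 2) - 2 * cs d * y (n + 2) ^ 2)) * sn ((n + 2 : ℕ) * d) ≤ - (sn ((n + 1 + 2 : ℕ) * d) * y (n + 2) ^ 2)
      rw [r]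
      show (T + (2 * y (n + 1) * y (n + 2) - 2 * cs d * y (n + 2) ^ 2)) * sn ((n + 2 : ℕ) * d) ≤ - ((2 * cs d * sn ((n + 2 : ℕ) * d) - sn ((n + 1 : ℕ) * d)) * y (n + 2) ^ 2)
      set a := sn ((n + 1 : ℕ) * d)
      set b := sn ((n + 2 : ℕ) * d)
      refine le_of_mul_le_mul_right ?_ s1
      nlinarith [mul_le_mul_of_nonneg_right ih s2.le, sq_nonneg (b * y (n + 1) - a * y (n + 2))]
  obtain ⟨n, rfl⟩ : ∃ n, m = n + 2 := ⟨m - 2, by omega⟩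
  have h1 := key n (by omega)
  have e : ((n + 2 : ℕ):ℝ) * d = pp := by rw [hd]; field_simp
  rw [e, Real.sin_pi, zero_mul, neg_zero] at h1
  have s1 := hs (n + 1) (by omega) (by omega)
  have h2 : (∑ k ∈ rg (n + 1), (2 * y k * y (k + 1) - 2 * cs d * y (k + 1) ^ 2)) ≤ 0 := by
    by_contra h; push Not at h; nlinarith [mul_pos h s1]
  have h3 : ∑ k ∈ rg (n + 2), (2 * y k * y (k + 1) - 2 * cs d * y (k + 1) ^ 2) ≤ 0 := by
    rw [Finset.sum_range_succ]
    have : y (n + 1 + 1) = 0 := hm0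
    rw [this]; simpa using h2
  have h4 := Finset.sum_range_sub (fun k => cs d * y k ^ 2) (n + 2)
  simp only [h0, hm0] at h4
  have h5 : ∑ k ∈ rg (n + 2), (2 * y k * y (k + 1) - 2 * cs d * y (k + 1) ^ 2) =
    2 * ∑ k ∈ rg (n + 2), (y k * y (k + 1) - cs d * y k ^ 2) - 2 * ∑ k ∈ rg (n + 2), (cs d * y (k + 1) ^ 2 - cs d * y k ^ 2) := by
    rw [Finset.mul_sum, Finset.mul_sum, ← Finset.sum_sub_distrib]
    exact Finset.sum_congr rfl fun k _ => by ring
  rw [h4] at h5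
  linarith
lemma wirt_cross {m : ℕ} (hm : 2 ≤ m) {x : ℕ → ℝ} (hx : x m = - x 0) :
    ∑ k ∈ rg m, (x k * cs ((k + 1 : ℕ) * (pp / m)) + cs (k * (pp / m)) * x (k + 1)
      - 2 * cs (pp / m) * (x k * cs (k * (pp / m)))) = 0 := by
  have hm' : (0:ℝ) < m := by positivity
  set d := pp / m with hd
  have h := Finset.sum_range_sub (fun k : ℕ => cs (k * d - d) * x k) m
  have e : (m:ℝ) * d = pp := by rw [hd]; field_simp
  simp only [e, hx, Nat.cast_zero, zero_mul, zero_sub, Real.cos_neg, Real.cos_pi_sub] at h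
  calc _ = ∑ k ∈ rg m, (cs ((k + 1 : ℕ) * d - d) * x (k + 1) - cs (k * d - d) * x k) := by
        refine Finset.sum_congr rfl fun k _ => ?_
        have e1 : ((k + 1 : ℕ):ℝ) * d = k * d + d := by push_cast; ring
        rw [e1, add_sub_cancel_right, Real.cos_add, Real.cos_sub]; ring
    _ = 0 := by rw [h]; ring
lemma wirt {m : ℕ} (hm : 2 ≤ m) {x : ℕ → ℝ} (hx : x m = - x 0) :
    ∑ k ∈ rg m, x k * x (k + 1) ≤ cs (pp / m) * ∑ k ∈ rg m, x k ^ 2 := by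
  have hm' : (0:ℝ) < m := by positivity
  set d := pp / m with hd
  have e : (m:ℝ) * d = pp := by rw [hd]; field_simp
  set c : ℕ → ℝ := fun k => cs (k * d) with hc
  have cm : c m = -1 := by simp [hc, e]
  have c0 : c 0 = 1 := by simp [hc]
  have h1 := wirt0 hm (y := fun k => x k - x 0 * c k) (by simp [c0]) (by simp [cm, hx])
  have h2 := wirt_cross hm hx
  have h3 := wirt_cross hm (x := c) (by rw [cm, c0])
  rw [← hd] at h1 h2 h3
  have e2 : ∑ k ∈ rg m, x k * x (k + 1) - cs d * ∑ k ∈ rg m, x k ^ 2 =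
     ∑ k ∈ rg m, ((x k - x 0 * c k) * (x (k + 1) - x 0 * c (k + 1)) - cs d * (x k - x 0 * c k) ^ 2)
     + x 0 * ∑ k ∈ rg m, (x k * c (k + 1) + c k * x (k + 1) - 2 * cs d * (x k * c k))
     - x 0 ^ 2 / 2 * ∑ k ∈ rg m, (c k * c (k + 1) + c k * c (k + 1) - 2 * cs d * (c k * c k)) := by
    rw [Finset.mul_sum, Finset.mul_sum, Finset.mul_sum, ← Finset.sum_sub_distrib, ← Finset.sum_add_distrib, ← Finset.sum_sub_distrib]
    exact Finset.sum_congr rfl fun k _ => by ring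
  rw [h2, h3] at e2
  linarith
lemma santalo {m : ℕ} (hm : 2 ≤ m) {h : ℕ → ℝ} (hpos : ∀ k, 0 < h k) (hp : h m = h 0) :
    (∑ k ∈ rg m, (h k * h (k + 1))⁻¹) * (2 * ∑ k ∈ rg m, h k * h (k + 1)
      - 2 * cs (pp / m) * ∑ k ∈ rg m, h k ^ 2) ≤ pp ^ 2 := by
  set W := ∑ k ∈ rg m, (h k * h (k + 1))⁻¹ with hW
  have hW0 : 0 < W := Finset.sum_pos (fun k _ => inv_pos.2 (mul_pos (hpos _) (hpos _))) ⟨0, by simp; omega⟩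
  set c := pp / W with hc
  set f : ℕ → ℝ := fun k => c * ∑ j ∈ rg k, (h j * h (j + 1))⁻¹ with hf
  have f0 : f 0 = 0 := by simp [hf]
  have fm : f m = pp := by simp only [hf, ← hW, hc]; field_simp
  have fs : ∀ k, f (k + 1) = f k + c * (h k * h (k + 1))⁻¹ := fun k => by
    simp only [hf, Finset.sum_range_succ]; ring
  have h1 := wirt hm (x := fun k => h k * cs (f k)) (by simp [f0, fm, hp])
  have h2 := wirt hm (x := fun k => h k * sn (f k)) (by simp [f0, fm])
  have e1 : ∑ k ∈ rg m, h k ^ 2 = ∑ k ∈ rg m, (h k * cs (f k)) ^ 2 + ∑ k ∈ rg m, (h k * sn (f k)) ^ 2 := by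
    rw [← Finset.sum_add_distrib]
    refine Finset.sum_congr rfl fun k _ => ?_
    have := Real.sin_sq_add_cos_sq (f k)
    linear_combination (- h k ^ 2) * this
  have e2 : ∑ k ∈ rg m, (h k * h (k + 1) - c ^ 2 / 2 * (h k * h (k + 1))⁻¹) ≤
     ∑ k ∈ rg m, (h k * cs (f k)) * (h (k + 1) * cs (f (k + 1))) + ∑ k ∈ rg m, (h k * sn (f k)) * (h (k + 1) * sn (f (k + 1))) := by
    rw [← Finset.sum_add_distrib]
    refine Finset.sum_le_sum fun k _ => ?_
    have hk := mul_pos (hpos k) (hpos (k + 1))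
    have h3 : cs (c * (h k * h (k + 1))⁻¹) = cs (f k) * cs (f (k + 1)) + sn (f k) * sn (f (k + 1)) := by
      rw [show c * (h k * h (k + 1))⁻¹ = f (k + 1) - f k by rw [fs]; ring, Real.cos_sub]; ring
    have h4 := Real.one_sub_sq_div_two_le_cos (x := c * (h k * h (k + 1))⁻¹)
    rw [h3] at h4
    have h5 := mul_le_mul_of_nonneg_left h4 hk.le
    have h6 : h k * h (k + 1) * (1 - (c * (h k * h (k + 1))⁻¹) ^ 2 / 2) = h k * h (k + 1) - c ^ 2 / 2 * (h k * h (k + 1))⁻¹ := by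
      have := hpos k; have := hpos (k + 1)
      field_simp
    linarith
  rw [Finset.sum_sub_distrib, ← Finset.mul_sum, ← hW] at e2
  have e3 : c ^ 2 / 2 * W = pp ^ 2 / (2 * W) := by rw [hc]; field_simp
  rw [e3] at e2
  have e4 : 2 * ∑ k ∈ rg m, h k * h (k + 1) - 2 * cs (pp / m) * ∑ k ∈ rg m, h k ^ 2 ≤ pp ^ 2 / W := by
    rw [e1]
    have : pp ^ 2 / W = 2 * (pp ^ 2 / (2 * W)) := by field_simp
    rw [this]
    linarith
  rw [le_div_iff₀ hW0] at e4
  linarith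
def PolyIneq (N : RR → ℝ) (ε : ℝ) : Prop :=
  ∀ (n : ℕ) (u : ℕ → RR), u n = u 0 → ∀ (m : ℕ) (g : Fin m → RR) (p : Fin m → ℝ),
    (∀ i, 0 ≤ p i) → ∑ i, p i = 1 → (∀ i x, |dt (g i) x| ≤ N x) →
    pp / 2 * (∑ i, ∑ j, p i * p j * |wd (g i) (g j)|) * (1 / 2 * ∑ k ∈ rg n, wd (u k) (u (k + 1)))
      ≤ (1 - ε) / (4 * pp) * (∑ k ∈ rg n, N (u (k + 1) - u k)) ^ 2
lemma ev_norm_ge (t : ℝ) : 1 / 2 ≤ ‖ev t‖ := by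
  by_contra h
  push Not at h
  have h1 : |cs t| < 1 / 2 := (norm_fst_le (ev t)).trans_lt h
  have h2 : |sn t| < 1 / 2 := (norm_snd_le (ev t)).trans_lt h
  have := Real.sin_sq_add_cos_sq t
  rw [abs_lt] at h1 h2
  nlinarith
lemma ev_dist (s t : ℝ) : ‖ev s - ev t‖ ≤ |s - t| := by
  rw [Prod.norm_def]
  refine max_le ?_ ?_
  · exact Real.abs_cos_sub_cos_le s t
  · exact Real.abs_sin_sub_sin_le s t
theorem poly_contra {N : RR → ℝ} (hN : IsNm N) {Λ : ℝ} (hl : ∀ x, ‖x‖ ≤ N x) (hu : ∀ x, N x ≤ Λ * ‖x‖)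
    {ε : ℝ} (hε : 0 < ε) (hJ : PolyIneq N ε) : False := by
  have hpi := Real.pi_pos
  have hΛ : 0 < Λ := by
    have h1 := hl (1, 0); have h2 := hu (1, 0)
    have : ‖((1:ℝ), (0:ℝ))‖ = 1 := by simp [Prod.norm_def]
    rw [this] at h1 h2; linarith
  obtain ⟨η, hη, hηε⟩ : ∃ η : ℝ, 0 < η ∧ (1 - ε) * (1 + η) ^ 2 < 1 := by
    have hc : Tendsto (fun η : ℝ => (1 - ε) * (1 + η) ^ 2) (nhdsWithin 0 (Set.Ioi 0)) (nhds ((1 - ε) * (1 + 0) ^ 2)) :=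
      (Continuous.tendsto (by fun_prop) 0).mono_left nhdsWithin_le_nhds
    obtain ⟨η, h1, h2⟩ := ((hc.eventually (gt_mem_nhds (show (1 - ε) * (1 + 0) ^ 2 < 1 by linarith))).and self_mem_nhdsWithin).exists
    exact ⟨η, h2, h1⟩
  obtain ⟨m, hm2, hmτ⟩ : ∃ m : ℕ, 2 ≤ m ∧ Λ * (pp / m) * (2 + η) ≤ η * (1 / 2) := by
    have hlim : Tendsto (fun m : ℕ => Λ * (pp / m) * (2 + η)) atTop (nhds (Λ * 0 * (2 + η))) :=
      ((tendsto_const_div_atTop_nhds_zero_nat _).const_mul _).mul_const _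
    have := (hlim.eventually (ge_mem_nhds (show Λ * 0 * (2 + η) < η * (1 / 2) by simp; positivity))).and (eventually_ge_atTop 2)
    obtain ⟨m, h1, h2⟩ := this.exists
    exact ⟨m, h2, h1⟩
  have hm' : (0:ℝ) < m := by positivity
  set d := pp / m with hd
  have hd0 : 0 < d := div_pos hpi hm'
  have hdm : (m:ℝ) * d = pp := by rw [hd]; field_simp
  have hdpi : d < pp := by
    rw [hd, div_lt_iff₀ hm']
    have : (2:ℝ) ≤ m := by exact_mod_cast hm2
    nlinarith
  have hsd : 0 < sn d := Real.sin_pos_of_pos_of_lt_pi hd0 hdpi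
  set e : ℕ → RR := fun k => ev (k * d) with he
  set h : ℕ → ℝ := fun k => N (e k) with hh
  have hpos : ∀ k, 0 < h k := fun k => hN.ev_pos _
  have hhalf : ∀ k, 1 / 2 ≤ h k := fun k => (ev_norm_ge _).trans (hl _)
  have em : ∀ k, e (k + m) = - e k := fun k => by
    simp only [he]; rw [← ev_pi]; congr 1; push_cast; rw [add_mul, hdm]
  have hm_ : ∀ k, h (k + m) = h k := fun k => by simp only [hh, em, hN.neg]
  have edist : ∀ k, N (e (k + 1) - e k) ≤ Λ * d := fun k => by
    refine (hu _).trans (mul_le_mul_of_nonneg_left ((ev_dist _ _).trans ?_) hΛ.le)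
    rw [show ((k + 1 : ℕ):ℝ) * d - k * d = d by push_cast; ring, abs_of_pos hd0]
  set g : ℕ → RR := fun k => h k • e k + ((h (k + 1) - cs d * h k) / sn d) • (-(e k).2, (e k).1) with hg
  have esucc : ∀ k, e (k + 1) = cs d • e k + sn d • (-(e k).2, (e k).1) := by
    intro k
    simp only [he, ev]
    rw [show ((k + 1 : ℕ):ℝ) * d = k * d + d by push_cast; ring, Real.cos_add, Real.sin_add]
    ext <;> simp <;> ring
  have e1 : ∀ k, (e k).1 ^ 2 + (e k).2 ^ 2 = 1 := fun k => Real.cos_sq_add_sin_sq _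
  have ge0 : ∀ k, dt (g k) (e k) = h k := by
    intro k
    have := e1 k
    simp only [hg, dt, Prod.fst_add, Prod.snd_add, Prod.smul_fst, Prod.smul_snd, smul_eq_mul]
    linear_combination h k * this
  have ge1 : ∀ k, dt (g k) (e (k + 1)) = h (k + 1) := by
    intro k
    rw [esucc, dt_add, dt_smul, dt_smul, ge0]
    have := e1 k
    have h2 : dt (g k) (-(e k).2, (e k).1) = (h (k + 1) - cs d * h k) / sn d := by
      simp only [hg, dt, Prod.fst_add, Prod.snd_add, Prod.smul_fst, Prod.smul_snd, smul_eq_mul]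
      linear_combination ((h (k + 1) - cs d * h k) / sn d) * this
    rw [h2]; field_simp; ring
  have gm : ∀ k, g (k + m) = - g k := by
    intro k
    have h1 : h (k + m + 1) = h (k + 1) := by rw [show k + m + 1 = k + 1 + m by ring, hm_]
    simp only [hg, em, hm_, h1]
    ext <;> simp <;> ring
  have gle : ∀ k x, dt (g k) x ≤ (1 + η) * N x := by
    intro k x
    obtain ⟨α, β, hx⟩ : ∃ α β : ℝ, x = α • e k + β • e (k + 1) := by
      refine ⟨wd x (e (k + 1)) / sn d, wd (e k) x / sn d, ?_⟩
      have hw : wd (e k) (e (k + 1)) = sn d := by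
        simp only [he]; rw [wd_ev]; congr 1; push_cast; ring
      have hw' := hw
      simp only [wd] at hw'
      rw [← hw]
      have hne : wd (e k) (e (k + 1)) ≠ 0 := by rw [hw]; exact hsd.ne'
      ext <;> simp only [Prod.fst_add, Prod.snd_add, Prod.smul_fst, Prod.smul_snd, smul_eq_mul] <;> field_simp <;> simp only [wd] <;> ring
    have gx : dt (g k) x = α * h k + β * h (k + 1) := by
      rw [hx, dt_add, dt_smul, dt_smul, ge0, ge1]
    have nx0 : 0 ≤ N x := (norm_nonneg x).trans (hl x)
    have nxη : N x ≤ (1 + η) * N x := by nlinarith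
    rw [gx]
    rcases le_total 0 α with ha | ha <;> rcases le_total 0 β with hb | hb
    · have n1 : (α + β) * h k ≤ N x + β * (Λ * d) := by
        have h1 := hN.add x (-(β • (e (k + 1) - e k)))
        rw [hN.neg, hN.smul, abs_of_nonneg hb, show x + -(β • (e (k + 1) - e k)) = (α + β) • e k by rw [hx]; module, hN.smul, abs_of_nonneg (add_nonneg ha hb)] at h1
        have := mul_le_mul_of_nonneg_left (edist k) hb
        linarith
      have n2 : h (k + 1) ≤ h k + Λ * d := by
        have h1 := hN.add (e k) (e (k + 1) - e k)
        rw [add_sub_cancel] at h1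
        linarith [edist k]
      have hk := hhalf k
      have hab : 0 ≤ α + β := add_nonneg ha hb
      have n3 : β * h (k + 1) ≤ β * (h k + Λ * d) := mul_le_mul_of_nonneg_left n2 hb
      have n4 : (α + β) * (Λ * d * (2 + η)) ≤ (α + β) * (η * h k) := mul_le_mul_of_nonneg_left (by nlinarith) hab
      have n5 : β * (Λ * d * (2 + η)) ≤ (α + β) * (Λ * d * (2 + η)) := mul_le_mul_of_nonneg_right (by linarith) (by positivity)
      nlinarith [mul_le_mul_of_nonneg_left n1 (by linarith : 0 ≤ 1 + η)]
    · have h1 := hN.add x ((-β) • e (k + 1))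
      rw [show x + (-β) • e (k + 1) = α • e k by rw [hx]; module, hN.smul, hN.smul, abs_of_nonneg ha, abs_of_nonneg (neg_nonneg.2 hb)] at h1
      linarith
    · have h1 := hN.add x ((-α) • e k)
      rw [show x + (-α) • e k = β • e (k + 1) by rw [hx]; module, hN.smul, hN.smul, abs_of_nonneg hb, abs_of_nonneg (neg_nonneg.2 ha)] at h1
      linarith
    · nlinarith [hpos k, hpos (k + 1)]
  have gabs : ∀ k x, |dt (g k) x| ≤ (1 + η) * N x := by
    intro k x
    refine abs_le.2 ⟨?_, gle k x⟩
    have := gle k (-x)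
    rw [dt_neg, hN.neg] at this
    linarith
  set W := ∑ k ∈ rg m, (h k * h (k + 1))⁻¹ with hW
  have hW0 : 0 < W := Finset.sum_pos (fun k _ => inv_pos.2 (mul_pos (hpos _) (hpos _))) ⟨0, by simp; omega⟩
  set p : ℕ → ℝ := fun k => (h k * h (k + 1))⁻¹ / W with hp
  have wdg : ∀ j k, |dt (g j) ((h (k + 1))⁻¹ • e (k + 1)) - dt (g j) ((h k)⁻¹ • e k)| = (W * sn d) * (p k * |wd (g j) (g k)|) := by
    intro j k
    have hw : wd (e k) (e (k + 1)) = sn d := by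
      simp only [he]; rw [wd_ev]; congr 1; push_cast; ring
    have cb : wd (g j) (g k) * wd (e k) (e (k + 1)) = dt (g j) (e k) * dt (g k) (e (k + 1)) - dt (g j) (e (k + 1)) * dt (g k) (e k) := by
      simp only [wd, dt]; ring
    rw [hw, ge0, ge1] at cb
    have h1 := hpos k
    have h2 := hpos (k + 1)
    have : dt (g j) ((h (k + 1))⁻¹ • e (k + 1)) - dt (g j) ((h k)⁻¹ • e k) = -((h k * h (k + 1))⁻¹ * sn d * wd (g j) (g k)) := by
      rw [dt_smul, dt_smul]; field_simp; linarith
    rw [this, abs_neg, abs_mul, abs_of_pos (by positivity)]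
    simp only [hp]; field_simp
  have rowsum : ∀ j, 2 ≤ (W * sn d) * ∑ k ∈ rg m, p k * |wd (g j) (g k)| := by
    intro j
    rw [Finset.mul_sum]
    set a : ℕ → ℝ := fun k => dt (g j) ((h k)⁻¹ • e k) with ha
    have aper : ∀ k, a (k + m) = - a k := fun k => by
      simp only [ha, hm_, em, smul_neg, dt_neg]
    have h1 : ∑ k ∈ rg m, (W * sn d) * (p k * |wd (g j) (g k)|) = ∑ k ∈ rg m, |a (k + 1) - a k| :=
      Finset.sum_congr rfl fun k _ => (wdg j k).symm
    rw [h1, ← sum_shift (F := fun k => |a (k + 1) - a k|) (m := m) (fun k => by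
      show |a (k + m + 1) - a (k + m)| = _
      rw [show k + m + 1 = k + 1 + m by ring, aper, aper, ← abs_neg]; congr 1; ring) j]
    have h2 := Finset.abs_sum_le_sum_abs (fun k => a (j + (k + 1)) - a (j + k)) (rg m)
    rw [Finset.sum_range_sub (fun k => a (j + k)) m] at h2
    simp only [add_zero, aper] at h2
    have aj : a j = 1 := by simp only [ha, dt_smul, ge0]; exact inv_mul_cancel₀ (hpos j).ne'
    rw [aj] at h2
    norm_num at h2
    exact h2
  have psum : ∑ k ∈ rg m, p k = 1 := by
    simp only [hp]; rw [← Finset.sum_div, ← hW, div_self hW0.ne']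
  have p0 : ∀ k, 0 ≤ p k := fun k => div_nonneg (inv_nonneg.2 (mul_pos (hpos _) (hpos _)).le) hW0.le
  have A2 : 2 ≤ (W * sn d) * ∑ j ∈ rg m, ∑ k ∈ rg m, p j * p k * |wd (g j) (g k)| := by
    calc (2:ℝ) = ∑ j ∈ rg m, p j * 2 := by rw [← Finset.sum_mul, psum, one_mul]
      _ ≤ ∑ j ∈ rg m, p j * ((W * sn d) * ∑ k ∈ rg m, p k * |wd (g j) (g k)|) :=
          Finset.sum_le_sum fun j _ => mul_le_mul_of_nonneg_left (rowsum j) (p0 j)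
      _ = _ := by
          rw [Finset.mul_sum]
          refine Finset.sum_congr rfl fun j _ => ?_
          rw [Finset.mul_sum, Finset.mul_sum, Finset.mul_sum]
          exact Finset.sum_congr rfl fun k _ => by ring
  set l : ℕ → ℝ := fun k => (h (k + 2) + h k - 2 * cs d * h (k + 1)) / sn d with hl_
  have esum : ∀ k, e (k + 2) + e k = (2 * cs d) • e (k + 1) := by
    intro k
    simp only [he, ev]
    rw [show ((k + 2 : ℕ):ℝ) * d = (k + 1 : ℕ) * d + d by push_cast; ring, show (k : ℝ) * d = (k + 1 : ℕ) * d - d by push_cast; ring, Real.cos_add, Real.sin_add, Real.cos_sub, Real.sin_sub]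
    ext <;> simp <;> ring
  have l0 : ∀ k, 0 ≤ l k := by
    intro k
    refine div_nonneg ?_ hsd.le
    have h1 := hN.add (e (k + 2)) (e k)
    rw [esum, hN.smul] at h1
    have h2 := mul_le_mul_of_nonneg_right (le_abs_self (2 * cs d)) (hpos (k + 1)).le
    have : |2 * cs d| * h (k + 1) ≤ h (k + 2) + h k := h1
    linarith
  have gdiff : ∀ k, g (k + 1) - g k = l k • (-(e (k + 1)).2, (e (k + 1)).1) := by
    intro k
    have hcs := Real.sin_sq_add_cos_sq d
    have e21 : (e (k + 1)).1 = cs d * (e k).1 - sn d * (e k).2 := by rw [esucc]; simp; ring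
    have e22 : (e (k + 1)).2 = cs d * (e k).2 + sn d * (e k).1 := by rw [esucc]; simp
    simp only [hg, hl_]
    ext
    · simp only [Prod.fst_sub, Prod.fst_add, Prod.smul_fst, smul_eq_mul, e21, e22]
      field_simp
      linear_combination (-(h (k + 1) * (e k).2)) * hcs
    · simp only [Prod.snd_sub, Prod.snd_add, Prod.smul_snd, smul_eq_mul, e21, e22]
      field_simp
      linear_combination (h (k + 1) * (e k).1) * hcs
  set S := ∑ k ∈ rg m, l k * h (k + 1) with hS
  have lper : ∀ k, l (k + m) = l k := by
    intro k
    simp only [hl_]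
    rw [show k + m + 2 = k + 2 + m by ring, show k + m + 1 = k + 1 + m by ring, hm_, hm_, hm_]
  have SS : S * sn d = 2 * ∑ k ∈ rg m, h k * h (k + 1) - 2 * cs d * ∑ k ∈ rg m, h k ^ 2 := by
    have a1 := sum_shift (F := fun k => h k * h (k + 1)) (m := m) (fun k => by
      show h (k + m) * h (k + m + 1) = _
      rw [show k + m + 1 = k + 1 + m by ring, hm_, hm_]) 1
    have a2 := sum_shift (F := fun k => h k ^ 2) (m := m) (fun k => by
      show h (k + m) ^ 2 = _
      rw [hm_]) 1
    have a3 : S * sn d = ∑ k ∈ rg m, (h (1 + k) * h (1 + k + 1) + h k * h (k + 1) - 2 * cs d * h (1 + k) ^ 2) := by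
      rw [hS, Finset.sum_mul]
      refine Finset.sum_congr rfl fun k _ => ?_
      simp only [hl_]
      rw [show 1 + k + 1 = k + 2 by ring, show 1 + k = k + 1 by ring]
      field_simp
    rw [a3, Finset.sum_sub_distrib, Finset.sum_add_distrib, ← Finset.mul_sum, a1, a2]
    ring
  have san : W * (S * sn d) ≤ pp ^ 2 := by
    rw [SS]; exact santalo hm2 hpos (by simpa using hm_ 0)
  have S0 : 0 < S := by
    refine lt_of_le_of_ne (Finset.sum_nonneg fun k _ => mul_nonneg (l0 k) (hpos _).le) fun hs => ?_
    have lz : ∀ k < m, l k = 0 := by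
      intro k hk
      have := (Finset.sum_eq_zero_iff_of_nonneg (fun k _ => mul_nonneg (l0 k) (hpos _).le)).1 hs.symm k (Finset.mem_range.2 hk)
      rcases mul_eq_zero.1 this with h1 | h1
      · exact h1
      · exact absurd h1 (hpos _).ne'
    have gz : ∀ k ≤ m, g k = g 0 := by
      intro k
      induction k with
      | zero => intro _; rfl
      | succ k ih =>
        intro hk
        have := gdiff k
        rw [lz k (by omega), zero_smul, sub_eq_zero] at this
        rw [this, ih (by omega)]
    have h1 := gz m le_rfl
    have h2 := gm 0
    rw [zero_add, h1] at h2
    have h3 : g 0 = 0 := self_eq_neg.1 h2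
    have h4 := ge0 0
    rw [h3] at h4
    have h5 := hpos 0
    rw [← h4] at h5
    simp [dt] at h5
  have M1 : ∀ k, N (((g (k + 1)).2, -(g (k + 1)).1) - ((g k).2, -(g k).1)) = l k * h (k + 1) := by
    intro k
    have h1 := gdiff k
    have h2 : (((g (k + 1)).2, -(g (k + 1)).1) - ((g k).2, -(g k).1) : RR) = l k • e (k + 1) := by
      have b1 := congrArg Prod.fst h1
      have b2 := congrArg Prod.snd h1
      simp only [Prod.fst_sub, Prod.snd_sub, Prod.smul_fst, Prod.smul_snd, smul_eq_mul] at b1 b2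
      ext
      · simp only [Prod.fst_sub, Prod.smul_fst, smul_eq_mul]; linarith
      · simp only [Prod.snd_sub, Prod.smul_snd, smul_eq_mul]; linarith
    rw [h2, hN.smul, abs_of_nonneg (l0 k)]
  have M2 : ∀ k, wd ((g k).2, -(g k).1) ((g (k + 1)).2, -(g (k + 1)).1) = l k * h (k + 1) := by
    intro k
    have h1 := gdiff k
    have b1 := congrArg Prod.fst h1
    have b2 := congrArg Prod.snd h1
    have h3 := ge1 k
    simp only [Prod.fst_sub, Prod.snd_sub, Prod.smul_fst, Prod.smul_snd, smul_eq_mul] at b1 b2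
    simp only [dt] at h3
    simp only [wd]
    linear_combination (g k).1 * b2 - (g k).2 * b1 + l k * h3
  have sum2 : ∑ k ∈ rg (2 * m), l k * h (k + 1) = 2 * S := by
    rw [two_mul, Finset.sum_range_add, hS]
    have : ∀ k, l (m + k) * h (m + k + 1) = l k * h (k + 1) := fun k => by
      rw [show m + k + 1 = k + 1 + m by ring, show m + k = k + m by ring, lper, hm_]
    simp only [this]; ring
  have key := hJ (2 * m) (fun k => ((g k).2, -(g k).1)) (by
      have : g (2 * m) = g 0 := by
        rw [show 2 * m = 0 + m + m by ring, gm, gm, neg_neg]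
      simp only [this]) m (fun i => (1 + η)⁻¹ • g i) (fun i => p i) (fun i => p0 i)
      (by rw [← Finset.sum_range (fun i => p i)]; exact psum)
      (fun i x => by
        have h1 := gabs i x
        have h2 : dt ((1 + η)⁻¹ • g i) x = (1 + η)⁻¹ * dt (g i) x := by simp only [dt, Prod.smul_fst, Prod.smul_snd, smul_eq_mul]; ring
        rw [h2, abs_mul, abs_of_pos (by positivity), inv_mul_le_iff₀ (by positivity)]
        exact h1)
  simp only [M1, M2, sum2] at key
  set Q := ∑ j ∈ rg m, ∑ k ∈ rg m, p j * p k * |wd (g j) (g k)| with hQ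
  have Qe : ∑ i : Fin m, ∑ j : Fin m, p i * p j * |wd ((1 + η)⁻¹ • g i) ((1 + η)⁻¹ • g j)| = ((1 + η)⁻¹) ^ 2 * Q := by
    rw [hQ, Finset.sum_range, Finset.mul_sum]
    refine Finset.sum_congr rfl fun i _ => ?_
    rw [Finset.sum_range, Finset.mul_sum]
    refine Finset.sum_congr rfl fun j _ => ?_
    have : wd ((1 + η)⁻¹ • g i) ((1 + η)⁻¹ • g j) = ((1 + η)⁻¹) ^ 2 * wd (g i) (g j) := by
      simp only [wd, Prod.smul_fst, Prod.smul_snd, smul_eq_mul]; ring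
    rw [this, abs_mul, abs_of_pos (by positivity)]; ring
  rw [Qe] at key
  have k2 : pp ^ 2 * Q ≤ 2 * ((1 - ε) * (1 + η) ^ 2) * S := by
    have hη1 : (0:ℝ) < 1 + η := by linarith
    have e1 : pp / 2 * ((1 + η)⁻¹ ^ 2 * Q) * (1 / 2 * (2 * S)) = (pp ^ 2 * Q) * (S / (2 * pp * (1 + η) ^ 2)) := by
      field_simp
    have e2 : (1 - ε) / (4 * pp) * (2 * S) ^ 2 = (2 * ((1 - ε) * (1 + η) ^ 2) * S) * (S / (2 * pp * (1 + η) ^ 2)) := by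
      field_simp; ring
    rw [e1, e2] at key
    exact le_of_mul_le_mul_right key (by positivity)
  have hWs : 0 < W * sn d := mul_pos hW0 hsd
  have k3 : pp ^ 2 * 2 ≤ 2 * ((1 - ε) * (1 + η) ^ 2) * (W * (S * sn d)) := by
    calc pp ^ 2 * 2 ≤ pp ^ 2 * ((W * sn d) * Q) := by gcongr
      _ = (W * sn d) * (pp ^ 2 * Q) := by ring
      _ ≤ (W * sn d) * (2 * ((1 - ε) * (1 + η) ^ 2) * S) := by gcongr
      _ = _ := by ring
  have hpp : 0 < pp ^ 2 := by positivity
  have hws2 : 0 < W * (S * sn d) := by positivity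
  nlinarith
lemma lip_length {X : Type*} [PseudoMetricSpace X] {γ : ℝ → X} {a b C : ℝ} (hC : 0 ≤ C) (hab : a ≤ b)
    (h : ∀ s ∈ Ic a b, ∀ t ∈ Ic a b, dist (γ s) (γ t) ≤ C * |s - t|) :
    eVariationOn γ (Ic a b) ≤ eR (C * (b - a)) := by
  have h1 : LipschitzOnWith C.toNNReal γ (Ic a b) := by
    refine LipschitzOnWith.of_dist_le_mul fun s hs t ht => ?_
    rw [Real.coe_toNNReal _ hC, Real.dist_eq]; exact h s hs t ht
  have h2 := h1.comp_eVariationOn_le (g := id) (s := Ic a b) (fun x hx => hx)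
  have h3 := (monotoneOn_id (s := Ic a b)).eVariationOn_eq (Set.left_mem_Icc.2 hab) (Set.right_mem_Icc.2 hab)
  rw [Set.inter_self] at h3
  refine (show eVariationOn γ (Ic a b) ≤ _ from h2).trans ((mul_le_mul_right h3.le _).trans ?_)
  rw [ENNReal.ofReal_mul hC]; exact le_rfl
lemma poly_loop {X : Type*} [PseudoMetricSpace X] (G : ℕ → ℝ → X) (D : ℕ → ℝ) {n : ℕ} (hn : 0 < n) (hD : ∀ k, 0 ≤ D k)
    (hG : ∀ k, ∀ s ∈ Ic 0 (D k), ∀ t ∈ Ic 0 (D k), dist (G k s) (G k t) ≤ |s - t|)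
    (hj : ∀ k, G k (D k) = G (k + 1) 0) :
    ∃ γ : ℝ → X, (∃ K : ℝ≥0, LipschitzOnWith K γ (Ic 0 1)) ∧
      (∀ k < n, ∀ s ∈ Ic ((k:ℝ) / n) ((k + 1 : ℝ) / n), γ s = G k ((n * s - k) * D k)) ∧
      (eVariationOn γ (Ic 0 1) ≤ eR (∑ k ∈ rg n, D k)) ∧
      (∀ k < n, ∀ s ∈ Ic ((k:ℝ) / n) ((k + 1 : ℝ) / n), ∀ t ∈ Ic ((k:ℝ) / n) ((k + 1 : ℝ) / n),
        dist (γ s) (γ t) ≤ (n * D k) * |s - t|) := by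
  have hn' : (0:ℝ) < n := by exact_mod_cast hn
  set γ : ℝ → X := fun s => G ⌊n * s⌋₊ ((n * s - ⌊n * s⌋₊) * D ⌊n * s⌋₊) with hγ
  have mem : ∀ k : ℕ, ∀ s, s ∈ Ic ((k:ℝ) / n) ((k + 1 : ℝ) / n) → (k:ℝ) ≤ n * s ∧ n * s ≤ k + 1 := by
    intro k s hs
    have h1 := (div_le_iff₀ hn').1 hs.1
    have h2 := (le_div_iff₀ hn').1 hs.2
    constructor <;> linarith
  have ev : ∀ k : ℕ, ∀ s ∈ Ic ((k:ℝ) / n) ((k + 1 : ℝ) / n), γ s = G k ((n * s - k) * D k) := by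
    intro k s hs
    obtain ⟨h1, h2⟩ := mem k s hs
    rcases h2.lt_or_eq with h2 | h2
    · have : ⌊n * s⌋₊ = k := (Nat.floor_eq_iff (by linarith [(Nat.cast_nonneg k : (0:ℝ) ≤ k)])).2 ⟨h1, h2⟩
      simp only [hγ, this]
    · have : ⌊n * s⌋₊ = k + 1 := by rw [h2]; exact_mod_cast Nat.floor_natCast (R := ℝ) (k + 1)
      simp only [hγ, this]
      rw [h2]; push_cast
      rw [sub_self, zero_mul, ← hj, add_sub_cancel_left, one_mul]
  have loc : ∀ k : ℕ, ∀ s ∈ Ic ((k:ℝ) / n) ((k + 1 : ℝ) / n), ∀ t ∈ Ic ((k:ℝ) / n) ((k + 1 : ℝ) / n),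
        dist (γ s) (γ t) ≤ (n * D k) * |s - t| := by
    intro k s hs t ht
    rw [ev k s hs, ev k t ht]
    have m : ∀ s, s ∈ Ic ((k:ℝ) / n) ((k + 1 : ℝ) / n) → (n * s - k) * D k ∈ Ic 0 (D k) := by
      intro s hs
      obtain ⟨h1, h2⟩ := mem k s hs
      exact ⟨mul_nonneg (by linarith) (hD k), by nlinarith [hD k]⟩
    refine (hG k _ (m s hs) _ (m t ht)).trans (le_of_eq ?_)
    rw [show (n * s - k) * D k - (n * t - k) * D k = (n * D k) * (s - t) by ring, abs_mul, abs_of_nonneg (mul_nonneg hn'.le (hD k))]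
  set T := ∑ k ∈ rg n, D k with hT
  have hDT : ∀ k < n, D k ≤ T := fun k hk => Finset.single_le_sum (fun i _ => hD i) (Finset.mem_range.2 hk)
  have hT0 : 0 ≤ T := Finset.sum_nonneg fun i _ => hD i
  have gl : ∀ j ≤ n, ∀ s ∈ Ic (0:ℝ) ((j:ℝ) / n), ∀ t ∈ Ic (0:ℝ) ((j:ℝ) / n), s ≤ t → dist (γ s) (γ t) ≤ (n * T) * (t - s) := by
    intro j
    induction j with
    | zero =>
      intro _ s hs t ht _
      simp at hs ht
      rw [hs, ht]; simp
    | succ j ih =>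
      intro hj s hs t ht hst
      push_cast at hs ht
      have hloc : ∀ s ∈ Ic ((j:ℝ) / n) ((j + 1 : ℝ) / n), ∀ t ∈ Ic ((j:ℝ) / n) ((j + 1 : ℝ) / n), s ≤ t →
        dist (γ s) (γ t) ≤ (n * T) * (t - s) := by
        intro s hs t ht hst
        refine (loc j s hs t ht).trans ?_
        rw [abs_sub_comm, abs_of_nonneg (by linarith)]
        have := hDT j (by omega)
        have : 0 ≤ t - s := by linarith
        gcongr
      have hmid : (j:ℝ) / n ≤ (j + 1 : ℝ) / n := by gcongr; linarith
      have hj0 : 0 ≤ (j:ℝ) / n := by positivity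
      rcases le_total t ((j:ℝ) / n) with h1 | h1
      · exact ih (by omega) s ⟨hs.1, hst.trans h1⟩ t ⟨ht.1, h1⟩ hst
      · rcases le_total s ((j:ℝ) / n) with h2 | h2
        · have a1 := ih (by omega) s ⟨hs.1, h2⟩ _ (Set.right_mem_Icc.2 hj0) h2
          have a2 := hloc _ (Set.left_mem_Icc.2 hmid) t ⟨h1, ht.2⟩ h1
          have := dist_triangle (γ s) (γ ((j:ℝ) / n)) (γ t)
          nlinarith
        · exact hloc s ⟨h2, hs.2⟩ t ⟨h1, ht.2⟩ hst
  have len : ∀ j ≤ n, eVariationOn γ (Ic 0 ((j:ℝ) / n)) ≤ eR (∑ k ∈ rg j, D k) := by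
    intro j
    induction j with
    | zero => intro _; simp
    | succ j ih =>
      intro hj
      have hmid : (j:ℝ) / n ≤ (j + 1 : ℝ) / n := by gcongr; linarith
      have hj0 : 0 ≤ (j:ℝ) / n := by positivity
      have := eVariationOn.Icc_add_Icc γ (s := Set.univ) hj0 hmid (Set.mem_univ _)
      simp only [Set.univ_inter] at this
      push_cast
      rw [← this, Finset.sum_range_succ, ENNReal.ofReal_add (Finset.sum_nonneg fun i _ => hD i) (hD j)]
      refine add_le_add (ih (by omega)) ((lip_length (mul_nonneg hn'.le (hD j)) hmid (loc j)).trans (le_of_eq ?_))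
      congr 1; field_simp; ring
  have h11 : ((n:ℕ):ℝ) / n = 1 := div_self hn'.ne'
  refine ⟨γ, ⟨(n * T).toNNReal, LipschitzOnWith.of_dist_le_mul fun s hs t ht => ?_⟩, fun k _ => ev k, ?_, fun k _ => loc k⟩
  · rw [Real.coe_toNNReal _ (by positivity), Real.dist_eq]
    have := gl n le_rfl
    rw [h11] at this
    rcases le_total s t with h | h
    · rw [abs_sub_comm, abs_of_nonneg (by linarith)]; exact this s hs t ht h
    · rw [abs_of_nonneg (by linarith), dist_comm]; exact this t ht s hs h
  · have := len n le_rfl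
    rwa [h11] at this
lemma rs_piece {F G : ℝ → ℝ} {a b C : ℝ} (hC : 0 ≤ C) (hab : a ≤ b)
    (hF : ∀ s ∈ Ic a b, ∀ t ∈ Ic a b, |F s - F t| ≤ C * |s - t|)
    (hG : ∀ s ∈ Ic a b, ∀ t ∈ Ic a b, |G s - G t| ≤ C * |s - t|) :
    IntervalIntegrable (fun s => F s * deriv G s) volume a b ∧
      |(∫ s in a..b, F s * deriv G s) - F a * (G b - G a)| ≤ (C * (b - a)) ^ 2 := by
  have lipF : LipschitzOnWith C.toNNReal F (Set.uIcc a b) := by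
    rw [Set.uIcc_of_le hab]
    refine LipschitzOnWith.of_dist_le_mul fun s hs t ht => ?_
    rw [Real.coe_toNNReal _ hC, Real.dist_eq]; exact hF s hs t ht
  have lipG : LipschitzOnWith C.toNNReal G (Set.uIcc a b) := by
    rw [Set.uIcc_of_le hab]
    refine LipschitzOnWith.of_dist_le_mul fun s hs t ht => ?_
    rw [Real.coe_toNNReal _ hC, Real.dist_eq]; exact hG s hs t ht
  have acG := lipG.absolutelyContinuousOnInterval
  have iG : IntervalIntegrable (deriv G) volume a b := acG.intervalIntegrable_deriv
  have i1 : IntervalIntegrable (fun s => F s * deriv G s) volume a b := iG.continuousOn_mul lipF.continuousOn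
  refine ⟨i1, ?_⟩
  have e1 : (∫ s in a..b, F s * deriv G s) - F a * (G b - G a) = ∫ s in a..b, (F s - F a) * deriv G s := by
    rw [← acG.integral_deriv_eq_sub, ← intervalIntegral.integral_const_mul, ← intervalIntegral.integral_sub i1 (iG.const_mul _)]
    congr 1; ext s; ring
  rw [e1, ← Real.norm_eq_abs]
  have := intervalIntegral.norm_integral_le_of_norm_le_const_ae (a := a) (b := b) (f := fun s => (F s - F a) * deriv G s) (C := (C * (b - a)) * C) (by
    filter_upwards [Measure.ae_ne volume b] with s hs1 hs2
    rw [Set.uIoc_of_le hab] at hs2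
    have hsb : s < b := lt_of_le_of_ne hs2.2 hs1
    rw [norm_mul]
    refine mul_le_mul ?_ ?_ (norm_nonneg _) (mul_nonneg hC (by linarith))
    · refine (hF s ⟨hs2.1.le, hs2.2⟩ a ⟨le_rfl, hab⟩).trans ?_
      rw [abs_of_nonneg (by linarith [hs2.1])]
      gcongr
    · refine norm_deriv_le_of_lip' hC ?_
      filter_upwards [Ioo_mem_nhds hs2.1 hsb] with t ht
      exact hG t ⟨ht.1.le, ht.2.le⟩ s ⟨hs2.1.le, hs2.2⟩)
  refine this.trans (le_of_eq ?_)
  rw [abs_of_nonneg (by linarith)]; ring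
lemma rs_sum {F G : ℝ → ℝ} {n : ℕ} (hn : 0 < n) {D : ℕ → ℝ} (hD : ∀ k, 0 ≤ D k)
    (hF : ∀ k < n, ∀ s ∈ Ic ((k:ℝ) / n) ((k + 1 : ℝ) / n), ∀ t ∈ Ic ((k:ℝ) / n) ((k + 1 : ℝ) / n), |F s - F t| ≤ (n * D k) * |s - t|)
    (hG : ∀ k < n, ∀ s ∈ Ic ((k:ℝ) / n) ((k + 1 : ℝ) / n), ∀ t ∈ Ic ((k:ℝ) / n) ((k + 1 : ℝ) / n), |G s - G t| ≤ (n * D k) * |s - t|) :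
    |(∫ s in (0:ℝ)..1, F s * deriv G s) - ∑ k ∈ rg n, F ((k:ℝ) / n) * (G (((k + 1 : ℕ):ℝ) / n) - G ((k:ℝ) / n))| ≤ ∑ k ∈ rg n, D k ^ 2 := by
  have hn' : (0:ℝ) < n := by exact_mod_cast hn
  have P : ∀ k < n, _ := fun k hk => rs_piece (mul_nonneg hn'.le (hD k)) (show (k:ℝ) / n ≤ (k + 1 : ℝ) / n by gcongr; linarith) (hF k hk) (hG k hk)
  have := intervalIntegral.sum_integral_adjacent_intervals (μ := volume) (f := fun s => F s * deriv G s) (a := fun k : ℕ => (k:ℝ) / n) (n := n) (fun k hk => by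
    have := (P k hk).1; push_cast; exact this)
  simp only [Nat.cast_zero, zero_div, div_self hn'.ne'] at this
  rw [← this, ← Finset.sum_sub_distrib]
  refine (Finset.abs_sum_le_sum_abs _ _).trans (Finset.sum_le_sum fun k hk => ?_)
  have := (P k (Finset.mem_range.1 hk)).2
  push_cast
  refine this.trans (le_of_eq ?_)
  congr 1; field_simp; ring
def Approx (X : Type*) [MetricSpace X] (N : RR → ℝ) : Prop :=
  ∀ (n : ℕ) (y : ℕ → RR) (η : ℝ), 0 < η → ∀ R0 : ℝ, ∃ R : ℝ, R0 ≤ R ∧ 0 < R ∧ ∃ x : ℕ → X,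
    ∀ i < n, ∀ j < n, |dist (x i) (x j) / R - N (y i - y j)| ≤ η
lemma kur_iso {X : Type u} [MetricSpace X] (x₀ : X) : Isometry (kuratowski X x₀) := by
  refine Isometry.of_dist_eq fun x y => ?_
  rw [dist_eq_norm]
  refine le_antisymm (lp.norm_le_of_forall_le dist_nonneg fun z => ?_) ?_
  · show |(dist x z - dist x₀ z) - (dist y z - dist x₀ z)| ≤ _
    rw [show (dist x z - dist x₀ z) - (dist y z - dist x₀ z) = dist x z - dist y z by ring]
    exact abs_dist_sub_le x y z
  · have := lp.norm_apply_le_norm ENNReal.top_ne_zero (kuratowski X x₀ x - kuratowski X x₀ y) y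
    refine le_trans ?_ this
    show _ ≤ |(dist x y - dist x₀ y) - (dist y y - dist x₀ y)|
    simp
lemma one_real {X : Type u} [MetricSpace X] (x₀ : X) (hX : GeodesicSpace X) {ε s₀ : ℝ} (hε1 : ε ≤ 1)
    (h : ∀ γ : ℝ → X, IsLipLoop γ → s₀ ≤ loopLength γ →
      ∃ φ : RR → Linfty X, BoundsLoop φ (kuratowski X x₀ ∘ γ) ∧ lipArea φ ≤ (1 - ε) / (4 * pp) * (loopLength γ) ^ 2)
    {n : ℕ} (hn : 0 < n) (x : ℕ → X) (hx : x n = x 0) (hs : ∃ k ≤ n, s₀ ≤ dist (x 0) (x k))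
    {m : ℕ} (f : Fin m → X → ℝ) (hf : ∀ i, LipschitzWith 1 (f i)) (p : Fin m → ℝ) (hp : ∀ i, 0 ≤ p i) (hp1 : ∑ i, p i = 1)
    (e : Fin m → Fin m → ℝ) (he : ∀ i j, |e i j| ≤ 1) :
    pp / 2 * ∑ i, ∑ j, p i * p j * (e i j * ∑ k ∈ rg n, f i (x k) * (f j (x (k + 1)) - f j (x k)))
      - pp / 2 * ∑ k ∈ rg n, dist (x k) (x (k + 1)) ^ 2 ≤
      (1 - ε) / (4 * pp) * (∑ k ∈ rg n, dist (x k) (x (k + 1))) ^ 2 := by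
  have hn' : (0:ℝ) < n := by exact_mod_cast hn
  choose G hG using fun k => hX (x k) (x (k + 1))
  set D : ℕ → ℝ := fun k => dist (x k) (x (k + 1)) with hDd
  have hD : ∀ k, 0 ≤ D k := fun k => dist_nonneg
  obtain ⟨γ, hlip, hev, hlen, hloc⟩ := poly_loop G D hn hD (fun k s hs t ht => ((hG k).2.2 s hs t ht).le)
    (fun k => by rw [(hG k).2.1, (hG (k + 1)).1])
  have gk : ∀ k < n, γ ((k:ℝ) / n) = x k := by
    intro k hk
    rw [hev k hk _ ⟨le_rfl, by gcongr; linarith⟩, mul_div_cancel₀ _ hn'.ne', sub_self, zero_mul, (hG k).1]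
  have gk1 : ∀ k < n, γ (((k + 1 : ℕ):ℝ) / n) = x (k + 1) := by
    intro k hk
    push_cast
    rw [hev k hk _ ⟨by gcongr; linarith, le_rfl⟩, mul_div_cancel₀ _ hn'.ne', add_sub_cancel_left, one_mul]
    exact (hG k).2.1
  have gk' : ∀ k ≤ n, γ ((k:ℝ) / n) = x k := by
    intro k hk
    cases k with
    | zero => exact gk 0 hn
    | succ k => exact gk1 k hk
  have g0 : γ 0 = x 0 := by simpa using gk' 0 (Nat.zero_le _)
  have g1 : γ 1 = x 0 := by simpa [div_self hn'.ne', hx] using gk' n le_rfl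
  have hfin : eVariationOn γ (Ic 0 1) ≠ ⊤ := (hlen.trans_lt ENNReal.ofReal_lt_top).ne
  have hL1 : loopLength γ ≤ ∑ k ∈ rg n, D k := ENNReal.toReal_le_of_le_ofReal (Finset.sum_nonneg fun i _ => hD i) hlen
  have hL2 : s₀ ≤ loopLength γ := by
    obtain ⟨k, hk, hk2⟩ := hs
    refine hk2.trans ?_
    have h1 : edist (γ 0) (γ ((k:ℝ) / n)) ≤ eVariationOn γ (Ic 0 1) :=
      eVariationOn.edist_le γ (by simp) ⟨by positivity, (div_le_one hn').2 (by exact_mod_cast hk)⟩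
    rw [g0, gk' k hk] at h1
    have := ENNReal.toReal_mono hfin h1
    rwa [← dist_edist] at this
  obtain ⟨φ, hφ, hA⟩ := h γ ⟨hlip, by rw [g0, g1]⟩ hL2
  have ext : ∀ i, ∃ F : Linfty X → ℝ, LipschitzWith 1 F ∧ ∀ z, F (kuratowski X x₀ z) = f i z := by
    intro i
    have iso := kur_iso x₀
    have : Nonempty X := ⟨x₀⟩
    have hl : LipschitzOnWith 1 (fun y => f i (Function.invFun (kuratowski X x₀) y)) (Set.range (kuratowski X x₀)) := by
      refine LipschitzOnWith.of_dist_le_mul ?_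
      rintro _ ⟨a, rfl⟩ _ ⟨b, rfl⟩
      simp only [Function.leftInverse_invFun iso.injective _]
      rw [iso.dist_eq]
      exact (hf i).dist_le_mul a b
    obtain ⟨F, h1, h2⟩ := hl.extend_real
    exact ⟨F, h1, fun z => by rw [← h2 ⟨z, rfl⟩]; simp only [Function.leftInverse_invFun iso.injective _]⟩
  choose F hF hFe using ext
  have low := area_lower hφ F hF p hp hp1 e he
  simp only [Function.comp, hFe] at low
  have RS : ∀ i j, |(∫ s in (0:ℝ)..1, f i (γ s) * deriv (fun s => f j (γ s)) s) - ∑ k ∈ rg n, f i (x k) * (f j (x (k + 1)) - f j (x k))| ≤ ∑ k ∈ rg n, D k ^ 2 := by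
    intro i j
    have lp : ∀ i, ∀ k < n, ∀ s ∈ Ic ((k:ℝ) / n) ((k + 1 : ℝ) / n), ∀ t ∈ Ic ((k:ℝ) / n) ((k + 1 : ℝ) / n), |f i (γ s) - f i (γ t)| ≤ (n * D k) * |s - t| := by
      intro i k hk s hs t ht
      have := (hf i).dist_le_mul (γ s) (γ t)
      rw [Real.dist_eq, NNReal.coe_one, one_mul] at this
      exact this.trans (hloc k hk s hs t ht)
    have := rs_sum (F := fun s => f i (γ s)) (G := fun s => f j (γ s)) hn hD (lp i) (lp j)
    convert this using 3
    refine Finset.sum_congr rfl fun k hk => ?_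
    rw [gk k (Finset.mem_range.1 hk), gk1 k (Finset.mem_range.1 hk)]
  have cmp : ∑ i, ∑ j, p i * p j * (e i j * ∑ k ∈ rg n, f i (x k) * (f j (x (k + 1)) - f j (x k))) - ∑ k ∈ rg n, D k ^ 2 ≤
      ∑ i, ∑ j, p i * p j * (e i j * ∫ s in (0:ℝ)..1, f i (γ s) * deriv (fun s => f j (γ s)) s) := by
    have : ∑ k ∈ rg n, D k ^ 2 = ∑ i, ∑ j, p i * p j * ∑ k ∈ rg n, D k ^ 2 := by
      simp only [← Finset.sum_mul, ← Finset.mul_sum, hp1, one_mul, mul_one]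
    rw [this, ← Finset.sum_sub_distrib]
    refine Finset.sum_le_sum fun i _ => ?_
    rw [← Finset.sum_sub_distrib]
    refine Finset.sum_le_sum fun j _ => ?_
    rw [← mul_sub]
    refine mul_le_mul_of_nonneg_left ?_ (mul_nonneg (hp i) (hp j))
    have h1 := RS i j
    have h2 := he i j
    rw [abs_sub_comm] at h1
    have h3 : |e i j * (∑ k ∈ rg n, f i (x k) * (f j (x (k + 1)) - f j (x k)) - ∫ s in (0:ℝ)..1, f i (γ s) * deriv (fun s => f j (γ s)) s)| ≤ 1 * ∑ k ∈ rg n, D k ^ 2 := by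
      rw [abs_mul]; exact mul_le_mul h2 h1 (abs_nonneg _) zero_le_one
    have h4 := (abs_le.1 h3).2
    linarith
  have hL0 : 0 ≤ loopLength γ := ENNReal.toReal_nonneg
  have hc : 0 ≤ (1 - ε) / (4 * pp) := div_nonneg (by linarith) (by positivity)
  have hsq : (loopLength γ) ^ 2 ≤ (∑ k ∈ rg n, D k) ^ 2 := by gcongr
  have a1 := mul_le_mul_of_nonneg_left hsq hc
  have a2 := mul_le_mul_of_nonneg_left cmp (show 0 ≤ pp / 2 by positivity)
  linarith
lemma star_ineq {X : Type u} [MetricSpace X] (x₀ : X) (hX : GeodesicSpace X) {ε s₀ : ℝ} (hε1 : ε ≤ 1)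
    (h : ∀ γ : ℝ → X, IsLipLoop γ → s₀ ≤ loopLength γ →
      ∃ φ : RR → Linfty X, BoundsLoop φ (kuratowski X x₀ ∘ γ) ∧ lipArea φ ≤ (1 - ε) / (4 * pp) * (loopLength γ) ^ 2)
    {N : RR → ℝ} (hl : ∀ x, ‖x‖ ≤ N x) (hA : Approx X N)
    {n : ℕ} (y : ℕ → RR) (hy : y n = y 0) (hne : ∃ k ≤ n, y k ≠ y 0)
    {m : ℕ} (g : Fin m → RR) (p : Fin m → ℝ) (hp : ∀ i, 0 ≤ p i) (hp1 : ∑ i, p i = 1) (hg : ∀ i x, |dt (g i) x| ≤ N x)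
    (e : Fin m → Fin m → ℝ) (he : ∀ i j, |e i j| ≤ 1) :
    pp / 2 * ∑ i, ∑ j, p i * p j * (e i j * ∑ k ∈ rg n, dt (g i) (y k) * (dt (g j) (y (k + 1)) - dt (g j) (y k)))
      - pp / 2 * ∑ k ∈ rg n, N (y k - y (k + 1)) ^ 2 ≤
      (1 - ε) / (4 * pp) * (∑ k ∈ rg n, N (y k - y (k + 1))) ^ 2 := by
  obtain ⟨k0, hk0, hne⟩ := hne
  have hn : 0 < n := by
    rcases Nat.eq_zero_or_pos n with h | h
    · subst h; rw [Nat.le_zero.1 hk0] at hne; exact absurd rfl hne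
    · exact h
  have : Nonempty (Fin n) := ⟨⟨0, hn⟩⟩
  set N0 := N (y 0 - y k0) with hN0
  have hN0p : 0 < N0 := lt_of_lt_of_le (norm_pos_iff.2 (sub_ne_zero.2 hne.symm)) (hl _)
  have ηp : ∀ t : ℕ, 0 < N0 / 2 / ((t:ℝ) + 1) := fun t => by positivity
  choose R hR0 hR x hx using fun t : ℕ => hA n y (N0 / 2 / ((t:ℝ) + 1)) (ηp t) (2 * s₀ / N0)
  have ηlim : Tendsto (fun t : ℕ => N0 / 2 / ((t:ℝ) + 1)) atTop (nhds 0) :=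
    (tendsto_const_div_atTop_nhds_zero_nat (N0 / 2)).comp (tendsto_add_atTop_nat 1) |>.congr fun t => by simp
  have modlt : ∀ k, k % n < n := fun k => Nat.mod_lt _ hn
  have ymod : ∀ k ≤ n, y (k % n) = y k := by
    intro k hk
    rcases hk.lt_or_eq with h | h
    · rw [Nat.mod_eq_of_lt h]
    · rw [h, Nat.mod_self, hy]
  set f : ℕ → Fin m → X → ℝ := fun t i z => ⨅ k : Fin n, (R t * dt (g i) (y k) + dist z (x t k)) with hf
  have hbd : ∀ t i z, BddBelow (Set.range fun k : Fin n => (R t * dt (g i) (y k) + dist z (x t k))) := fun t i z => (Set.finite_range _).bddBelow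
  have flip : ∀ t i, LipschitzWith 1 (f t i) := fun t i => LipschitzWith.of_le_add fun a b => by
    simp only [hf]
    rw [← sub_le_iff_le_add]
    refine le_ciInf fun k => ?_
    have := ciInf_le (hbd t i a) k
    linarith [dist_triangle a b (x t k)]
  have fle : ∀ t i, ∀ k < n, f t i (x t k) ≤ R t * dt (g i) (y k) := fun t i k hk => by
    have := ciInf_le (hbd t i (x t k)) ⟨k, hk⟩
    simpa using this
  have fge : ∀ t i, ∀ k < n, R t * dt (g i) (y k) - R t * (N0 / 2 / ((t:ℝ) + 1)) ≤ f t i (x t k) := fun t i k hk => by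
    refine le_ciInf fun l => ?_
    have h1 := hg i (y k - y l)
    rw [dt_sub] at h1
    have h2 := (abs_le.1 (hx t k hk l l.2)).1
    have h3 := (abs_le.1 h1).2
    have h4 : R t * (dist (x t k) (x t l) / R t) = dist (x t k) (x t l) := mul_div_cancel₀ _ (hR t).ne'
    have h5 : dt (g i) (y k) - dt (g i) (y l) ≤ dist (x t k) (x t l) / R t + N0 / 2 / ((t:ℝ) + 1) := by linarith
    have h6 := mul_le_mul_of_nonneg_left h5 (hR t).le
    rw [mul_add, h4] at h6
    linarith
  set a : Fin m → ℕ → ℕ → ℝ := fun i k t => f t i (x t (k % n)) / R t with ha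
  have alim : ∀ i, ∀ k ≤ n, Tendsto (a i k) atTop (nhds (dt (g i) (y k))) := by
    intro i k hk
    have : Tendsto (fun t : ℕ => dt (g i) (y k) - N0 / 2 / ((t:ℝ) + 1)) atTop (nhds (dt (g i) (y k) - 0)) := tendsto_const_nhds.sub ηlim
    rw [sub_zero] at this
    refine tendsto_of_tendsto_of_tendsto_of_le_of_le this tendsto_const_nhds (fun t => ?_) (fun t => ?_)
    · have := fge t i _ (modlt k)
      rw [ymod k hk] at this
      simp only [ha]
      rw [le_div_iff₀ (hR t)]; linarith
    · have := fle t i _ (modlt k)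
      rw [ymod k hk] at this
      simp only [ha]
      rw [div_le_iff₀ (hR t)]; linarith
  set D : ℕ → ℕ → ℝ := fun k t => dist (x t (k % n)) (x t ((k + 1) % n)) / R t with hD
  have dlim : ∀ k < n, Tendsto (D k) atTop (nhds (N (y k - y (k + 1)))) := by
    intro k hk
    rw [tendsto_iff_dist_tendsto_zero]
    refine squeeze_zero (fun _ => dist_nonneg) (fun t => ?_) ηlim
    have := hx t _ (modlt k) _ (modlt (k + 1))
    rw [ymod k hk.le, ymod (k + 1) hk] at this
    exact this
  have key : ∀ t, pp / 2 * ∑ i, ∑ j, p i * p j * (e i j * ∑ k ∈ rg n, a i k t * (a j (k + 1) t - a j k t))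
      - pp / 2 * ∑ k ∈ rg n, D k t ^ 2 ≤ (1 - ε) / (4 * pp) * (∑ k ∈ rg n, D k t) ^ 2 := by
    intro t
    have hRt := hR t
    have := one_real x₀ hX hε1 h hn (fun k => x t (k % n)) (by simp) ⟨k0, hk0, by
      have h1 := (abs_le.1 (hx t _ (modlt 0) _ (modlt k0))).1
      rw [ymod 0 (Nat.zero_le _), ymod k0 hk0, ← hN0] at h1
      have h2 : N0 / 2 / ((t:ℝ) + 1) ≤ N0 / 2 := div_le_self (by positivity) (by linarith [(Nat.cast_nonneg t : (0:ℝ) ≤ t)])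
      have h3 : N0 / 2 ≤ dist (x t (0 % n)) (x t (k0 % n)) / R t := by linarith
      rw [le_div_iff₀ hRt] at h3
      have h4 := (div_le_iff₀ hN0p).1 (hR0 t)
      linarith⟩ (f t) (flip t) p hp hp1 e he
    have fe : ∀ i k, f t i (x t (k % n)) = R t * a i k t := fun i k => (mul_div_cancel₀ _ hRt.ne').symm
    have de : ∀ k, dist (x t (k % n)) (x t ((k + 1) % n)) = R t * D k t := fun k => (mul_div_cancel₀ _ hRt.ne').symm
    simp only [fe, de] at this
    have e1 : ∑ i, ∑ j, p i * p j * (e i j * ∑ k ∈ rg n, R t * a i k t * (R t * a j (k + 1) t - R t * a j k t)) =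
       R t ^ 2 * ∑ i, ∑ j, p i * p j * (e i j * ∑ k ∈ rg n, a i k t * (a j (k + 1) t - a j k t)) := by
      rw [Finset.mul_sum]
      refine Finset.sum_congr rfl fun i _ => ?_
      rw [Finset.mul_sum]
      refine Finset.sum_congr rfl fun j _ => ?_
      simp only [Finset.mul_sum]
      exact Finset.sum_congr rfl fun k _ => by ring
    have e2 : ∑ k ∈ rg n, (R t * D k t) ^ 2 = R t ^ 2 * ∑ k ∈ rg n, D k t ^ 2 := by
      rw [Finset.mul_sum]; exact Finset.sum_congr rfl fun k _ => by ring
    rw [e1, e2, ← Finset.mul_sum] at this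
    refine le_of_mul_le_mul_left ?_ (pow_pos hRt 2)
    linarith
  refine le_of_tendsto_of_tendsto' (b := atTop) ?_ ?_ key
  · refine Tendsto.sub (Tendsto.const_mul _ ?_) (Tendsto.const_mul _ ?_)
    · refine tendsto_finsetSum _ fun i _ => tendsto_finsetSum _ fun j _ => Tendsto.const_mul _ (Tendsto.const_mul _ (tendsto_finsetSum _ fun k hk => ?_))
      have hk := Finset.mem_range.1 hk
      exact (alim i k hk.le).mul ((alim j (k + 1) hk).sub (alim j k hk.le))
    · exact tendsto_finsetSum _ fun k hk => (dlim k (Finset.mem_range.1 hk)).pow 2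
  · exact ((tendsto_finsetSum _ fun k hk => dlim k (Finset.mem_range.1 hk)).pow 2).const_mul _
lemma wd_self (x : RR) : wd x x = 0 := by simp only [wd]; ring
lemma sum_double (f : ℕ → ℝ) (n : ℕ) : ∑ k ∈ rg (2 * n), f k = ∑ k ∈ rg n, (f (2 * k) + f (2 * k + 1)) := by
  induction n with
  | zero => simp
  | succ n ih => rw [show 2 * (n + 1) = 2 * n + 1 + 1 by ring, Finset.sum_range_succ, Finset.sum_range_succ, ih, Finset.sum_range_succ]; ring
theorem polyIneq_of_approx {X : Type u} [MetricSpace X] (x₀ : X) (hX : GeodesicSpace X) {ε s₀ : ℝ} (hε1 : ε ≤ 1)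
    (h : ∀ γ : ℝ → X, IsLipLoop γ → s₀ ≤ loopLength γ →
      ∃ φ : RR → Linfty X, BoundsLoop φ (kuratowski X x₀ ∘ γ) ∧ lipArea φ ≤ (1 - ε) / (4 * pp) * (loopLength γ) ^ 2)
    {N : RR → ℝ} (hN : IsNm N) (hl : ∀ x, ‖x‖ ≤ N x) (hA : Approx X N) : PolyIneq N ε := by
  have step : ∀ t : ℕ, ∀ (n : ℕ) (u : ℕ → RR), u n = u 0 → ∀ (m : ℕ) (g : Fin m → RR) (p : Fin m → ℝ),
    (∀ i, 0 ≤ p i) → ∑ i, p i = 1 → (∀ i x, |dt (g i) x| ≤ N x) →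
    pp / 2 * (∑ i, ∑ j, p i * p j * |wd (g i) (g j)|) * (1 / 2 * ∑ k ∈ rg n, wd (u k) (u (k + 1)))
      - pp / 2 * ∑ k ∈ rg n, N (u (k + 1) - u k) ^ 2 * (1 / 2) ^ t
      ≤ (1 - ε) / (4 * pp) * (∑ k ∈ rg n, N (u (k + 1) - u k)) ^ 2 := by
    intro t
    induction t with
    | zero =>
      intro n u hu m g p hp hp1 hg
      simp only [pow_zero, mul_one]
      have sym : ∀ a b, N (a - b) = N (b - a) := fun a b => by rw [← neg_sub, hN.neg]
      by_cases hne : ∃ k ≤ n, u k ≠ u 0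
      · have := star_ineq x₀ hX hε1 h hl hA u hu hne g p hp hp1 hg (fun i j => (SignType.sign (wd (g i) (g j)) : ℝ))
          (fun i j => by rcases lt_trichotomy (wd (g i) (g j)) 0 with h | h | h <;> simp [h])
        have e2 : ∑ i, ∑ j, p i * p j * ((SignType.sign (wd (g i) (g j)) : ℝ) * ∑ k ∈ rg n, dt (g i) (u k) * (dt (g j) (u (k + 1)) - dt (g j) (u k)))
           = (∑ i, ∑ j, p i * p j * |wd (g i) (g j)|) * (1 / 2 * ∑ k ∈ rg n, wd (u k) (u (k + 1))) := by
          set A : Fin m → Fin m → ℝ := fun i j => ∑ k ∈ rg n, dt (g i) (u k) * (dt (g j) (u (k + 1)) - dt (g j) (u k)) with hAd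
          set e : Fin m → Fin m → ℝ := fun i j => (SignType.sign (wd (g i) (g j)) : ℝ) with he
          have anti : ∀ i j, e j i = - e i j := by
            intro i j
            have : wd (g j) (g i) = - wd (g i) (g j) := by simp only [wd]; ring
            simp only [he, this, Left.sign_neg]; simp
          have tele : ∀ i j, A i j - A j i = wd (g i) (g j) * ∑ k ∈ rg n, wd (u k) (u (k + 1)) := by
            intro i j
            simp only [hAd]
            rw [← Finset.sum_sub_distrib, Finset.mul_sum]
            exact Finset.sum_congr rfl fun k _ => by simp only [wd, dt]; ring
          have sw : ∑ i, ∑ j, p i * p j * (e i j * A i j) = ∑ i, ∑ j, p i * p j * (-(e i j * A j i)) := by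
            rw [Finset.sum_comm]
            refine Finset.sum_congr rfl fun i _ => Finset.sum_congr rfl fun j _ => ?_
            rw [anti i j]; ring
          have dbl : 2 * ∑ i, ∑ j, p i * p j * (e i j * A i j) = ∑ i, ∑ j, p i * p j * (e i j * (A i j - A j i)) := by
            rw [two_mul]
            nth_rw 2 [sw]
            rw [← Finset.sum_add_distrib]
            refine Finset.sum_congr rfl fun i _ => ?_
            rw [← Finset.sum_add_distrib]
            exact Finset.sum_congr rfl fun j _ => by ring
          have fin : ∑ i, ∑ j, p i * p j * (e i j * (A i j - A j i)) = (∑ i, ∑ j, p i * p j * |wd (g i) (g j)|) * ∑ k ∈ rg n, wd (u k) (u (k + 1)) := by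
            rw [Finset.sum_mul]
            refine Finset.sum_congr rfl fun i _ => ?_
            rw [Finset.sum_mul]
            refine Finset.sum_congr rfl fun j _ => ?_
            rw [tele, ← sign_mul_self (wd (g i) (g j))]; ring
          linarith
        rw [e2, ← mul_assoc] at this
        simpa only [sym] using this
      · push Not at hne
        have c1 : ∀ k ∈ rg n, wd (u k) (u (k + 1)) = 0 := fun k hk => by
          have := Finset.mem_range.1 hk
          rw [hne k (by omega), hne (k + 1) (by omega), wd_self]
        have N00 : N 0 = 0 := by have := hN.smul 0 0; simpa using this
        have c2 : ∀ k ∈ rg n, N (u (k + 1) - u k) = 0 := fun k hk => by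
          have := Finset.mem_range.1 hk
          rw [hne k (by omega), hne (k + 1) (by omega), sub_self, N00]
        have c3 : ∀ k ∈ rg n, N (u (k + 1) - u k) ^ 2 = 0 := fun k hk => by rw [c2 k hk]; simp
        rw [Finset.sum_eq_zero c1, Finset.sum_eq_zero c2, Finset.sum_eq_zero c3]
        simp
    | succ t ih =>
      intro n u hu m g p hp hp1 hg
      set v : ℕ → RR := fun j => (1 / 2 : ℝ) • (u (j / 2) + u ((j + 1) / 2)) with hv
      have v0 : ∀ k, v (2 * k) = u k := fun k => by
        simp only [hv]
        rw [show 2 * k / 2 = k by omega, show (2 * k + 1) / 2 = k by omega]; module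
      have v1 : ∀ k, v (2 * k + 1) = (1 / 2 : ℝ) • (u k + u (k + 1)) := fun k => by
        simp only [hv]
        rw [show (2 * k + 1) / 2 = k by omega, show (2 * k + 1 + 1) / 2 = k + 1 by omega]
      have v2 : ∀ k, v (2 * k + 1 + 1) = u (k + 1) := fun k => v0 (k + 1)
      have := ih (2 * n) v (by rw [v0, hu, ← v0 0]) m g p hp hp1 hg
      simp only [sum_double, v0, v1, v2] at this
      have d1 : ∀ k, N ((1 / 2 : ℝ) • (u k + u (k + 1)) - u k) = 1 / 2 * N (u (k + 1) - u k) := fun k => by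
        rw [show (1 / 2 : ℝ) • (u k + u (k + 1)) - u k = (1 / 2 : ℝ) • (u (k + 1) - u k) by module, hN.smul, abs_of_pos (by norm_num)]
      have d2 : ∀ k, N (u (k + 1) - (1 / 2 : ℝ) • (u k + u (k + 1))) = 1 / 2 * N (u (k + 1) - u k) := fun k => by
        rw [show u (k + 1) - (1 / 2 : ℝ) • (u k + u (k + 1)) = (1 / 2 : ℝ) • (u (k + 1) - u k) by module, hN.smul, abs_of_pos (by norm_num)]
      have w1 : ∀ k, wd (u k) ((1 / 2 : ℝ) • (u k + u (k + 1))) + wd ((1 / 2 : ℝ) • (u k + u (k + 1))) (u (k + 1)) = wd (u k) (u (k + 1)) := fun k => by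
        simp only [wd, Prod.smul_fst, Prod.smul_snd, Prod.fst_add, Prod.snd_add, smul_eq_mul]; ring
      simp only [d1, d2, w1] at this
      have s1 : ∀ k, (1 / 2 * N (u (k + 1) - u k)) ^ 2 * (1 / 2) ^ t + (1 / 2 * N (u (k + 1) - u k)) ^ 2 * (1 / 2) ^ t = N (u (k + 1) - u k) ^ 2 * (1 / 2) ^ (t + 1) := fun k => by ring
      have s2 : ∀ k, 1 / 2 * N (u (k + 1) - u k) + 1 / 2 * N (u (k + 1) - u k) = N (u (k + 1) - u k) := fun k => by ring
      simpa only [s1, s2] using this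
  intro n u hu m g p hp hp1 hg
  have lim : Tendsto (fun t : ℕ => pp / 2 * (∑ i, ∑ j, p i * p j * |wd (g i) (g j)|) * (1 / 2 * ∑ k ∈ rg n, wd (u k) (u (k + 1)))
      - pp / 2 * ∑ k ∈ rg n, N (u (k + 1) - u k) ^ 2 * (1 / 2) ^ t) atTop
      (nhds (pp / 2 * (∑ i, ∑ j, p i * p j * |wd (g i) (g j)|) * (1 / 2 * ∑ k ∈ rg n, wd (u k) (u (k + 1)))
      - pp / 2 * ∑ k ∈ rg n, N (u (k + 1) - u k) ^ 2 * 0)) :=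
    tendsto_const_nhds.sub (Tendsto.const_mul _ (tendsto_finsetSum _ fun k _ => (tendsto_pow_atTop_nhds_zero_of_lt_one (by norm_num) (by norm_num)).const_mul _))
  have := le_of_tendsto' lim fun t => step t n u hu m g p hp hp1 hg
  simpa using this
section hyp
variable {X : Type*} [MetricSpace X]
def Geo (σ : ℝ → X) (l : ℝ) : Prop := 0 ≤ l ∧ ∀ s ∈ Ic 0 l, ∀ t ∈ Ic 0 l, dist (σ s) (σ t) = |s - t|
def Pth (m : X) (r L : ℝ) (a b : X) : Prop :=
  0 ≤ L ∧ ∃ c : ℝ → X, c 0 = a ∧ c L = b ∧ (∀ s ∈ Ic 0 L, ∀ t ∈ Ic 0 L, dist (c s) (c t) ≤ |s - t|) ∧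
    ∀ s ∈ Ic 0 L, r ≤ dist m (c s)
lemma Pth.mono {m : X} {r L L' : ℝ} {a b : X} (h : Pth m r L a b) (hL : L ≤ L') : Pth m r L' a b := by
  obtain ⟨h0, c, c0, c1, cl, cf⟩ := h
  have mm : ∀ s ∈ Ic 0 L', min s L ∈ Ic 0 L := fun s hs => ⟨le_min hs.1 h0, min_le_right _ _⟩
  refine ⟨h0.trans hL, fun s => c (min s L), by simp [h0, c0], by simp [hL, c1], fun s hs t ht => ?_, fun s hs => cf _ (mm s hs)⟩
  refine (cl _ (mm s hs) _ (mm t ht)).trans ?_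
  simpa using abs_min_sub_min_le_max s L t L
lemma Pth.symm {m : X} {r L : ℝ} {a b : X} (h : Pth m r L a b) : Pth m r L b a := by
  obtain ⟨h0, c, c0, c1, cl, cf⟩ := h
  have mm : ∀ s ∈ Ic 0 L, L - s ∈ Ic 0 L := fun s hs => ⟨by linarith [hs.2], by linarith [hs.1]⟩
  refine ⟨h0, fun s => c (L - s), by simp [c1], by simp [c0], fun s hs t ht => ?_, fun s hs => cf _ (mm s hs)⟩
  refine (cl _ (mm s hs) _ (mm t ht)).trans ?_
  rw [show L - s - (L - t) = t - s by ring, abs_sub_comm]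
lemma Pth.trans {m : X} {r L L' : ℝ} {a b d : X} (h : Pth m r L a b) (h' : Pth m r L' b d) : Pth m r (L + L') a d := by
  obtain ⟨h0, c, c0, c1, cl, cf⟩ := h
  obtain ⟨h0', c', c0', c1', cl', cf'⟩ := h'
  set e : ℝ → X := fun s => if s ≤ L then c s else c' (s - L) with he
  have e1 : ∀ s, s ≤ L → e s = c s := fun s hs => by simp [he, hs]
  have e2 : ∀ s, L ≤ s → e s = c' (s - L) := fun s hs => by
    rcases hs.lt_or_eq with hs | hs
    · simp [he, not_le.2 hs]
    · subst hs; simp [he, c1, c0']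
  refine ⟨by linarith, e, by rw [e1 0 h0, c0], by rw [e2 _ (by linarith), add_sub_cancel_left, c1'], ?_, ?_⟩
  · have main : ∀ s ∈ Ic 0 (L + L'), ∀ t ∈ Ic 0 (L + L'), s ≤ t → dist (e s) (e t) ≤ t - s := by
      intro s hs t ht hst
      have hL1 : L ∈ Ic 0 L := ⟨h0, le_rfl⟩
      have hL2 : (0:ℝ) ∈ Ic 0 L' := ⟨le_rfl, h0'⟩
      rcases le_total t L with h1 | h1
      · rw [e1 s (hst.trans h1), e1 t h1]
        have := cl s ⟨hs.1, hst.trans h1⟩ t ⟨ht.1, h1⟩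
        rwa [abs_sub_comm, abs_of_nonneg (by linarith)] at this
      · have ht' : t - L ∈ Ic 0 L' := ⟨by linarith, by linarith [ht.2]⟩
        rcases le_total s L with h2 | h2
        · rw [e1 s h2, e2 t h1]
          have a1 := cl s ⟨hs.1, h2⟩ L hL1
          have a2 := cl' 0 hL2 (t - L) ht'
          rw [abs_sub_comm, abs_of_nonneg (by linarith)] at a1 a2
          rw [c1] at a1; rw [c0'] at a2
          linarith [dist_triangle (c s) b (c' (t - L))]
        · rw [e2 s h2, e2 t h1]
          have := cl' (s - L) ⟨by linarith, by linarith [hs.2]⟩ (t - L) ht'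
          rw [abs_sub_comm, abs_of_nonneg (by linarith)] at this
          linarith
    intro s hs t ht
    rcases le_total s t with h | h
    · rw [abs_sub_comm, abs_of_nonneg (by linarith)]; exact main s hs t ht h
    · rw [abs_of_nonneg (by linarith), dist_comm]; exact main t ht s hs h
  · intro s hs
    rcases le_total s L with h1 | h1
    · rw [e1 s h1]; exact cf s ⟨hs.1, h1⟩
    · rw [e2 s h1]; exact cf' _ ⟨by linarith, by linarith [hs.2]⟩
lemma Geo.sub {σ : ℝ → X} {l : ℝ} (h : Geo σ l) {a b : ℝ} (ha : 0 ≤ a) (hab : a ≤ b) (hb : b ≤ l) : Geo (fun s => σ (a + s)) (b - a) := by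
  refine ⟨by linarith, fun s hs t ht => ?_⟩
  rw [h.2 _ ⟨by linarith [hs.1], by linarith [hs.2]⟩ _ ⟨by linarith [ht.1], by linarith [ht.2]⟩]
  congr 1; ring
lemma Geo.pth {σ : ℝ → X} {l : ℝ} (h : Geo σ l) {m : X} {r : ℝ} (hm : ∀ s ∈ Ic 0 l, r ≤ dist m (σ s)) {a b : ℝ}
    (ha : a ∈ Ic 0 l) (hb : b ∈ Ic 0 l) {L : ℝ} (hL : dist (σ a) (σ b) ≤ L) : Pth m r L (σ a) (σ b) := by
  refine Pth.mono ?_ hL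
  have main : ∀ a ∈ Ic 0 l, ∀ b ∈ Ic 0 l, a ≤ b → Pth m r (dist (σ a) (σ b)) (σ a) (σ b) := by
    intro a ha b hb hab
    have hg := h.sub ha.1 hab hb.2
    have hd : dist (σ a) (σ b) = b - a := by rw [h.2 a ha b hb, abs_sub_comm, abs_of_nonneg (by linarith)]
    rw [hd]
    exact ⟨hg.1, _, by simp, by simp, fun s hs t ht => (hg.2 s hs t ht).le, fun s hs => hm _ ⟨by linarith [ha.1, hs.1], by linarith [hb.2, hs.2]⟩⟩
  rcases le_total a b with hab | hab
  · exact main a ha b hb hab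
  · rw [dist_comm]; exact (main b hb a ha hab).symm
lemma bridge (hX : GeodesicSpace X) {m a b : X} {r ρ : ℝ} (hab : dist a b ≤ ρ) (hm : r + ρ ≤ dist m a) : Pth m r ρ a b := by
  obtain ⟨g, g0, g1, hg⟩ := hX a b
  have hG : Geo g (dist a b) := ⟨dist_nonneg, hg⟩
  have := hG.pth (m := m) (r := r) (fun s hs => by
    have h1 := hg 0 ⟨le_rfl, dist_nonneg⟩ s hs
    rw [g0, zero_sub, abs_neg, abs_of_nonneg hs.1] at h1
    linarith [dist_triangle m (g s) a, dist_comm a (g s), hs.2]) (a := 0) (b := dist a b) ⟨le_rfl, dist_nonneg⟩ ⟨dist_nonneg, le_rfl⟩ (L := ρ) (by rw [g0, g1]; exact hab)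
  rwa [g0, g1] at this
def FatTri (X : Type*) [MetricSpace X] (P D : ℝ) : Prop :=
  ∃ (σ τ ω : ℝ → X) (l1 l2 l3 t : ℝ), Geo σ l1 ∧ Geo τ l2 ∧ Geo ω l3 ∧ σ l1 = τ 0 ∧ τ l2 = ω 0 ∧ ω l3 = σ 0 ∧
    l1 + l2 + l3 ≤ P ∧ t ∈ Ic 0 l1 ∧ (∀ s ∈ Ic 0 l2, D ≤ dist (σ t) (τ s)) ∧ (∀ s ∈ Ic 0 l3, D ≤ dist (σ t) (ω s))
def Conf (X : Type*) [MetricSpace X] (D : ℝ) : Prop :=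
  ∃ (σ : ℝ → X) (l t : ℝ), Geo σ l ∧ l ≤ 8 * D ∧ D ≤ t ∧ t ≤ l - D ∧ Pth (σ t) D (60 * D) (σ l) (σ 0)
lemma connect (hX : GeodesicSpace X) {D P : ℝ} (hD : 0 < D) {τ ω : ℝ → X} {l1 l2 l3 : ℝ} (hτ : Geo τ l2) (hω : Geo ω l3) (hj : τ l2 = ω 0)
    (hd : dist (ω l3) (τ 0) ≤ l1) (hP : l1 + l2 + l3 ≤ P) {m : X}
    (mτ : ∀ s ∈ Ic 0 l2, D ≤ dist m (τ s)) (mω : ∀ s ∈ Ic 0 l3, D ≤ dist m (ω s))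
    {a b : ℝ} (ha : a ∈ Ic 0 l2) (hb : b ∈ Ic 0 l3) (hma : dist m (τ a) ≤ 6 * D) (hab : dist (τ a) (ω b) ≤ 12 * D) :
    Pth m D (56 * D) (τ a) (ω b) ∨ FatTri X P (2 * D) := by
  have h2 : l2 ∈ Ic 0 l2 := ⟨hτ.1, le_rfl⟩
  have h0 : (0:ℝ) ∈ Ic 0 l3 := ⟨le_rfl, hω.1⟩
  rcases le_or_gt (l2 - a) (20 * D) with hz | hz
  · left
    have e1 : dist (τ a) (τ l2) ≤ 20 * D := by rw [hτ.2 a ha l2 h2, abs_sub_comm, abs_of_nonneg (by linarith [ha.2])]; exact hz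
    have e2 : dist (ω 0) (ω b) ≤ 32 * D := by
      rw [← hj]; linarith [dist_triangle (τ l2) (τ a) (ω b), dist_comm (τ a) (τ l2)]
    have p1 := hτ.pth mτ ha h2 e1
    have p2 := hω.pth mω h0 hb e2
    rw [hj] at p1
    exact (p1.trans p2).mono (by linarith)
  · have hw : a + 20 * D ∈ Ic 0 l2 := ⟨by linarith [ha.1], by linarith⟩
    have daw : dist (τ a) (τ (a + 20 * D)) = 20 * D := by
      rw [hτ.2 a ha _ hw, abs_sub_comm, abs_of_nonneg (by linarith)]; ring
    by_cases hc : ∃ s ∈ Ic 0 l3, dist (τ (a + 20 * D)) (ω s) < 2 * D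
    · left
      obtain ⟨s, hs, hs2⟩ := hc
      have p1 := hτ.pth mτ ha hw daw.le
      have hm2 : D + 2 * D ≤ dist m (τ (a + 20 * D)) := by
        linarith [dist_triangle (τ a) m (τ (a + 20 * D)), dist_comm m (τ a)]
      have p2 := bridge hX hs2.le hm2
      have e3 : dist (ω s) (ω b) ≤ 34 * D := by
        have t1 := dist_triangle4 (ω s) (τ (a + 20 * D)) (τ a) (ω b)
        linarith [dist_comm (ω s) (τ (a + 20 * D)), dist_comm (τ (a + 20 * D)) (τ a)]
      have p3 := hω.pth mω hs hb e3
      exact ((p1.trans p2).trans p3).mono (by linarith)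
    · right
      push Not at hc
      obtain ⟨κ, k0, k1, hκ⟩ := hX (ω b) (τ a)
      refine ⟨fun s => τ (a + s), fun s => ω (0 + s), κ, l2 - a, b - 0, dist (ω b) (τ a), 20 * D, hτ.sub ha.1 ha.2 le_rfl, hω.sub le_rfl hb.1 hb.2, ⟨dist_nonneg, hκ⟩, ?_, ?_, ?_, ?_, ⟨by linarith, hz.le⟩, ?_, ?_⟩
      · simp [hj]
      · simp [k0]
      · simp [k1]
      · have t1 := dist_triangle4 (ω b) (ω l3) (τ 0) (τ a)
        have t2 : dist (ω b) (ω l3) = l3 - b := by rw [hω.2 b hb l3 ⟨hω.1, le_rfl⟩, abs_sub_comm, abs_of_nonneg (by linarith [hb.2])]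
        have t3 : dist (τ 0) (τ a) = a := by rw [hτ.2 0 ⟨le_rfl, hτ.1⟩ a ha, zero_sub, abs_neg, abs_of_nonneg ha.1]
        linarith
      · intro s hs
        show _ ≤ dist (τ (a + 20 * D)) (ω (0 + s))
        rw [zero_add]
        exact hc s ⟨hs.1, by linarith [hs.2, hb.2]⟩
      · intro s hs
        have t1 := hκ s hs _ ⟨dist_nonneg, le_rfl⟩
        rw [k1, abs_sub_comm, abs_of_nonneg (by linarith [hs.2])] at t1
        have := dist_triangle (τ a) (κ s) (τ (a + 20 * D))
        show _ ≤ dist (τ (a + 20 * D)) (κ s)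
        linarith [dist_comm (κ s) (τ a), dist_comm (κ s) (τ (a + 20 * D)), dist_comm (ω b) (τ a), hs.1]
lemma fat_conf (hX : GeodesicSpace X) (n : ℕ) : ∀ P D : ℝ, 0 < D → P ≤ D * 2 ^ n → FatTri X P D → ∃ D', D ≤ D' ∧ Conf X D' := by
  induction n with
  | zero =>
    rintro P D hD hP ⟨σ, τ, ω, l1, l2, l3, t, hσ, hτ, hω, j1, j2, j3, hp, ht, f1, f2⟩
    exfalso
    have a1 := f1 0 ⟨le_rfl, hτ.1⟩
    have a2 := f2 l3 ⟨hω.1, le_rfl⟩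
    rw [← j1, hσ.2 t ht l1 ⟨hσ.1, le_rfl⟩, abs_sub_comm, abs_of_nonneg (by linarith [ht.2])] at a1
    rw [j3, hσ.2 t ht 0 ⟨le_rfl, hσ.1⟩, sub_zero, abs_of_nonneg ht.1] at a2
    have := hτ.1; have := hω.1
    simp at hP
    linarith
  | succ n ih =>
    rintro P D hD hP ⟨σ, τ, ω, l1, l2, l3, t, hσ, hτ, hω, j1, j2, j3, hp, ht, f1, f2⟩
    have rec2 : FatTri X P (2 * D) → ∃ D', D ≤ D' ∧ Conf X D' := fun h => by
      obtain ⟨D', h1, h2⟩ := ih P (2 * D) (by linarith) (by rw [pow_succ] at hP; linarith) h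
      exact ⟨D', by linarith, h2⟩
    have z1 : l1 ∈ Ic 0 l1 := ⟨hσ.1, le_rfl⟩
    have z0 : (0:ℝ) ∈ Ic 0 l1 := ⟨le_rfl, hσ.1⟩
    have a1 := f1 0 ⟨le_rfl, hτ.1⟩
    have a2 := f2 l3 ⟨hω.1, le_rfl⟩
    rw [← j1, hσ.2 t ht l1 z1, abs_sub_comm, abs_of_nonneg (by linarith [ht.2])] at a1
    rw [j3, hσ.2 t ht 0 z0, sub_zero, abs_of_nonneg ht.1] at a2
    by_cases hrec : FatTri X P (2 * D)
    · exact rec2 hrec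
    have side : ∀ s ∈ Ic 0 l1, dist (σ t) (σ s) = 4 * D → ∃ v, ((∃ a ∈ Ic 0 l2, τ a = v) ∨ (∃ a ∈ Ic 0 l3, ω a = v)) ∧ Pth (σ t) D (2 * D) (σ s) v ∧ dist (σ t) v ≤ 6 * D := by
      intro s hs hs4
      by_contra hcon
      push Not at hcon
      refine hrec ⟨σ, τ, ω, l1, l2, l3, s, hσ, hτ, hω, j1, j2, j3, hp, hs, fun a ha => ?_, fun a ha => ?_⟩
      · by_contra hlt
        push Not at hlt
        have := hcon (τ a) (Or.inl ⟨a, ha, rfl⟩) (bridge hX hlt.le (by linarith))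
        linarith [dist_triangle (σ t) (σ s) (τ a)]
      · by_contra hlt
        push Not at hlt
        have := hcon (ω a) (Or.inr ⟨a, ha, rfl⟩) (bridge hX hlt.le (by linarith))
        linarith [dist_triangle (σ t) (σ s) (ω a)]
    have const : ∀ z : X, D ≤ dist (σ t) z → Pth (σ t) D (2 * D) z z := fun z hz =>
      ⟨by linarith, fun _ => z, rfl, rfl, fun s _ t _ => by simp, fun _ _ => hz⟩
    obtain ⟨a, ha0, hat, hta, v, hv, pv, dv⟩ : ∃ a, 0 ≤ a ∧ a ≤ t - D ∧ t - a ≤ 4 * D ∧ ∃ v, ((∃ a ∈ Ic 0 l2, τ a = v) ∨ (∃ a ∈ Ic 0 l3, ω a = v)) ∧ Pth (σ t) D (2 * D) (σ a) v ∧ dist (σ t) v ≤ 6 * D := by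
      rcases le_total t (4 * D) with h4 | h4
      · refine ⟨0, le_rfl, by linarith, by linarith, ω l3, Or.inr ⟨l3, ⟨hω.1, le_rfl⟩, rfl⟩, ?_, ?_⟩
        · rw [j3]; refine const _ ?_; rw [← j3]; exact f2 l3 ⟨hω.1, le_rfl⟩
        · rw [j3, hσ.2 t ht 0 z0, sub_zero, abs_of_nonneg ht.1]; linarith
      · refine ⟨t - 4 * D, by linarith, by linarith, by linarith, side _ ⟨by linarith, by linarith [ht.2]⟩ ?_⟩
        rw [hσ.2 t ht _ ⟨by linarith, by linarith [ht.2]⟩, show t - (t - 4 * D) = 4 * D by ring, abs_of_pos (by linarith)]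
    obtain ⟨b, hbl, htb, hbt, v', hv', pv', dv'⟩ : ∃ b, b ≤ l1 ∧ t + D ≤ b ∧ b - t ≤ 4 * D ∧ ∃ v, ((∃ a ∈ Ic 0 l2, τ a = v) ∨ (∃ a ∈ Ic 0 l3, ω a = v)) ∧ Pth (σ t) D (2 * D) (σ b) v ∧ dist (σ t) v ≤ 6 * D := by
      rcases le_total (l1 - t) (4 * D) with h4 | h4
      · refine ⟨l1, le_rfl, by linarith, by linarith, τ 0, Or.inl ⟨0, ⟨le_rfl, hτ.1⟩, rfl⟩, ?_, ?_⟩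
        · rw [j1]; exact const _ (f1 0 ⟨le_rfl, hτ.1⟩)
        · rw [← j1, hσ.2 t ht l1 z1, abs_sub_comm, abs_of_nonneg (by linarith [ht.2])]; linarith
      · refine ⟨t + 4 * D, by linarith, by linarith, by linarith, side _ ⟨by linarith [ht.1], by linarith⟩ ?_⟩
        rw [hσ.2 t ht _ ⟨by linarith [ht.1], by linarith⟩, show t - (t + 4 * D) = -(4 * D) by ring, abs_neg, abs_of_pos (by linarith)]
    have dvv : dist v v' ≤ 12 * D := by linarith [dist_triangle v (σ t) v', dist_comm v (σ t)]
    have hd : dist (ω l3) (τ 0) ≤ l1 := by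
      rw [j3, ← j1, hσ.2 0 z0 l1 z1, zero_sub, abs_neg, abs_of_nonneg hσ.1]
    have mid : Pth (σ t) D (56 * D) v v' := by
      rcases hv with ⟨x, hx, rfl⟩ | ⟨x, hx, rfl⟩ <;> rcases hv' with ⟨y, hy, rfl⟩ | ⟨y, hy, rfl⟩
      · exact hτ.pth f1 hx hy (by linarith)
      · exact (connect hX hD hτ hω j2 hd hp f1 f2 hx hy dv dvv).resolve_right hrec
      · rw [dist_comm] at dvv
        exact ((connect hX hD hτ hω j2 hd hp f1 f2 hy hx dv' dvv).resolve_right hrec).symm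
      · exact hω.pth f2 hx hy (by linarith)
    refine ⟨D, le_rfl, fun s => σ (a + s), b - a, t - a, hσ.sub ha0 (by linarith) hbl, by linarith, by linarith, by linarith, ?_⟩
    simp only [add_sub_cancel, add_zero]
    exact ((pv'.trans mid.symm).trans pv.symm).mono (by linarith)
theorem conf_of_not_hyp (hX : GeodesicSpace X) (h : ¬ GromovHyperbolic X) (D : ℝ) : ∃ D', D ≤ D' ∧ 0 < D' ∧ Conf X D' := by
  simp only [GromovHyperbolic] at h
  push Not at h
  obtain ⟨x, y, z, g1, g2, g3, h1, h2, h3, s, hs, hfar⟩ := h (max D 1) (le_max_of_le_right zero_le_one)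
  set D0 := max D 1 with hD0
  have hpos : 0 < D0 := lt_of_lt_of_le one_pos (le_max_right _ _)
  set P := dist x y + dist y z + dist z x with hP
  obtain ⟨n, hn⟩ := pow_unbounded_of_one_lt (P / D0) (one_lt_two)
  have hn' : P ≤ D0 * 2 ^ n := by
    have := (div_lt_iff₀ hpos).1 hn
    linarith
  obtain ⟨D', hD', hc⟩ := fat_conf hX n P D0 hpos hn' ⟨g1, g2, g3, dist x y, dist y z, dist z x, s, ⟨dist_nonneg, h1.2.2⟩, ⟨dist_nonneg, h2.2.2⟩, ⟨dist_nonneg, h3.2.2⟩,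
    by rw [h1.2.1, h2.1], by rw [h2.2.1, h3.1], by rw [h3.2.1, h1.1], le_rfl, hs,
    fun a ha => (hfar _ (Or.inl ⟨a, ha, rfl⟩)).le, fun a ha => (hfar _ (Or.inr ⟨a, ha, rfl⟩)).le⟩
  exact ⟨D', (le_max_left _ _).trans hD', hpos.trans_le hD', hc⟩
end hyp
def DL (δ : RR → RR → ℝ) (u : RR → ℝ) : Prop := ∀ z w, |u z - u w| ≤ δ z w
structure PM (δ : RR → RR → ℝ) (L : ℝ≥0) (J : RR → ℝ) (C : ℝ) : Prop where
  self : ∀ z, δ z z = 0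
  symm : ∀ z w, δ z w = δ w z
  tri : ∀ x y z, δ x z ≤ δ x y + δ y z
  lip : ∀ z w, δ z w ≤ L * dist z w
  Jint : IntegrableOn J D2
  Jnn : ∀ z, 0 ≤ J z
  JC : ∫ z in D2, J z ≤ C
  area : ∀ u v, DL δ u → DL δ v → ∀ᵐ z ∂(volume.restrict D2), |wd (grad u z) (grad v z)| ≤ J z
noncomputable def kK (x : ℝ) : ℝ := Real.smoothTransition ((x + 1) / 2)
noncomputable def kk (x : ℝ) : ℝ := deriv kK x
lemma kK_smooth : ContDiff ℝ 3 kK := by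
  unfold kK; exact Real.smoothTransition.contDiff.comp (by fun_prop)
lemma kk_smooth : ContDiff ℝ 2 kk := by
  have h := kK_smooth
  rw [show (3 : WithTop ℕ∞) = 2 + 1 by norm_num, contDiff_succ_iff_deriv] at h
  exact h.2.2
lemma kK_left {x : ℝ} (h : x ≤ -1) : kK x = 0 := Real.smoothTransition.zero_of_nonpos (by linarith)
lemma kK_right {x : ℝ} (h : 1 ≤ x) : kK x = 1 := Real.smoothTransition.one_of_one_le (by linarith)
lemma kk_zero {x : ℝ} (h : 1 < |x|) : kk x = 0 := by
  rcases lt_abs.1 h with h | h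
  · have : kK =ᶠ[nhds x] fun _ => 1 := by
      filter_upwards [lt_mem_nhds h] with y hy using kK_right hy.le
    unfold kk; rw [this.deriv_eq]; simp
  · have : kK =ᶠ[nhds x] fun _ => 0 := by
      filter_upwards [gt_mem_nhds (show x < -1 by linarith)] with y hy using kK_left hy.le
    unfold kk; rw [this.deriv_eq]; simp
lemma kk_cs : HasCompactSupport kk := HasCompactSupport.intro (isCompact_Icc (a := (-1:ℝ)) (b := 1)) fun x hx =>
  kk_zero (by by_contra h; push Not at h; exact hx (abs_le.1 h))
lemma kk_bdd : ∃ C : ℝ, 1 ≤ C ∧ ∀ x, |kk x| ≤ C := by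
  obtain ⟨C, hC⟩ := kk_smooth.continuous.bounded_above_of_compact_support kk_cs
  exact ⟨max C 1, le_max_right _ _, fun x => (hC x).trans (le_max_left _ _)⟩
noncomputable def Kc (c ρ x : ℝ) : ℝ := kK ((x - c) / ρ)
noncomputable def kc (c ρ x : ℝ) : ℝ := kk ((x - c) / ρ) / ρ
lemma Kc_deriv (c ρ x : ℝ) : HasDerivAt (Kc c ρ) (kc c ρ x) x := by
  have h1 : HasDerivAt (fun x => (x - c) / ρ) (1 / ρ) x := ((hasDerivAt_id x).sub_const c).div_const ρ
  have h2 : HasDerivAt kK (kk ((x - c) / ρ)) ((x - c) / ρ) :=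
    (kK_smooth.differentiable (by norm_num) _).hasDerivAt
  have := h2.comp x h1
  rw [mul_one_div] at this
  exact this
lemma kc_smooth (c ρ : ℝ) : ContDiff ℝ 1 (kc c ρ) := by
  have := kk_smooth.of_le (show (1 : WithTop ℕ∞) ≤ 2 by norm_num)
  unfold kc; exact (this.comp (by fun_prop)).div_const _
lemma Kc_smooth (c ρ : ℝ) : ContDiff ℝ 1 (Kc c ρ) := by
  have := kK_smooth.of_le (show (1 : WithTop ℕ∞) ≤ 3 by norm_num)
  unfold Kc; exact this.comp (by fun_prop)
lemma Kc_left {c ρ x : ℝ} (hρ : 0 < ρ) (h : x ≤ c - ρ) : Kc c ρ x = 0 :=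
  kK_left (by rw [div_le_iff₀ hρ]; linarith)
lemma Kc_right {c ρ x : ℝ} (hρ : 0 < ρ) (h : c + ρ ≤ x) : Kc c ρ x = 1 :=
  kK_right (by rw [le_div_iff₀ hρ]; linarith)
lemma Kc_mem (c ρ x : ℝ) : 0 ≤ Kc c ρ x ∧ Kc c ρ x ≤ 1 :=
  ⟨Real.smoothTransition.nonneg _, Real.smoothTransition.le_one _⟩
lemma kc_zero {c ρ x : ℝ} (hρ : 0 < ρ) (h : ρ < |x - c|) : kc c ρ x = 0 := by
  unfold kc; rw [kk_zero, zero_div]; rw [abs_div, abs_of_pos hρ, lt_div_iff₀ hρ]; linarith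
lemma kc_le {C : ℝ} (hC : ∀ x, |kk x| ≤ C) {c ρ x : ℝ} (hρ : 0 < ρ) : |kc c ρ x| ≤ C / ρ := by
  unfold kc; rw [abs_div, abs_of_pos hρ]; gcongr; exact hC _
lemma Kc_lip (c : ℝ) {ρ : ℝ} (hρ : 0 < ρ) : ∃ K, LipschitzWith K (Kc c ρ) := by
  obtain ⟨C, h1, hC⟩ := kk_bdd
  refine ⟨Real.toNNReal (C / ρ), lipschitzWith_of_nnnorm_deriv_le
    (fun x => (Kc_deriv c ρ x).differentiableAt) fun x => ?_⟩
  rw [(Kc_deriv c ρ x).deriv, ← NNReal.coe_le_coe, Real.coe_toNNReal _ (by positivity)]; exact kc_le hC hρ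
def LB (u : RR → ℝ) : Prop := (∃ K : ℝ≥0, LipschitzWith K u) ∧ ∃ B : ℝ, ∀ z, |u z| ≤ B
lemma LB.mul {u v : RR → ℝ} (hu : LB u) (hv : LB v) : LB fun z => u z * v z := by
  obtain ⟨⟨K, hK⟩, B, hB⟩ := hu
  obtain ⟨⟨K', hK'⟩, B', hB'⟩ := hv
  have b0 : 0 ≤ B := (abs_nonneg _).trans (hB 0)
  have b0' : 0 ≤ B' := (abs_nonneg _).trans (hB' 0)
  refine ⟨⟨⟨B * K' + B' * K, by positivity⟩, LipschitzWith.of_dist_le_mul fun z w => ?_⟩, B * B', fun z => ?_⟩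
  · have h1 := hK.dist_le_mul z w
    have h2 := hK'.dist_le_mul z w
    rw [Real.dist_eq] at h1 h2 ⊢
    have : u z * v z - u w * v w = u z * (v z - v w) + v w * (u z - u w) := by ring
    rw [this]
    refine (abs_add_le _ _).trans ?_
    rw [abs_mul, abs_mul]
    have e1 := mul_le_mul (hB z) h2 (abs_nonneg _) b0
    have e2 := mul_le_mul (hB' w) h1 (abs_nonneg _) b0'
    show _ ≤ (B * K' + B' * K) * dist z w
    linarith
  · rw [abs_mul]; exact mul_le_mul (hB z) (hB' z) (abs_nonneg _) b0
lemma grad_of {a : RR → ℝ} {a' : RR →L[ℝ] ℝ} {z : RR} (h : HasFDerivAt a a' z) :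
    grad a z = (a' (1, 0), a' (0, 1)) := by unfold grad; rw [h.fderiv]
variable {δ : RR → RR → ℝ} {L : ℝ≥0} {J : RR → ℝ} {C : ℝ}
lemma PM.dl_lip (P : PM δ L J C) {u : RR → ℝ} (hu : DL δ u) : LipschitzWith L u :=
  LipschitzWith.of_dist_le_mul fun z w => (hu z w).trans (P.lip z w)
lemma comp_LB (P : PM δ L J C) {u : RR → ℝ} (hu : DL δ u) {A : ℝ → ℝ} (hA : ContDiff ℝ 1 A) {α β : ℝ}
    (hs : ∀ x, x ∉ Ic α β → A x = 0) : LB fun z => A (u z) := by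
  have hc : HasCompactSupport A := HasCompactSupport.intro isCompact_Icc hs
  obtain ⟨K, hK⟩ := hA.lipschitzWith_of_hasCompactSupport hc (by norm_num)
  obtain ⟨B, hB⟩ := hA.continuous.bounded_above_of_compact_support hc
  exact ⟨⟨_, hK.comp (P.dl_lip hu)⟩, B, fun z => hB _⟩
lemma wd_bdd {u v : RR → ℝ} {K K' : ℝ≥0} (hu : LipschitzWith K u) (hv : LipschitzWith K' v) (z : RR) :
    |wd (grad u z) (grad v z)| ≤ 2 * (K * K') := by
  have h1 := norm_grad_le hu z
  have h2 := norm_grad_le hv z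
  unfold wd
  refine (abs_sub _ _).trans ?_
  rw [abs_mul, abs_mul]
  have := mul_le_mul h1.1 h2.2 (abs_nonneg _) K.2
  have := mul_le_mul h1.2 h2.1 (abs_nonneg _) K.2
  linarith
lemma vol_D2_lt : volume D2 < ⊤ := by
  refine (measure_mono (t := Metric.closedBall (0 : RR) 1) fun z hz => ?_).trans_lt
    measure_closedBall_lt_top
  have hz : z.1 ^ 2 + z.2 ^ 2 ≤ 1 := hz
  rw [mem_closedBall_zero_iff, Prod.norm_def, max_le_iff, Real.norm_eq_abs, Real.norm_eq_abs]
  exact ⟨abs_le_one_iff_mul_self_le_one.2 (by nlinarith), abs_le_one_iff_mul_self_le_one.2 (by nlinarith)⟩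
lemma int_D2 {q : RR → ℝ} (hm : AEStronglyMeasurable q (volume.restrict D2)) {B : ℝ} (hB : ∀ z, |q z| ≤ B) :
    IntegrableOn q D2 :=
  have : IsFiniteMeasure (volume.restrict D2) := ⟨by simpa using vol_D2_lt⟩
  Integrable.of_bound hm B (ae_of_all _ hB)
lemma shift (P : PM δ L J C) {f g h : RR → ℝ} (hf : DL δ f) (hg : DL δ g) (hh : DL δ h) {S : ℝ}
    (hS : ∀ z, |h z| ≤ S) {A A' b : ℝ → ℝ} (hA : ContDiff ℝ 1 A) (hA' : ∀ x, HasDerivAt A (A' x) x)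
    (hAc : Continuous A') (hb : ContDiff ℝ 1 b) {α β α' β' B : ℝ} (hA1 : ∀ x, |A x| ≤ 1) (hB : ∀ x, |b x| ≤ B)
    (sA : ∀ x, x ∉ Ic α β → A x = 0) (sb : ∀ x, x ∉ Ic α' β' → b x = 0)
    (hbd : ∀ s, f (circ s) ∈ Ic α β → g (circ s) ∉ Ic α' β') :
    |∫ z in D2, A' (f z) * b (g z) * h z * wd (grad f z) (grad g z)| ≤
      B * ∫ z in D2 ∩ {z | f z ∈ Ic α β ∧ g z ∈ Ic α' β'}, J z := by
  have lf := P.dl_lip hf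
  have lg := P.dl_lip hg
  have lh := P.dl_lip hh
  have B0 : 0 ≤ B := (abs_nonneg _).trans (hB 0)
  have hL : LB fun z => A (f z) * b (g z) * h z :=
    ((comp_LB P hf hA sA).mul (comp_LB P hg hb sb)).mul ⟨⟨_, lh⟩, S, hS⟩
  obtain ⟨⟨K, hK⟩, -⟩ := hL
  have st := stokes (hK.weaken (le_max_left K L)) (lg.weaken (le_max_right K L))
  have z0 : ∀ s, A (f (circ s)) * b (g (circ s)) * h (circ s) = 0 := fun s => by
    by_cases h1 : f (circ s) ∈ Ic α β
    · rw [sb _ (hbd s h1)]; ring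
    · rw [sA _ h1]; ring
  simp only [z0, zero_mul, intervalIntegral.integral_zero] at st
  have cf := lf.continuous
  have cg := lg.continuous
  have ch := lh.continuous
  have dA : ∃ M, ∀ x, |A' x| ≤ M := by
    obtain ⟨M, hM⟩ := hAc.bounded_above_of_compact_support (HasCompactSupport.intro
      (isCompact_Icc (a := α) (b := β)) fun x hx => by
        have : A =ᶠ[nhds x] fun _ => 0 := by
          filter_upwards [isClosed_Icc.isOpen_compl.mem_nhds hx] with y hy using sA y hy
        rw [← (hA' x).deriv, this.deriv_eq]; simp)
    exact ⟨M, hM⟩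
  obtain ⟨M, hM⟩ := dA
  have i1 : IntegrableOn (fun z => A' (f z) * b (g z) * h z * wd (grad f z) (grad g z)) D2 := by
    refine int_D2 (B := M * B * S * (2 * (L * L))) ?_ fun z => ?_
    · exact (((by have := hb.continuous; fun_prop : Continuous fun z => A' (f z) * b (g z) * h z).measurable).mul
        (measurable_wd_grad f g)).aestronglyMeasurable
    · rw [abs_mul, abs_mul, abs_mul]
      have := hM (f z); have := hB (g z); have := hS z; have := wd_bdd lf lg z
      have := (abs_nonneg _).trans (hM 0); have := (abs_nonneg _).trans (hS 0)
      gcongr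
  have i2 : IntegrableOn (fun z => A (f z) * b (g z) * wd (grad h z) (grad g z)) D2 := by
    refine int_D2 (B := 1 * B * (2 * (L * L))) ?_ fun z => ?_
    · exact (((by have := hb.continuous; have := hA.continuous; fun_prop : Continuous fun z => A (f z) * b (g z)).measurable).mul
        (measurable_wd_grad h g)).aestronglyMeasurable
    · rw [abs_mul, abs_mul]
      have := hA1 (f z); have := hB (g z); have := wd_bdd lh lg z
      gcongr
  have key : ∫ z in D2, (A' (f z) * b (g z) * h z * wd (grad f z) (grad g z) +
      A (f z) * b (g z) * wd (grad h z) (grad g z)) = 0 := by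
    rw [← st]
    apply integral_congr_ae
    refine ae_restrict_of_ae ?_
    filter_upwards [lf.ae_differentiableAt (μ := volume), lg.ae_differentiableAt (μ := volume),
      lh.ae_differentiableAt (μ := volume)] with z h1 h2 h3
    have e1 := (((hA' (f z)).comp_hasFDerivAt z h1.hasFDerivAt).mul
      (((hb.differentiable (by norm_num) (g z)).hasDerivAt).comp_hasFDerivAt z h2.hasFDerivAt)).mul h3.hasFDerivAt
    have e2 : grad (fun z => A (f z) * b (g z) * h z) z = _ := grad_of e1
    rw [e2]
    simp [wd, grad]
    ring
  rw [integral_add i1 i2] at key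
  rw [eq_neg_of_add_eq_zero_left key, abs_neg]
  set E := {z | f z ∈ Ic α β ∧ g z ∈ Ic α' β'} with hE
  have mE : MeasurableSet E := (measurableSet_Icc.preimage cf.measurable).inter (measurableSet_Icc.preimage cg.measurable)
  rw [← integral_const_mul, ← setIntegral_indicator mE, ← Real.norm_eq_abs]
  refine norm_integral_le_of_norm_le ((P.Jint.const_mul B).indicator mE) ?_
  filter_upwards [P.area h g hh hg] with z hz
  by_cases hzE : z ∈ E
  · rw [Set.indicator_of_mem hzE, Real.norm_eq_abs, abs_mul, abs_mul]
    have := hA1 (f z); have := hB (g z)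
    calc _ ≤ 1 * B * J z := by gcongr
      _ = _ := by ring
  · rw [Set.indicator_of_notMem hzE]
    have : A (f z) * b (g z) = 0 := by
      by_cases h1 : f z ∈ Ic α β
      · rw [sb _ fun h2 => hzE ⟨h1, h2⟩, mul_zero]
      · rw [sA _ h1, zero_mul]
    rw [this]; simp
structure Cfg (δ : RR → RR → ℝ) (f g : RR → ℝ) (tm : ℝ) : Prop where
  hf : DL δ f
  hg : DL δ g
  bd : ∃ sm ∈ Ic (0:ℝ) 1, g (circ sm) = 1 ∧ g (circ 0) = 0 ∧
    (∀ s ∈ Ic 0 sm, 0 < g (circ s) → g (circ s) < 3/4 → f (circ s) ≤ tm - 1/4) ∧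
    (∀ s ∈ Ic sm 1, 0 < g (circ s) → g (circ s) < 3/4 → tm + 1/4 ≤ f (circ s))
lemma circ_fract (s : ℝ) : circ (Int.fract s) = circ s := by
  unfold circ
  have : 2 * pp * Int.fract s = 2 * pp * s - ⌊s⌋ * (2 * pp) := by
    rw [Int.fract]; ring
  rw [this, Real.cos_sub_int_mul_two_pi, Real.sin_sub_int_mul_two_pi]
variable {δ : RR → RR → ℝ} {L : ℝ≥0} {J : RR → ℝ} {C : ℝ} {f g : RR → ℝ} {tm : ℝ}
lemma Cfg.avoid (c : Cfg δ f g tm) (s : ℝ) (h1 : f (circ s) ∈ Ic (tm - 3/16) (tm + 3/16)) :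
    g (circ s) ∉ Ic (3/8 - 3/16) (3/8 + 3/16 : ℝ) := by
  intro h2
  obtain ⟨sm, hsm, -, -, a1, a2⟩ := c.bd
  rw [← circ_fract s] at h1 h2
  have g1 : 0 < g (circ (Int.fract s)) := by linarith [h2.1]
  have g2 : g (circ (Int.fract s)) < 3/4 := by linarith [h2.2]
  rcases le_total (Int.fract s) sm with h | h
  · linarith [a1 _ ⟨Int.fract_nonneg s, h⟩ g1 g2, h1.1]
  · linarith [a2 _ ⟨h, (Int.fract_lt_one s).le⟩ g1 g2, h1.2]
noncomputable def U (f g h : RR → ℝ) (y : RR) (ρ : ℝ) : ℝ :=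
  ∫ z in D2, kc y.1 ρ (f z) * kc y.2 ρ (g z) * h z * wd (grad f z) (grad g z)
def bx (f g : RR → ℝ) (y : RR) (ρ : ℝ) : Set RR :=
  {z | f z ∈ Ic (y.1 - ρ) (y.1 + ρ) ∧ g z ∈ Ic (y.2 - ρ) (y.2 + ρ)}
noncomputable def mu (f g J : RR → ℝ) (y : RR) (ρ : ℝ) : ℝ := ∫ z in D2 ∩ bx f g y ρ, J z
lemma kbox {c ρ c0 R x : ℝ} (hρ : 0 < ρ) (h : |c - c0| + ρ ≤ R) (hx : x ∉ Ic (c0 - R) (c0 + R)) :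
    kc c ρ x = 0 ∧ ((x < c0 - R → Kc c ρ x = 0) ∧ (c0 + R < x → Kc c ρ x = 1)) := by
  have h1 := abs_le.1 (le_refl |c - c0|)
  refine ⟨kc_zero hρ ?_, fun h2 => Kc_left hρ (by linarith), fun h2 => Kc_right hρ (by linarith)⟩
  by_contra h2
  push Not at h2
  have := abs_le.1 h2
  exact hx ⟨by linarith, by linarith⟩
lemma half (P : PM δ L J C) {f g h : RR → ℝ} (hf : DL δ f) (hg : DL δ g) (hh : DL δ h) {S : ℝ}
    (hS : ∀ z, |h z| ≤ S) {C0 : ℝ} (hC0 : ∀ x, |kk x| ≤ C0) {c c' ρ ρ' c0 R d d0 τ : ℝ} (hρ : 0 < ρ) (hρ' : 0 < ρ')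
    (hτ : 0 < τ) (h1 : |c - c0| + ρ ≤ R) (h2 : |c' - c0| + ρ' ≤ R) (h3 : |d - d0| + τ ≤ R)
    (hbd : ∀ s, f (circ s) ∈ Ic (c0 - R) (c0 + R) → g (circ s) ∉ Ic (d0 - R) (d0 + R)) :
    |∫ z in D2, (kc c ρ (f z) - kc c' ρ' (f z)) * kc d τ (g z) * h z * wd (grad f z) (grad g z)| ≤
      C0 / τ * mu f g J (c0, d0) R := by
  refine shift P hf hg hh hS (A := fun x => Kc c ρ x - Kc c' ρ' x) (A' := fun x => kc c ρ x - kc c' ρ' x)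
    (b := kc d τ) ((Kc_smooth _ _).sub (Kc_smooth _ _)) (fun x => (Kc_deriv _ _ x).sub (Kc_deriv _ _ x))
    ((kc_smooth _ _).continuous.sub (kc_smooth _ _).continuous) (kc_smooth _ _) (fun x => ?_)
    (fun x => kc_le hC0 hτ) (fun x hx => ?_) (fun x hx => (kbox hτ h3 hx).1) hbd
  · rw [abs_le]
    have := Kc_mem c ρ x; have := Kc_mem c' ρ' x
    constructor <;> linarith
  · have a1 := (kbox hρ h1 hx).2
    have a2 := (kbox hρ' h2 hx).2
    by_cases hl : x < c0 - R
    · simp only [a1.1 hl, a2.1 hl, sub_zero]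
    · have hr : c0 + R < x := by
        by_contra h; push Not at h hl; exact hx ⟨hl, h⟩
      simp only [a1.2 hr, a2.2 hr, sub_self]
lemma U_int (P : PM δ L J C) {f g h : RR → ℝ} (hf : DL δ f) (hg : DL δ g) (hh : DL δ h) {S : ℝ}
    (hS : ∀ z, |h z| ≤ S) {a b : ℝ → ℝ} (ha : Continuous a) (hb : Continuous b) {A B : ℝ} (hA : ∀ x, |a x| ≤ A)
    (hB : ∀ x, |b x| ≤ B) : IntegrableOn (fun z => a (f z) * b (g z) * h z * wd (grad f z) (grad g z)) D2 := by
  have cf := (P.dl_lip hf).continuous; have cg := (P.dl_lip hg).continuous; have ch := (P.dl_lip hh).continuous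
  refine int_D2 (B := A * B * S * (2 * (L * L))) ?_ fun z => ?_
  · exact (((by fun_prop : Continuous fun z => a (f z) * b (g z) * h z).measurable).mul
      (measurable_wd_grad f g)).aestronglyMeasurable
  · rw [abs_mul, abs_mul, abs_mul]
    have := hA (f z); have := hB (g z); have := hS z; have := wd_bdd (P.dl_lip hf) (P.dl_lip hg) z
    have := (abs_nonneg _).trans (hA 0); have := (abs_nonneg _).trans (hB 0); have := (abs_nonneg _).trans (hS 0)
    gcongr
lemma U_diff (P : PM δ L J C) {f g h : RR → ℝ} (hf : DL δ f) (hg : DL δ g) (hh : DL δ h) {S : ℝ}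
    (hS : ∀ z, |h z| ≤ S) {C0 : ℝ} (hC0 : ∀ x, |kk x| ≤ C0) {y y' y0 : RR} {ρ ρ' R : ℝ} (hρ : 0 < ρ) (hρ' : 0 < ρ')
    (h1 : dist y y0 + ρ ≤ R) (h2 : dist y' y0 + ρ' ≤ R)
    (hbd : ∀ s, f (circ s) ∈ Ic (y0.1 - R) (y0.1 + R) → g (circ s) ∉ Ic (y0.2 - R) (y0.2 + R)) :
    |U f g h y ρ - U f g h y' ρ'| ≤ (C0 / ρ + C0 / ρ') * mu f g J y0 R := by
  rw [Prod.dist_eq, Real.dist_eq, Real.dist_eq] at h1 h2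
  have m1 := le_max_left |y.1 - y0.1| |y.2 - y0.2|
  have m2 := le_max_right |y.1 - y0.1| |y.2 - y0.2|
  have m3 := le_max_left |y'.1 - y0.1| |y'.2 - y0.2|
  have m4 := le_max_right |y'.1 - y0.1| |y'.2 - y0.2|
  have e1 := half P hf hg hh hS hC0 (c := y.1) (c' := y'.1) (c0 := y0.1) (R := R) (d := y.2) (d0 := y0.2) hρ hρ' hρ
    (by linarith) (by linarith) (by linarith) hbd
  have e2 := half P hg hf hh hS hC0 (c := y.2) (c' := y'.2) (c0 := y0.2) (R := R) (d := y'.1) (d0 := y0.1) hρ hρ' hρ'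
    (by linarith) (by linarith) (by linarith) (fun s a b => hbd s b a)
  have hb : ∀ {c τ : ℝ}, 0 < τ → ∀ x, |kc c τ x| ≤ C0 / τ := fun hτ x => kc_le hC0 hτ
  have hc : ∀ c τ, Continuous (kc c τ) := fun c τ => (kc_smooth c τ).continuous
  have i1 := U_int P hf hg hh hS (hc y.1 ρ) (hc y.2 ρ) (hb hρ) (hb hρ)
  have i2 := U_int P hf hg hh hS (hc y'.1 ρ') (hc y.2 ρ) (hb hρ') (hb hρ)
  have i3 := U_int P hf hg hh hS (hc y'.1 ρ') (hc y'.2 ρ') (hb hρ') (hb hρ')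
  have s1 : mu g f J (y0.2, y0.1) R = mu f g J y0 R := by
    unfold mu bx; congr 2; ext z; simp [and_comm]
  rw [s1] at e2
  have : U f g h y ρ - U f g h y' ρ' =
      (∫ z in D2, (kc y.1 ρ (f z) - kc y'.1 ρ' (f z)) * kc y.2 ρ (g z) * h z * wd (grad f z) (grad g z)) -
      ∫ z in D2, (kc y.2 ρ (g z) - kc y'.2 ρ' (g z)) * kc y'.1 ρ' (f z) * h z * wd (grad g z) (grad f z) := by
    have q1 : (∫ z in D2, (kc y.1 ρ (f z) - kc y'.1 ρ' (f z)) * kc y.2 ρ (g z) * h z * wd (grad f z) (grad g z)) =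
        U f g h y ρ - ∫ z in D2, kc y'.1 ρ' (f z) * kc y.2 ρ (g z) * h z * wd (grad f z) (grad g z) := by
      unfold U; rw [← integral_sub i1 i2]; congr 1; ext z; ring
    have q2 : (∫ z in D2, (kc y.2 ρ (g z) - kc y'.2 ρ' (g z)) * kc y'.1 ρ' (f z) * h z * wd (grad g z) (grad f z)) =
        U f g h y' ρ' - ∫ z in D2, kc y'.1 ρ' (f z) * kc y.2 ρ (g z) * h z * wd (grad f z) (grad g z) := by
      unfold U; rw [← integral_sub i3 i2]; congr 1; ext z; unfold wd; ring
    rw [q1, q2]; ring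
  rw [this, add_mul]
  exact (abs_sub _ _).trans (add_le_add e1 e2)
lemma Cfg.avoid' (c : Cfg δ f g tm) {y : RR} (hy : dist y (tm, 3/8) ≤ 1/16) {R : ℝ} (hR : R ≤ 1/8) (s : ℝ)
    (h1 : f (circ s) ∈ Ic (y.1 - R) (y.1 + R)) : g (circ s) ∉ Ic (y.2 - R) (y.2 + R) := by
  rw [Prod.dist_eq, Real.dist_eq, Real.dist_eq, max_le_iff, abs_le, abs_le] at hy
  obtain ⟨⟨a, b⟩, d, e⟩ := hy
  simp only at a b d e
  intro h2
  exact c.avoid s ⟨by linarith [h1.1], by linarith [h1.2]⟩ ⟨by linarith [h2.1], by linarith [h2.2]⟩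
lemma slice_lip (P : PM δ L J C) (c : Cfg δ f g tm) {h : RR → ℝ} (hh : DL δ h) {S : ℝ}
    (hS : ∀ z, |h z| ≤ S) {C0 : ℝ} (hC0 : ∀ x, |kk x| ≤ C0) {y y' : RR} {Λ T T' : ℝ} (hΛ : 0 ≤ Λ)
    (hy : dist y (tm, 3/8) ≤ 1/16) (hy' : dist y' (tm, 3/8) ≤ 1/16) (hd : dist y y' ≤ 1/16)
    (hT : Tendsto (U f g h y) (nhdsWithin 0 (Set.Ioi 0)) (nhds T))
    (hT' : Tendsto (U f g h y') (nhdsWithin 0 (Set.Ioi 0)) (nhds T'))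
    (hm : ∀ ρ, 0 < ρ → ρ ≤ 1/8 → mu f g J y ρ ≤ Λ * ρ ^ 2)
    (hm' : ∀ ρ, 0 < ρ → ρ ≤ 1/8 → mu f g J y' ρ ≤ Λ * ρ ^ 2) : |T - T'| ≤ 20 * C0 * Λ * dist y y' := by
  have C00 : 0 ≤ C0 := (abs_nonneg _).trans (hC0 0)
  rcases eq_or_ne y y' with rfl | hne
  · rw [tendsto_nhds_unique hT hT']; simp
  set ρ := dist y y' with hρd
  have hρ : 0 < ρ := dist_pos.2 hne
  have tele : ∀ (x : RR) (t : ℝ), dist x (tm, 3/8) ≤ 1/16 →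
      Tendsto (U f g h x) (nhdsWithin 0 (Set.Ioi 0)) (nhds t) →
      (∀ ρ, 0 < ρ → ρ ≤ 1/8 → mu f g J x ρ ≤ Λ * ρ ^ 2) → |U f g h x ρ - t| ≤ 6 * C0 * Λ * ρ := by
    intro x t hx ht hmx
    have hlim : Tendsto (fun n : ℕ => U f g h x (ρ / 2 ^ n)) atTop (nhds t) := by
      refine ht.comp (tendsto_nhdsWithin_iff.2 ⟨?_, Eventually.of_forall fun n => ?_⟩)
      · have := (tendsto_pow_atTop_nhds_zero_of_lt_one (r := (1/2:ℝ)) (by norm_num) (by norm_num)).const_mul ρ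
        simpa [div_eq_mul_inv] using this
      · show 0 < ρ / 2 ^ n; positivity
    have := dist_le_of_le_geometric_two_of_tendsto₀ (f := fun n : ℕ => U f g h x (ρ / 2 ^ n)) (C := 6 * C0 * Λ * ρ)
      (fun n => ?_) hlim
    · simpa [Real.dist_eq] using this
    · set τ := ρ / 2 ^ n with hτ
      have t0 : 0 < τ := by positivity
      have t1 : τ ≤ 1/8 := (div_le_self hρ.le (one_le_pow₀ (by norm_num))).trans (by linarith)
      have e1 : ρ / 2 ^ (n + 1) = τ / 2 := by rw [hτ, pow_succ]; field_simp
      rw [e1, Real.dist_eq]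
      refine (U_diff P c.hf c.hg hh hS hC0 (y0 := x) (R := τ) t0 (half_pos t0) (by simp) (by simp; linarith)
        (c.avoid' hx t1)).trans ?_
      calc _ ≤ (C0 / τ + C0 / (τ / 2)) * (Λ * τ ^ 2) := by gcongr; exact hmx _ t0 t1
        _ = 3 * C0 * Λ * τ := by field_simp; ring
        _ = _ := by rw [hτ]; field_simp; ring
  have a1 := tele y T hy hT hm
  have a2 := tele y' T' hy' hT' hm'
  have a3 : |U f g h y ρ - U f g h y' ρ| ≤ 8 * C0 * Λ * ρ := by
    refine (U_diff P c.hf c.hg hh hS hC0 (y0 := y) (R := 2 * ρ) hρ hρ (by simp; linarith)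
      (by rw [dist_comm]; linarith) (c.avoid' hy (by linarith))).trans ?_
    calc _ ≤ (C0 / ρ + C0 / ρ) * (Λ * (2 * ρ) ^ 2) := by gcongr; exact hm _ (by linarith) (by linarith)
      _ = _ := by field_simp; ring
  rw [abs_sub_comm] at a1
  calc |T - T'| = |(T - U f g h y ρ) + (U f g h y ρ - U f g h y' ρ) + (U f g h y' ρ - T')| := by congr 1; ring
    _ ≤ _ := (abs_add_three _ _ _).trans (by linarith)
lemma deg (P : PM δ L J C) (c : Cfg δ f g tm) {y : RR} (hy : dist y (tm, 3/8) ≤ 1/16) {ρ : ℝ} (hρ : 0 < ρ)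
    (hR : ρ ≤ 1/8) : U f g (fun _ => 1) y ρ = -1 := by
  have lf := P.dl_lip c.hf
  have lg := P.dl_lip c.hg
  obtain ⟨K1, k1⟩ := Kc_lip y.1 hρ
  obtain ⟨K2, k2⟩ := Kc_lip y.2 hρ
  have l1 := k1.comp lf
  have l2 := k2.comp lg
  have st := stokes (l1.weaken (le_max_left _ _)) (l2.weaken (le_max_right _ _))
  have e1 : U f g (fun _ => 1) y ρ = ∫ z in D2, wd (grad (Kc y.1 ρ ∘ f) z) (grad (Kc y.2 ρ ∘ g) z) := by
    apply integral_congr_ae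
    refine ae_restrict_of_ae ?_
    filter_upwards [lf.ae_differentiableAt (μ := volume), lg.ae_differentiableAt (μ := volume)] with z h1 h2
    rw [grad_of ((Kc_deriv y.1 ρ (f z)).comp_hasFDerivAt z h1.hasFDerivAt),
      grad_of ((Kc_deriv y.2 ρ (g z)).comp_hasFDerivAt z h2.hasFDerivAt)]
    simp [wd, grad]; ring
  rw [e1, st]
  obtain ⟨sm, hsm, g1, g0, b1, b2⟩ := c.bd
  rw [Prod.dist_eq, Real.dist_eq, Real.dist_eq, max_le_iff, abs_le, abs_le] at hy
  obtain ⟨⟨y1, y2⟩, y3, y4⟩ := hy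
  simp only at y1 y2 y3 y4
  obtain ⟨Kl, hcl⟩ : ∃ K, LipschitzWith K circ := by
    refine ⟨Real.toNNReal (2 * pp), LipschitzWith.of_dist_le_mul fun s t => ?_⟩
    rw [Real.coe_toNNReal _ (by positivity), Prod.dist_eq, max_le_iff, Real.dist_eq, Real.dist_eq, Real.dist_eq]
    have e : 2 * pp * |s - t| = |2 * pp * s - 2 * pp * t| := by
      rw [← mul_sub, abs_mul, abs_of_pos (Real.two_pi_pos)]
    rw [e]
    have h1 := Real.lipschitzWith_cos.dist_le_mul (2 * pp * s) (2 * pp * t)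
    have h2 := Real.lipschitzWith_sin.dist_le_mul (2 * pp * s) (2 * pp * t)
    simp only [Real.dist_eq, NNReal.coe_one, one_mul] at h1 h2
    exact ⟨h1, h2⟩
  set q : ℝ → ℝ := fun s => (Kc y.2 ρ ∘ g) (circ s) with hq
  have lq := l2.comp hcl
  have hdq : ∀ s, deriv q s ≠ 0 → |g (circ s) - y.2| ≤ ρ := by
    intro s hs
    by_contra hcon
    push Not at hcon
    apply hs
    have cg : Continuous fun s => g (circ s) := (lg.comp hcl).continuous
    rcases lt_abs.1 hcon with h | h
    · have : q =ᶠ[nhds s] fun _ => 1 := by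
        filter_upwards [(isOpen_lt (continuous_const (y := y.2 + ρ)) cg).mem_nhds (show y.2 + ρ < g (circ s) by linarith)] with t ht
        exact Kc_right hρ (le_of_lt ht)
      rw [this.deriv_eq]; simp
    · have : q =ᶠ[nhds s] fun _ => 0 := by
        filter_upwards [(isOpen_lt cg (continuous_const (y := y.2 - ρ))).mem_nhds (show g (circ s) < y.2 - ρ by linarith)] with t ht
        exact Kc_left hρ (le_of_lt ht)
      rw [this.deriv_eq]; simp
  set Q : ℝ → ℝ := fun s => q (max s sm) with hQ
  have lQ : LipschitzWith (K2 * L * Kl * 1) Q := lq.comp (LipschitzWith.id.max_const sm)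
  have e2 : ∫ s in (0:ℝ)..1, (Kc y.1 ρ ∘ f) (circ s) * deriv q s = ∫ s in (0:ℝ)..1, deriv Q s := by
    apply intervalIntegral.integral_congr_ae
    filter_upwards [Measure.ae_ne volume sm] with s hs hI
    rw [Set.uIoc_of_le zero_le_one] at hI
    have aux : deriv q s ≠ 0 → 0 < g (circ s) ∧ g (circ s) < 3/4 := fun h => by
      have := abs_le.1 (hdq s h)
      constructor <;> linarith
    rcases lt_or_gt_of_ne hs with h | h
    · have : Q =ᶠ[nhds s] fun _ => q sm := by
        filter_upwards [gt_mem_nhds h] with t ht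
        rw [hQ]; simp only; rw [max_eq_right ht.le]
      rw [this.deriv_eq, deriv_const]
      by_cases hd : deriv q s = 0
      · rw [hd, mul_zero]
      · have := b1 s ⟨hI.1.le, h.le⟩ (aux hd).1 (aux hd).2
        show Kc y.1 ρ (f (circ s)) * _ = 0
        rw [Kc_left hρ (by linarith), zero_mul]
    · have : Q =ᶠ[nhds s] q := by
        filter_upwards [lt_mem_nhds h] with t ht
        rw [hQ]; simp only; rw [max_eq_left ht.le]
      rw [this.deriv_eq]
      by_cases hd : deriv q s = 0
      · rw [hd, mul_zero]
      · have := b2 s ⟨h.le, hI.2⟩ (aux hd).1 (aux hd).2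
        show Kc y.1 ρ (f (circ s)) * _ = _
        rw [Kc_right hρ (by linarith), one_mul]
  rw [e2, (lQ.lipschitzOnWith.absolutelyContinuousOnInterval (a := 0) (b := 1)).integral_deriv_eq_sub]
  have c1 : circ 1 = circ 0 := by simp [circ]
  simp only [hQ, hq, max_eq_left hsm.2, max_eq_right hsm.1, Function.comp, c1, g0, g1]
  rw [Kc_left hρ (by linarith), Kc_right hρ (by linarith)]; norm_num
lemma inj_radius (A : RR →L[ℝ] RR) : ∃ r : ℝ≥0, r ≠ 0 ∧ (A.det ≠ 0 →
    ∀ (f : RR → RR) (s : Set RR), ApproximatesLinearOn f A s r → Set.InjOn f s) := by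
  by_cases h : A.det = 0
  · exact ⟨1, one_ne_zero, fun h' => absurd h h'⟩
  · set e := A.toContinuousLinearEquivOfDetNeZero h with he
    have hp : 0 < ‖(e.symm : RR →L[ℝ] RR)‖₊⁻¹ := inv_pos.2 e.nnnorm_symm_pos
    refine ⟨‖(e.symm : RR →L[ℝ] RR)‖₊⁻¹ / 2, (half_pos hp).ne', fun _ f s hs => ?_⟩
    have : (e : RR →L[ℝ] RR) = A := A.coe_toContinuousLinearEquivOfDetNeZero h
    rw [← this] at hs
    exact hs.injOn (Or.inr (half_lt_self hp))
lemma det_prod (a b : RR →L[ℝ] ℝ) : (a.prod b).det = a (1, 0) * b (0, 1) - a (0, 1) * b (1, 0) := by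
  have : (a.prod b : RR →ₗ[ℝ] RR) = Matrix.toLin (Module.Basis.finTwoProd ℝ) (Module.Basis.finTwoProd ℝ)
      !![a (1, 0), a (0, 1); b (1, 0), b (0, 1)] := by
    ext <;> simp [Matrix.toLin_finTwoProd_apply]
  rw [ContinuousLinearMap.det, this, LinearMap.det_toLin, Matrix.det_fin_two]
  simp
variable {δ : RR → RR → ℝ} {L : ℝ≥0} {J : RR → ℝ} {C : ℝ} {f g : RR → ℝ} {tm : ℝ}
lemma slices (P : PM δ L J C) (hf : DL δ f) (hg : DL δ g) :
    ∃ (E : ℕ → Set RR) (p : ℕ → RR → RR) (sg : ℕ → RR → ℤ), (∀ n, MeasurableSet (E n)) ∧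
      (∀ n, ∀ y ∈ E n, (f (p n y), g (p n y)) = y) ∧ (∀ n y, sg n y = 1 ∨ sg n y = -1) ∧
      ∑' n, volume (E n) ≤ eR C ∧
      ∀ h : RR → ℝ, Continuous h → (∃ S, ∀ z, |h z| ≤ S) →
        (∀ n, IntegrableOn (fun y => (sg n y : ℝ) * h (p n y)) (E n)) ∧
        ∀ η : RR → ℝ, Continuous η → (∃ S, ∀ z, |η z| ≤ S) →
          HasSum (fun n => ∫ y in E n, η y * ((sg n y : ℝ) * h (p n y)))
            (∫ z in D2, η (f z, g z) * h z * wd (grad f z) (grad g z)) := by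
  have lf := P.dl_lip hf
  have lg := P.dl_lip hg
  set w : RR → ℝ := fun z => wd (grad f z) (grad g z) with hw
  have mw : Measurable w := measurable_wd_grad f g
  set F : RR → RR := fun z => (f z, g z) with hF
  have cF : Continuous F := lf.continuous.prodMk lg.continuous
  set A : Set RR := D2 ∩ ({z | DifferentiableAt ℝ f z} ∩ {z | DifferentiableAt ℝ g z}) ∩ {z | w z ≠ 0} with hA
  have mA : MeasurableSet A := (measurableSet_D2.inter ((measurableSet_of_differentiableAt ℝ f).inter
    (measurableSet_of_differentiableAt ℝ g))).inter (mw (measurableSet_singleton 0).compl)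
  set F' : RR → (RR →L[ℝ] RR) := fun z => (fderiv ℝ f z).prod (fderiv ℝ g z) with hF'
  have dF' : ∀ z, (F' z).det = w z := fun z => by rw [hF']; simp only; rw [det_prod]; rfl
  have dF : ∀ z ∈ A, HasFDerivAt F (F' z) z := fun z hz =>
    hz.1.2.1.hasFDerivAt.prodMk hz.1.2.2.hasFDerivAt
  choose r hr0 hr using inj_radius
  obtain ⟨t, B, td, tm, tc, ta, tB⟩ := exists_partition_approximatesLinearOn_of_hasFDerivWithinAt F A F'
    (fun z hz => (dF z hz).hasFDerivWithinAt) r hr0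
  set s : ℕ → Set RR := fun n => A ∩ t n with hs
  have ms : ∀ n, MeasurableSet (s n) := fun n => mA.inter (tm n)
  have inj : ∀ n, Set.InjOn F (s n) := by
    intro n
    rcases A.eq_empty_or_nonempty with h0 | h0
    · simp [hs, h0]
    · obtain ⟨y, hy, e⟩ := tB h0 n
      exact hr (B n) (by rw [e, dF']; exact hy.2) F _ (ta n)
  have dFs : ∀ n, ∀ z ∈ s n, HasFDerivWithinAt F (F' z) (s n) z := fun n z hz => (dF z hz.1).hasFDerivWithinAt
  have hsA : ⋃ n, s n = A := by
    rw [hs, ← Set.inter_iUnion, Set.inter_eq_left.2 tc]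
  have sd : Pairwise (Function.onFun Disjoint s) := fun i j hij =>
    (td hij).mono Set.inter_subset_right Set.inter_subset_right
  have AD : A ⊆ D2 := fun z hz => hz.1.1
  have wJ := P.area f g hf hg
  set q : ℕ → RR → RR := fun n => Function.invFunOn F (s n) with hq
  have qF : ∀ n, ∀ z ∈ s n, q n (F z) = z := fun n z hz => (inj n).leftInvOn_invFunOn hz
  refine ⟨fun n => F '' s n, q, fun n y => if 0 < w (q n y) then 1 else -1,
    fun n => measurable_image_of_fderivWithin (ms n) (dFs n) (inj n), ?_, fun n y => by dsimp only; split_ifs <;> simp,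
    ?_, ?_⟩
  · rintro n y ⟨z, hz, rfl⟩
    rw [qF n z hz]
  · have : ∀ n, volume (F '' s n) = ∫⁻ z in s n, eR |w z| := fun n => by
      rw [← lintegral_abs_det_fderiv_eq_addHaar_image volume (ms n) (dFs n) (inj n)]
      simp only [dF']
    simp only [this]
    rw [← lintegral_iUnion ms sd, hsA]
    calc _ ≤ ∫⁻ z in D2, eR |w z| := lintegral_mono_set AD
      _ ≤ ∫⁻ z in D2, eR (J z) := by
        apply lintegral_mono_ae; filter_upwards [wJ] with z hz; exact ENNReal.ofReal_le_ofReal hz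
      _ = eR (∫ z in D2, J z) := (ofReal_integral_eq_lintegral_ofReal P.Jint (ae_of_all _ P.Jnn)).symm
      _ ≤ _ := ENNReal.ofReal_le_ofReal P.JC
  · intro h ch ⟨S, hS⟩
    have key : ∀ (η : RR → ℝ) (n : ℕ), ∀ z ∈ s n,
        |(F' z).det| • (η (F z) * (((if 0 < w (q n (F z)) then 1 else -1 : ℤ) : ℝ) * h (q n (F z)))) =
        η (f z, g z) * h z * w z := by
      intro η n z hz
      rw [qF n z hz, dF', smul_eq_mul]
      have h0 : w z ≠ 0 := hz.1.2
      split_ifs with hp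
      · rw [abs_of_pos hp]; simp only [hF]; push_cast; ring
      · rw [abs_of_neg (lt_of_le_of_ne (not_lt.1 hp) h0)]; simp only [hF]; push_cast; ring
    have I : ∀ η : RR → ℝ, Continuous η → (∃ S, ∀ z, |η z| ≤ S) →
        IntegrableOn (fun z => η (f z, g z) * h z * w z) D2 := by
      intro η cη ⟨S', hS'⟩
      refine int_D2 (B := S' * S * (2 * (L * L))) ?_ fun z => ?_
      · exact (((cη.comp cF).mul ch).measurable.mul mw).aestronglyMeasurable
      · rw [abs_mul, abs_mul]
        have := hS' (f z, g z); have := hS z; have := wd_bdd lf lg z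
        have := (abs_nonneg _).trans (hS' 0); have := (abs_nonneg _).trans (hS 0)
        gcongr
    refine ⟨fun n => ?_, fun η cη hη => ?_⟩
    · have := (integrableOn_image_iff_integrableOn_abs_det_fderiv_smul volume (ms n) (dFs n) (inj n)
        (fun y => ((if 0 < w (q n y) then 1 else -1 : ℤ) : ℝ) * h (q n y))).2 ?_
      · exact this
      · have i1 := (I (fun _ => 1) continuous_const ⟨1, by simp⟩).mono_set (Set.inter_subset_left.trans AD : s n ⊆ D2)
        refine i1.congr_fun (fun z hz => ?_) (ms n)
        have := key (fun _ => 1) n z hz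
        simp only [one_mul] at this ⊢
        exact this.symm
    · have e1 : ∀ n, ∫ y in F '' s n, η y * (((if 0 < w (q n y) then 1 else -1 : ℤ) : ℝ) * h (q n y)) =
          ∫ z in s n, η (f z, g z) * h z * w z := fun n => by
        rw [integral_image_eq_integral_abs_det_fderiv_smul volume (ms n) (dFs n) (inj n)]
        exact setIntegral_congr_fun (ms n) (key η n)
      simp only [e1]
      have e2 := hasSum_integral_iUnion ms sd ((I η cη hη).mono_set (hsA.trans_subset AD))
      rw [hsA] at e2
      have e3 : ∫ z in D2, η (f z, g z) * h z * w z = ∫ z in A, η (f z, g z) * h z * w z := by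
        refine setIntegral_eq_of_subset_of_ae_sdiff_eq_zero measurableSet_D2.nullMeasurableSet AD ?_
        filter_upwards [lf.ae_differentiableAt (μ := volume), lg.ae_differentiableAt (μ := volume)] with z h1 h2 hz
        have : w z = 0 := by
          by_contra h0; exact hz.2 ⟨⟨hz.1, h1, h2⟩, h0⟩
        rw [this, mul_zero]
      exact e3 ▸ e2
lemma kc_integral (c : ℝ) {ρ : ℝ} (hρ : 0 < ρ) : Integrable (kc c ρ) ∧ ∫ x, kc c ρ x = 1 := by
  have hs : ∀ x, x ∉ Ic (c - ρ) (c + ρ) → kc c ρ x = 0 := fun x hx =>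
    (kbox hρ (by simp) hx).1
  have cc := (kc_smooth c ρ).continuous
  refine ⟨cc.integrable_of_hasCompactSupport (HasCompactSupport.intro isCompact_Icc hs), ?_⟩
  rw [← intervalIntegral.integral_eq_integral_of_support_subset (a := c - 2 * ρ) (b := c + 2 * ρ),
    intervalIntegral.integral_eq_sub_of_hasDerivAt (fun x _ => Kc_deriv c ρ x) (cc.intervalIntegrable _ _),
    Kc_left (x := c - 2 * ρ) hρ (by linarith), Kc_right (x := c + 2 * ρ) hρ (by linarith), sub_zero]
  intro x hx
  by_contra h
  refine hx (hs x fun h' => h ⟨by linarith [h'.1], by linarith [h'.2]⟩)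
noncomputable def TT (E : ℕ → Set RR) (p : ℕ → RR → RR) (sg : ℕ → RR → ℤ) (h : RR → ℝ)
    (y : RR) : ℝ := ∑' n, (E n).indicator (fun y => (sg n y : ℝ) * h (p n y)) y
variable {E : ℕ → Set RR} {p : ℕ → RR → RR} {sg : ℕ → RR → ℤ} {f g h : RR → ℝ}
lemma slice_tendsto (hE : ∀ n, MeasurableSet (E n)) (hs : ∑' n, volume (E n) ≠ ⊤)
    (hsg : ∀ n y, sg n y = 1 ∨ sg n y = -1) {S : ℝ} (hS : ∀ z, |h z| ≤ S)
    (hi : ∀ n, IntegrableOn (fun y => (sg n y : ℝ) * h (p n y)) (E n))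
    (hη : ∀ η : RR → ℝ, Continuous η → (∃ S, ∀ z, |η z| ≤ S) →
          HasSum (fun n => ∫ y in E n, η y * ((sg n y : ℝ) * h (p n y)))
            (∫ z in D2, η (f z, g z) * h z * wd (grad f z) (grad g z))) :
    ∀ᵐ y, Tendsto (U f g h y) (nhdsWithin 0 (Set.Ioi 0)) (nhds (TT E p sg h y)) := by
  set a : ℕ → RR → ℝ := fun n => (E n).indicator (fun y => (sg n y : ℝ) * h (p n y)) with ha
  have S0 : 0 ≤ S := (abs_nonneg _).trans (hS 0)
  have ia : ∀ n, Integrable (a n) := fun n => (hi n).integrable_indicator (hE n)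
  have ab : ∀ n y, |a n y| ≤ (E n).indicator (fun _ => S) y := by
    intro n y
    by_cases hy : y ∈ E n
    · simp only [ha, Set.indicator_of_mem hy, abs_mul]
      have : |(sg n y : ℝ)| = 1 := by rcases hsg n y with e | e <;> simp [e]
      rw [this, one_mul]; exact hS _
    · simp [ha, Set.indicator_of_notMem hy]
  have fE : ∀ n, volume (E n) ≠ ⊤ := fun n => ENNReal.ne_top_of_tsum_ne_top hs n
  have fin : ∀ᵐ y, {n | y ∈ E n}.Finite := ae_finite_setOfPred_mem hs
  have la : ∀ n, ∫⁻ y, ‖a n y‖ₑ ≤ eR S * volume (E n) := by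
    intro n
    rw [← setLIntegral_const, ← lintegral_indicator (hE n)]
    refine lintegral_mono fun y => ?_
    have := ab n y
    rw [← ofReal_norm, Real.norm_eq_abs]
    by_cases hy : y ∈ E n
    · rw [Set.indicator_of_mem hy] at this ⊢; exact ENNReal.ofReal_le_ofReal this
    · rw [Set.indicator_of_notMem hy] at this ⊢; simpa using ENNReal.ofReal_le_ofReal this
  have lsum : ∑' n, ∫⁻ y, ‖a n y‖ₑ < ⊤ := by
    refine (ENNReal.tsum_le_tsum la).trans_lt ?_
    rw [ENNReal.tsum_mul_left]
    exact ENNReal.mul_lt_top ENNReal.ofReal_lt_top hs.lt_top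
  have iT : Integrable (TT E p sg h) := by
    refine ⟨?_, ?_⟩
    · refine aestronglyMeasurable_of_tendsto_ae atTop (f := fun N : ℕ => fun y => ∑ n ∈ rg N, a n y)
        (fun N => (integrable_finsetSum _ fun n _ => ia n).aestronglyMeasurable) ?_
      filter_upwards [fin] with y hy
      have : Summable fun n => a n y := summable_of_hasFiniteSupport (hy.subset fun n hn => by
        by_contra h'; exact hn (Set.indicator_of_notMem (show y ∉ E n from h') _))
      exact this.hasSum.tendsto_sum_nat
    · refine lt_of_le_of_lt (lintegral_mono fun y => enorm_tsum_le_tsum_enorm) ?_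
      rw [lintegral_tsum fun n => (ia n).aestronglyMeasurable.enorm]
      exact lsum
  have iden : ∀ η : RR → ℝ, Continuous η → (∃ S, ∀ z, |η z| ≤ S) →
      ∫ z in D2, η (f z, g z) * h z * wd (grad f z) (grad g z) = ∫ y, η y * TT E p sg h y := by
    intro η cη ⟨B, hB⟩
    have h1 := hη η cη ⟨B, hB⟩
    have h2 := hasSum_integral_of_summable_integral_norm (μ := volume) (F := fun n y => η y * a n y)
      (fun n => (ia n).bdd_mul cη.aestronglyMeasurable (ae_of_all _ hB)) ?_
    · have e : ∀ n, ∫ y, η y * a n y = ∫ y in E n, η y * ((sg n y : ℝ) * h (p n y)) := fun n => by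
        rw [← integral_indicator (hE n)]; congr 1; ext y
        by_cases hy : y ∈ E n <;> simp [ha, hy]
      simp only [e, tsum_mul_left] at h2
      exact h1.unique h2
    · refine Summable.of_nonneg_of_le (fun n => integral_nonneg fun y => norm_nonneg _)
        (f := fun n => B * ∫ y, ‖a n y‖) (fun n => ?_) (Summable.mul_left _ ?_)
      · rw [← integral_const_mul]
        refine integral_mono_of_nonneg (ae_of_all _ fun y => norm_nonneg _) ((ia n).norm.const_mul _) (ae_of_all _ fun y => ?_)
        simp only [norm_mul]
        exact mul_le_mul_of_nonneg_right (hB y) (norm_nonneg _)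
      · have := ENNReal.summable_toReal lsum.ne
        refine this.congr fun n => ?_
        rw [integral_norm_eq_lintegral_enorm (ia n).aestronglyMeasurable]
  obtain ⟨C0, -, hC0⟩ := kk_bdd
  filter_upwards [IsUnifLocDoublingMeasure.ae_tendsto_average_norm_sub (μ := (volume : Measure RR)) iT.locallyIntegrable 1] with y hy
  have hy := hy (l := nhdsWithin (0:ℝ) (Set.Ioi 0)) (fun _ => y) id tendsto_id (by
    filter_upwards [self_mem_nhdsWithin] with ρ hρ
    exact Metric.mem_closedBall_self (by simpa using le_of_lt hρ))
  rw [tendsto_iff_norm_sub_tendsto_zero]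
  have hy4 := hy.const_mul (4 * C0 ^ 2)
  rw [mul_zero] at hy4
  refine squeeze_zero' (Eventually.of_forall fun _ => norm_nonneg _) ?_ hy4
  filter_upwards [self_mem_nhdsWithin] with ρ hρ
  have hρ : 0 < ρ := hρ
  set η : RR → ℝ := fun x => kc y.1 ρ x.1 * kc y.2 ρ x.2 with hηd
  have cη : Continuous η := ((kc_smooth y.1 ρ).continuous.comp continuous_fst).mul
    ((kc_smooth y.2 ρ).continuous.comp continuous_snd)
  have bη : ∀ x, |η x| ≤ C0 / ρ * (C0 / ρ) := fun x => by
    rw [hηd]; simp only [abs_mul]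
    exact mul_le_mul (kc_le hC0 hρ) (kc_le hC0 hρ) (abs_nonneg _) ((abs_nonneg _).trans (kc_le hC0 (c := 0) (x := 0) hρ))
  have zη : ∀ x, x ∉ Metric.closedBall y ρ → η x = 0 := fun x hx => by
    rw [Metric.mem_closedBall, Prod.dist_eq, max_le_iff, not_and_or, Real.dist_eq, Real.dist_eq] at hx
    simp only [hηd]
    rcases hx with h | h
    · rw [kc_zero hρ (by push Not at h; exact h), zero_mul]
    · rw [kc_zero (x := x.2) hρ (by push Not at h; exact h), mul_zero]
  have e1 : U f g h y ρ = ∫ x, η x * TT E p sg h x := iden η cη ⟨_, bη⟩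
  have iη : Integrable η := (kc_integral y.1 hρ).1.mul_prod (kc_integral y.2 hρ).1
  have e2 : ∫ x, η x = 1 := by
    have := integral_prod_mul (μ := volume) (ν := volume) (kc y.1 ρ) (kc y.2 ρ)
    rw [(kc_integral y.1 hρ).2, (kc_integral y.2 hρ).2, one_mul] at this
    exact this
  have e3 : U f g h y ρ - TT E p sg h y = ∫ x in Metric.closedBall y ρ, η x * (TT E p sg h x - TT E p sg h y) := by
    rw [setIntegral_eq_integral_of_forall_compl_eq_zero (fun x hx => by rw [zη x hx, zero_mul])]
    simp only [mul_sub]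
    rw [integral_sub (iT.bdd_mul cη.aestronglyMeasurable (ae_of_all _ bη)) (iη.mul_const _), integral_mul_const, e2, e1, one_mul]
  have iN : IntegrableOn (fun x => ‖TT E p sg h x - TT E p sg h y‖) (Metric.closedBall y ρ) :=
    (iT.integrableOn.sub (integrableOn_const measure_closedBall_lt_top.ne)).norm
  have vb : volume.real (Metric.closedBall y ρ) = 4 * ρ ^ 2 := by
    have : Metric.closedBall y ρ = Metric.closedBall y.1 ρ ×ˢ Metric.closedBall y.2 ρ := by
      rw [closedBall_prod_same]
    rw [this, Measure.real, Measure.volume_eq_prod, Measure.prod_prod, Real.volume_closedBall, Real.volume_closedBall,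
      ENNReal.toReal_mul, ENNReal.toReal_ofReal (by positivity)]; ring
  rw [e3]
  refine (norm_integral_le_of_norm_le (iN.const_mul (C0 / ρ * (C0 / ρ))) (ae_of_all _ fun x => ?_)).trans ?_
  · rw [norm_mul]; exact mul_le_mul_of_nonneg_right (bη x) (norm_nonneg _)
  · rw [integral_const_mul, setAverage_eq, id, vb, smul_eq_mul]
    apply le_of_eq
    field_simp
variable {δ : RR → RR → ℝ} {L : ℝ≥0} {J : RR → ℝ} {C : ℝ} {f g : RR → ℝ} {tm : ℝ}
lemma vol_cb (y : RR) {ρ : ℝ} (hρ : 0 ≤ ρ) : volume (Metric.closedBall y ρ) = eR (4 * ρ ^ 2) := by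
  have : Metric.closedBall y ρ = Metric.closedBall y.1 ρ ×ˢ Metric.closedBall y.2 ρ := by
    rw [closedBall_prod_same]
  rw [this, Measure.volume_eq_prod, Measure.prod_prod, Real.volume_closedBall, Real.volume_closedBall,
    ← ENNReal.ofReal_mul (by positivity)]; congr 1; ring
lemma bx_eq (f g : RR → ℝ) (y : RR) (ρ : ℝ) : bx f g y ρ = (fun z => (f z, g z)) ⁻¹' Metric.closedBall y ρ := by
  ext z
  simp only [bx, Set.mem_preimage, Metric.mem_closedBall, Prod.dist_eq, max_le_iff, Real.dist_eq, abs_le,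
    Set.mem_Icc, Set.mem_ofPred_eq]
  constructor
  · rintro ⟨⟨a, b⟩, c, d⟩; exact ⟨⟨by linarith, by linarith⟩, by linarith, by linarith⟩
  · rintro ⟨⟨a, b⟩, c, d⟩; exact ⟨⟨by linarith, by linarith⟩, by linarith, by linarith⟩
lemma bad_vol (P : PM δ L J C) (hf : DL δ f) (hg : DL δ g) {Λ : ℝ} (hΛ : 0 < Λ) :
    volume {y : RR | ∃ ρ, 0 < ρ ∧ ρ ≤ 1/8 ∧ Λ * ρ ^ 2 < mu f g J y ρ} ≤ eR (100 * C / Λ) := by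
  set B := {y : RR | ∃ ρ, 0 < ρ ∧ ρ ≤ 1/8 ∧ Λ * ρ ^ 2 < mu f g J y ρ} with hB
  have cF : Continuous fun z => (f z, g z) := (P.dl_lip hf).continuous.prodMk (P.dl_lip hg).continuous
  have : ∀ y : RR, ∃ ρ, y ∈ B → (0 < ρ ∧ ρ ≤ 1/8 ∧ Λ * ρ ^ 2 < mu f g J y ρ) := fun y => by
    by_cases hy : y ∈ B
    · obtain ⟨ρ, h⟩ := hy; exact ⟨ρ, fun _ => h⟩
    · exact ⟨0, fun h => absurd h hy⟩
  choose r hr using this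
  obtain ⟨u, uB, ud, uc⟩ := Vitali.exists_disjoint_subfamily_covering_enlargement_closedBall B id r (1/8)
    (fun y hy => (hr y hy).2.1) 5 (by norm_num)
  have ucnt : u.Countable := ud.countable_of_nonempty_interior fun y hy => by
    refine ⟨y, ?_⟩
    rw [interior_closedBall _ (hr y (uB hy)).1.ne']
    exact Metric.mem_ball_self (hr y (uB hy)).1
  set ν := (volume.restrict D2).withDensity fun z => eR (J z) with hν
  have mb : ∀ y ρ, MeasurableSet (bx f g y ρ) := fun y ρ => by
    rw [bx_eq]; exact Metric.isClosed_closedBall.measurableSet.preimage cF.measurable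
  have νb : ∀ y ρ, eR (mu f g J y ρ) = ν (bx f g y ρ) := fun y ρ => by
    rw [hν, withDensity_apply _ (mb y ρ), Measure.restrict_restrict (mb y ρ), Set.inter_comm, mu,
      ofReal_integral_eq_lintegral_ofReal (P.Jint.mono_set Set.inter_subset_left) (ae_of_all _ P.Jnn)]
  have ν1 : ν Set.univ ≤ eR C := by
    rw [hν, withDensity_apply _ MeasurableSet.univ, Measure.restrict_univ,
      ← ofReal_integral_eq_lintegral_ofReal P.Jint (ae_of_all _ P.Jnn)]
    exact ENNReal.ofReal_le_ofReal P.JC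
  have : Countable u := ucnt
  calc volume B ≤ volume (⋃ y ∈ u, Metric.closedBall y (5 * r y)) := by
        refine measure_mono fun y hy => ?_
        obtain ⟨b, hb, hs⟩ := uc y hy
        exact Set.mem_biUnion hb (hs (Metric.mem_closedBall_self (hr y hy).1.le))
    _ ≤ ∑' y : u, volume (Metric.closedBall (y : RR) (5 * r y)) := measure_biUnion_le _ ucnt _
    _ ≤ ∑' y : u, eR (100 / Λ) * ν (bx f g y (r y)) := by
        refine ENNReal.tsum_le_tsum fun y => ?_
        obtain ⟨h1, h2, h3⟩ := hr y (uB y.2)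
        rw [vol_cb _ (by linarith), ← νb, ← ENNReal.ofReal_mul (by positivity)]
        apply ENNReal.ofReal_le_ofReal
        rw [div_mul_eq_mul_div, le_div_iff₀ hΛ]
        nlinarith
    _ = eR (100 / Λ) * ν (⋃ y ∈ u, bx f g y (r y)) := by
        rw [ENNReal.tsum_mul_left, measure_biUnion ucnt ?_ fun y _ => mb _ _]
        intro a ha b hb hab
        simp only [Function.onFun, bx_eq]
        exact Disjoint.preimage _ (ud ha hb hab)
    _ ≤ eR (100 / Λ) * eR C := by
        gcongr; exact (measure_mono (Set.subset_univ _)).trans ν1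
    _ = _ := by rw [← ENNReal.ofReal_mul (by positivity)]; congr 1; ring
def HH (δ : RR → RR → ℝ) (a b : RR) (s e : ℝ) (z : RR) : ℝ := min (δ z b + |e|) (max 0 (s - δ z a))
lemma PM.nonneg (P : PM δ L J C) (z w : RR) : 0 ≤ δ z w := by
  have := P.tri z w z; rw [P.self, P.symm w z] at this; linarith
lemma PM.dl_right (P : PM δ L J C) (a : RR) : DL δ fun z => δ z a := fun z w => by
  have h1 := P.tri z w a; have h2 := P.tri w z a; rw [P.symm w z] at h2
  rw [abs_le]; constructor <;> linarith
lemma HH_dl (P : PM δ L J C) (a b : RR) (s e : ℝ) : DL δ (HH δ a b s e) ∧ ∀ z, |HH δ a b s e z| ≤ |s| := by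
  refine ⟨fun z w => ?_, fun z => ?_⟩
  · refine (abs_min_sub_min_le_max _ _ _ _).trans (max_le ?_ ?_)
    · have := P.dl_right b z w; rwa [add_sub_add_right_eq_sub]
    · refine (abs_max_sub_max_le_max _ _ _ _).trans (max_le (by simpa using P.nonneg z w) ?_)
      have := P.dl_right a z w; rw [sub_sub_sub_cancel_left, abs_sub_comm]; exact this
  · have h0 : 0 ≤ HH δ a b s e z := le_min (add_nonneg (P.nonneg _ _) (abs_nonneg _)) (le_max_left _ _)
    rw [abs_of_nonneg h0]
    exact (min_le_right _ _).trans (max_le (abs_nonneg _) (by linarith [P.nonneg z a, le_abs_self s]))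
lemma HH_cont (P : PM δ L J C) (z : RR) :
    Continuous fun q : (RR) × (RR) × RR => HH δ q.1 q.2.1 q.2.2.1 q.2.2.2 z := by
  have h : Continuous fun a => δ z a := by
    have := (P.dl_lip (P.dl_right z)).continuous
    simpa only [P.symm _ z] using this
  unfold HH
  have h1 := h.comp (continuous_fst (X := RR) (Y := (RR) × RR))
  have h2 := h.comp (continuous_fst.comp (continuous_snd (X := RR) (Y := (RR) × RR)))
  simp only [Function.comp_def] at h1 h2
  fun_prop
lemma good {C : ℝ} (hC : 0 ≤ C) : ∃ (m : ℕ) (M : ℝ), 0 ≤ M ∧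
    ∀ (δ : RR → RR → ℝ) (L : ℝ≥0) (J f g : RR → ℝ) (tm : ℝ), PM δ L J C → Cfg δ f g tm →
    ∃ (G : Set RR) (I : RR → Finset ℕ) (p : ℕ → RR → RR) (sg : ℕ → RR → ℤ),
      G ⊆ Metric.closedBall (tm, 3/8) (1/16) ∧ eR (1/128) ≤ volume G ∧
      (∀ n y, sg n y = 1 ∨ sg n y = -1) ∧
      (∀ y ∈ G, (I y).card ≤ m ∧ (∀ n ∈ I y, (f (p n y), g (p n y)) = y) ∧ ∑ n ∈ I y, sg n y = -1) ∧
      ∀ y ∈ G, ∀ y' ∈ G, dist y y' ≤ 1/16 → ∀ a b s e,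
        |∑ n ∈ I y, (sg n y : ℝ) * HH δ a b s e (p n y) - ∑ n ∈ I y', (sg n y' : ℝ) * HH δ a b s e (p n y')| ≤
          M * dist y y' := by
  obtain ⟨C0, hC1, hC0⟩ := kk_bdd
  set Λ : ℝ := 25600 * (C + 1) with hΛd
  have hΛ : 0 < Λ := by positivity
  set m : ℕ := ⌈256 * (C + 1)⌉₊ with hmd
  have hm : 256 * (C + 1) ≤ m := Nat.le_ceil _
  refine ⟨m, 20 * C0 * Λ, by positivity, fun δ L J f g tm P c => ?_⟩
  obtain ⟨E, p, sg, mE, pE, hsg, sE, hH⟩ := slices P c.hf c.hg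
  have sE' : ∑' n, volume (E n) ≠ ⊤ := (sE.trans_lt ENNReal.ofReal_lt_top).ne
  classical
  set I : RR → Finset ℕ := fun y => if h : {n | y ∈ E n}.Finite then h.toFinset else ∅ with hI
  have mI : ∀ y n, n ∈ I y → y ∈ E n := fun y n hn => by
    simp only [hI] at hn
    split_ifs at hn with h
    · simpa using hn
    · simp at hn
  have mI' : ∀ y, {n | y ∈ E n}.Finite → ∀ n, n ∉ I y → y ∉ E n := fun y hy n hn => by
    simp only [hI, dif_pos hy] at hn; simpa using hn
  have hTT : ∀ y, {n | y ∈ E n}.Finite → ∀ h, TT E p sg h y = ∑ n ∈ I y, (sg n y : ℝ) * h (p n y) := by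
    intro y hy h
    unfold TT
    rw [tsum_eq_sum (s := I y) fun n hn => Set.indicator_of_notMem (mI' y hy n hn) _]
    exact Finset.sum_congr rfl fun n hn => Set.indicator_of_mem (mI y n hn) _
  have fin : ∀ᵐ y, {n | y ∈ E n}.Finite := ae_finite_setOfPred_mem sE'
  set N : RR → ℝ≥0∞ := fun y => ∑' n, (E n).indicator 1 y with hN
  have mN : Measurable N := Measurable.tsum fun n => measurable_one.indicator (mE n)
  have iN : ∫⁻ y, N y ≤ eR C := by
    rw [hN, lintegral_tsum fun n => (measurable_one.indicator (mE n)).aemeasurable]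
    simpa only [lintegral_indicator_one (mE _)] using sE
  have hNc : ∀ y, {n | y ∈ E n}.Finite → N y = (I y).card := by
    intro y hy
    simp only [hN]
    rw [tsum_eq_sum (s := I y) fun n hn => Set.indicator_of_notMem (mI' y hy n hn) _,
      Finset.sum_congr rfl fun n hn => Set.indicator_of_mem (mI y n hn) _]
    simp
  have DLc : ∀ h, DL δ h → ∀ S, (∀ z, |h z| ≤ S) →
      ∀ᵐ y, Tendsto (U f g h y) (nhdsWithin 0 (Set.Ioi 0)) (nhds (TT E p sg h y)) := fun h hh S hS =>
    have := hH h (P.dl_lip hh).continuous ⟨S, hS⟩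
    slice_tendsto mE sE' hsg hS this.1 this.2
  have dl1 : DL δ fun _ => 1 := fun z w => by simpa using P.nonneg z w
  set d := TopologicalSpace.denseSeq ((RR) × (RR) × RR) with hd
  have ae1 := DLc _ dl1 1 (by simp)
  have ae2 : ∀ᵐ y, ∀ k, Tendsto (U f g (HH δ (d k).1 (d k).2.1 (d k).2.2.1 (d k).2.2.2) y) (nhdsWithin 0 (Set.Ioi 0))
      (nhds (TT E p sg (HH δ (d k).1 (d k).2.1 (d k).2.2.1 (d k).2.2.2) y)) :=
    ae_all_iff.2 fun k => DLc _ (HH_dl P _ _ _ _).1 _ (HH_dl P _ _ _ _).2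
  set B1 := {y : RR | ∃ ρ, 0 < ρ ∧ ρ ≤ 1/8 ∧ Λ * ρ ^ 2 < mu f g J y ρ} with hB1
  set B2 := {y : RR | (m : ℝ≥0∞) ≤ N y} with hB2
  have ae3 := (fin.and ae1).and ae2
  set B3 := {y : RR | ¬ ((({n | y ∈ E n}.Finite) ∧ Tendsto (U f g (fun _ => 1) y) (nhdsWithin 0 (Set.Ioi 0)) (nhds (TT E p sg (fun _ => 1) y))) ∧
    ∀ k, Tendsto (U f g (HH δ (d k).1 (d k).2.1 (d k).2.2.1 (d k).2.2.2) y) (nhdsWithin 0 (Set.Ioi 0))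
      (nhds (TT E p sg (HH δ (d k).1 (d k).2.1 (d k).2.2.1 (d k).2.2.2) y)))} with hB3
  have v3 : volume B3 = 0 := ae3
  have v1 : volume B1 ≤ eR (1/256) := (bad_vol P c.hf c.hg hΛ).trans (ENNReal.ofReal_le_ofReal (by
    rw [div_le_iff₀ hΛ, hΛd]; linarith))
  have v2 : volume B2 ≤ eR (1/256) := by
    have h1 := mul_meas_ge_le_lintegral mN (m : ℝ≥0∞) (μ := volume)
    have h2 : eR (256 * (C + 1)) ≤ m := by
      rw [← ENNReal.ofReal_natCast]; exact ENNReal.ofReal_le_ofReal hm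
    have h3 : eR (256 * (C + 1)) * volume B2 ≤ eR (256 * (C + 1)) * eR (1/256) := by
      refine (mul_le_mul_left h2 _).trans (h1.trans (iN.trans ?_))
      rw [← ENNReal.ofReal_mul (by positivity)]
      exact ENNReal.ofReal_le_ofReal (by linarith)
    rwa [ENNReal.mul_le_mul_iff_right (by simp; positivity) ENNReal.ofReal_ne_top] at h3
  set Q := Metric.closedBall ((tm, 3/8) : RR) (1/16)
  set G := Q \ (B1 ∪ B2 ∪ B3) with hG
  have vG : eR (1/128) ≤ volume G := by
    have h1 : volume Q = eR (1/64) := by rw [vol_cb _ (by norm_num)]; norm_num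
    have h2 : volume Q ≤ volume G + (eR (1/256) + eR (1/256)) := by
      calc volume Q ≤ volume (G ∪ (B1 ∪ B2 ∪ B3)) := measure_mono (by rw [hG, Set.sdiff_union_self]; exact Set.subset_union_left)
        _ ≤ volume G + (volume B1 + volume B2 + volume B3) :=
          (measure_union_le _ _).trans (by gcongr; exact (measure_union_le _ _).trans (by gcongr; exact measure_union_le _ _))
        _ ≤ _ := by rw [v3, add_zero]; gcongr
    rw [h1, ← ENNReal.ofReal_add (by norm_num) (by norm_num)] at h2
    have h3 : eR (1/64) = eR (1/128) + eR (1/256 + 1/256) := by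
      rw [← ENNReal.ofReal_add (by norm_num) (by norm_num)]; norm_num
    rw [h3] at h2
    exact (ENNReal.add_le_add_iff_right ENNReal.ofReal_ne_top).1 h2
  have G3 : ∀ y ∈ G, (({n | y ∈ E n}.Finite) ∧ Tendsto (U f g (fun _ => 1) y) (nhdsWithin 0 (Set.Ioi 0)) (nhds (TT E p sg (fun _ => 1) y))) ∧
    ∀ k, Tendsto (U f g (HH δ (d k).1 (d k).2.1 (d k).2.2.1 (d k).2.2.2) y) (nhdsWithin 0 (Set.Ioi 0))
      (nhds (TT E p sg (HH δ (d k).1 (d k).2.1 (d k).2.2.1 (d k).2.2.2) y)) := fun y hy => by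
    by_contra h; exact hy.2 (Or.inr h)
  have G1 : ∀ y ∈ G, ∀ ρ, 0 < ρ → ρ ≤ 1/8 → mu f g J y ρ ≤ Λ * ρ ^ 2 := fun y hy ρ h1 h2 => by
    by_contra h; push Not at h; exact hy.2 (Or.inl (Or.inl ⟨ρ, h1, h2, h⟩))
  have G2 : ∀ y ∈ G, N y < m := fun y hy => by
    by_contra h; push Not at h; exact hy.2 (Or.inl (Or.inr h))
  refine ⟨G, I, p, sg, Set.sdiff_subset, vG, hsg, fun y hy => ⟨?_, fun n hn => pE n y (mI y n hn), ?_⟩, ?_⟩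
  · have := G2 y hy
    rw [hNc y (G3 y hy).1.1] at this
    exact_mod_cast this.le
  · have h1 := (G3 y hy).1.2
    have h2 : Tendsto (U f g (fun _ => 1) y) (nhdsWithin 0 (Set.Ioi 0)) (nhds (-1)) := by
      refine tendsto_const_nhds.congr' ?_
      filter_upwards [self_mem_nhdsWithin, mem_nhdsWithin_of_mem_nhds (gt_mem_nhds (show (0:ℝ) < 1/8 by norm_num))] with ρ h h'
      exact (deg P c hy.1 h h'.le).symm
    have h3 := tendsto_nhds_unique h1 h2
    rw [hTT y (G3 y hy).1.1] at h3
    simp only [mul_one] at h3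
    exact_mod_cast h3
  · intro y hy y' hy' hdist a b s e
    have hcl : IsClosed {q : (RR) × (RR) × RR |
        |∑ n ∈ I y, (sg n y : ℝ) * HH δ q.1 q.2.1 q.2.2.1 q.2.2.2 (p n y) -
          ∑ n ∈ I y', (sg n y' : ℝ) * HH δ q.1 q.2.1 q.2.2.1 q.2.2.2 (p n y')| ≤ 20 * C0 * Λ * dist y y'} := by
      refine isClosed_le (Continuous.abs (Continuous.sub ?_ ?_)) continuous_const <;>
      exact continuous_finsetSum _ fun n _ => continuous_const.mul (HH_cont P _)
    have hall : closure (Set.range d) ⊆ _ := hcl.closure_subset_iff.2 (by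
      rintro _ ⟨k, rfl⟩
      have := slice_lip P c (HH_dl P (d k).1 (d k).2.1 (d k).2.2.1 (d k).2.2.2).1 (HH_dl P _ _ _ _).2 hC0 hΛ.le hy.1 hy'.1 hdist
        ((G3 y hy).2 k) ((G3 y' hy').2 k) (G1 y hy) (G1 y' hy')
      rwa [hTT y (G3 y hy).1.1, hTT y' (G3 y' hy').1.1] at this)
    rw [(TopologicalSpace.denseRange_denseSeq _).closure_range] at hall
    exact hall (Set.mem_univ (a, b, s, e))
lemma clus {I T : Finset ℕ} (hT : T ⊆ I) {sg : ℕ → ℤ} (hs : ∀ n, sg n = 1 ∨ sg n = -1) {h : ℕ → ℝ} {h0 ε : ℝ} {m : ℕ}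
    (hε : 0 ≤ ε) (hm : I.card ≤ m) (hoff : ∀ n ∈ I, n ∉ T → h n = 0) (hon : ∀ n ∈ T, |h n - h0| ≤ ε) :
    |∑ n ∈ I, (sg n : ℝ) * h n - h0 * ((∑ n ∈ T, sg n : ℤ) : ℝ)| ≤ m * ε := by
  rw [← Finset.sum_subset hT (fun n h1 h2 => by rw [hoff n h1 h2, mul_zero]), Int.cast_sum, Finset.mul_sum, ← Finset.sum_sub_distrib]
  refine (Finset.abs_sum_le_sum_abs _ _).trans ((Finset.sum_le_card_nsmul _ _ ε fun n hn => ?_).trans ?_)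
  · rw [show (sg n : ℝ) * h n - h0 * sg n = sg n * (h n - h0) by ring, abs_mul]
    have : |(sg n : ℝ)| = 1 := by rcases hs n with h | h <;> simp [h]
    rw [this, one_mul]; exact hon n hn
  · rw [nsmul_eq_mul]
    have : T.card ≤ m := (Finset.card_le_card hT).trans hm
    gcongr
lemma int_mul_ge {c : ℤ} (hc : c ≠ 0) {x : ℝ} (hx : 0 ≤ x) : x ≤ |x * c| := by
  rw [abs_mul, abs_of_nonneg hx]
  have : (1:ℝ) ≤ |(c:ℝ)| := by exact_mod_cast Int.one_le_abs hc
  nlinarith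
variable {δ : RR → RR → ℝ} {L : ℝ≥0} {J : RR → ℝ} {C : ℝ}
lemma sel1 (P : PM δ L J C) {S : Set RR} {I : RR → Finset ℕ} {p : ℕ → RR → RR} {sg : ℕ → RR → ℤ}
    {m : ℕ} {M s θ : ℝ} (hs : 0 < s) (hθ : 0 < θ) (hθ1 : θ ≤ 1/64) (hm : m * θ ≤ 1/64) (hsg : ∀ n y, sg n y = 1 ∨ sg n y = -1)
    (hS : ∀ y ∈ S, (I y).card ≤ m ∧ ∑ n ∈ I y, sg n y = -1)
    (hgap : ∀ y ∈ S, ∀ n ∈ I y, ∀ n' ∈ I y, δ (p n y) (p n' y) ≤ s → δ (p n y) (p n' y) ≤ θ * s)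
    (hM : ∀ y ∈ S, ∀ y' ∈ S, M * dist y y' ≤ s / 32)
    (hH : ∀ y ∈ S, ∀ y' ∈ S, ∀ a b t e, |∑ n ∈ I y, (sg n y : ℝ) * HH δ a b t e (p n y) -
      ∑ n ∈ I y', (sg n y' : ℝ) * HH δ a b t e (p n y')| ≤ M * dist y y') :
    ∃ ψ : RR → ℕ, (∀ y ∈ S, ψ y ∈ I y) ∧ ∀ y ∈ S, ∀ y' ∈ S,
      δ (p (ψ y) y) (p (ψ y') y') ≤ 2 * (m * (θ * s)) + M * dist y y' := by
  classical
  rcases S.eq_empty_or_nonempty with rfl | ⟨y0, hy0⟩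
  · exact ⟨fun _ => 0, by simp, by simp⟩
  have hθs : 0 < θ * s := by positivity
  have hθs' : θ * s ≤ s / 64 := by nlinarith
  have hms : m * (θ * s) ≤ s / 64 := by nlinarith
  set T : RR → ℕ → Finset ℕ := fun y n => (I y).filter fun n' => δ (p n y) (p n' y) ≤ θ * s with hT
  have hTI : ∀ y n, T y n ⊆ I y := fun y n => Finset.filter_subset _ _
  have memT : ∀ y n n', n' ∈ T y n ↔ n' ∈ I y ∧ δ (p n y) (p n' y) ≤ θ * s := fun y n n' => Finset.mem_filter
  have off : ∀ y ∈ S, ∀ n ∈ I y, ∀ n' ∈ I y, n' ∉ T y n → s < δ (p n y) (p n' y) := fun y hy n hn n' hn' h => by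
    by_contra h'
    exact h ((memT _ _ _).2 ⟨hn', hgap y hy n hn n' hn' (not_lt.1 h')⟩)
  obtain ⟨n0, hn0, hc0⟩ : ∃ n0 ∈ I y0, ∑ n ∈ T y0 n0, sg n y0 ≠ 0 := by
    by_contra hcon
    push Not at hcon
    have h1 := Finset.sum_fiberwise_of_maps_to (s := I y0) (t := (I y0).image (T y0)) (g := T y0)
      (fun n hn => Finset.mem_image_of_mem _ hn) (fun n => sg n y0)
    rw [(hS y0 hy0).2] at h1
    have h2 : ∑ j ∈ (I y0).image (T y0), ∑ n ∈ I y0 with T y0 n = j, sg n y0 = 0 := by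
      refine Finset.sum_eq_zero fun j hj => ?_
      obtain ⟨n1, hn1, rfl⟩ := Finset.mem_image.1 hj
      rw [← hcon n1 hn1]
      refine Finset.sum_congr (Finset.ext fun i => ?_) fun _ _ => rfl
      rw [Finset.mem_filter]
      constructor
      · rintro ⟨hi, h⟩
        rw [← h, memT]; exact ⟨hi, by rw [P.self]; exact hθs.le⟩
      · intro hi
        obtain ⟨hi, h⟩ := (memT _ _ _).1 hi
        refine ⟨hi, Finset.ext fun k => ?_⟩
        rw [memT, memT]
        refine and_congr_right fun hk => ⟨fun h' => hgap _ hy0 _ hn1 _ hk ?_, fun h' => hgap _ hy0 _ hi _ hk ?_⟩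
        · linarith [P.tri (p n1 y0) (p i y0) (p k y0)]
        · linarith [P.tri (p i y0) (p n1 y0) (p k y0), P.symm (p i y0) (p n1 y0)]
    omega
  set a := p n0 y0
  have hh1 : ∀ z, HH δ a a (s/8) s z = max 0 (s / 8 - δ z a) := fun z => by
    unfold HH
    rw [abs_of_pos hs]
    have := P.nonneg z a
    exact min_eq_right (max_le (by linarith) (by linarith))
  have h0 : s / 8 - s / 64 ≤ |∑ n ∈ I y0, (sg n y0 : ℝ) * HH δ a a (s/8) s (p n y0)| := by
    have := clus (hTI y0 n0) (fun n => hsg n y0) (h := fun n => HH δ a a (s/8) s (p n y0)) (h0 := s / 8) hθs.le (hS y0 hy0).1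
      (fun n hn hn' => by
        have := off y0 hy0 n0 hn0 n hn hn'
        rw [hh1, P.symm]; exact max_eq_left (by linarith))
      (fun n hn => by
        have := ((memT _ _ _).1 hn).2
        have h3 := P.nonneg a (p n y0)
        rw [hh1, P.symm, max_eq_right (by linarith), abs_le]; constructor <;> linarith)
    have h2 := int_mul_ge hc0 (x := s / 8) (by positivity)
    have h3 := abs_le.1 (abs_abs_sub_abs_le_abs_sub _ _ |>.trans this)
    linarith [h3.1]
  have step : ∀ y ∈ S, ∃ n ∈ I y, δ (p n y) a < s / 8 ∧ ∑ n' ∈ T y n, sg n' y ≠ 0 := by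
    intro y hy
    by_contra hcon
    push Not at hcon
    have h1 := abs_le.1 ((abs_abs_sub_abs_le_abs_sub _ _).trans ((hH y hy y0 hy0 a a (s/8) s).trans (hM y hy y0 hy0)))
    have : |∑ n ∈ I y, (sg n y : ℝ) * HH δ a a (s/8) s (p n y)| ≤ s / 64 := by
      by_cases hex : ∃ n ∈ I y, δ (p n y) a < s / 8
      · obtain ⟨n, hn, hna⟩ := hex
        have := clus (hTI y n) (fun n => hsg n y) (h := fun n => HH δ a a (s/8) s (p n y)) (h0 := HH δ a a (s/8) s (p n y)) hθs.le (hS y hy).1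
          (fun n' hn' hn'' => by
            have := off y hy n hn n' hn' hn''
            rw [hh1]; exact max_eq_left (by linarith [P.tri (p n y) a (p n' y), P.symm a (p n' y)]))
          (fun n' hn' => ((HH_dl P a a (s/8) s).1 _ _).trans (by rw [P.symm]; exact ((memT _ _ _).1 hn').2))
        rw [hcon n hn hna, Int.cast_zero, mul_zero, sub_zero] at this
        linarith
      · push Not at hex
        rw [Finset.sum_eq_zero fun n hn => by rw [hh1, max_eq_left (by linarith [hex n hn]), mul_zero], abs_zero]; positivity
    linarith [h1.1]
  choose! ψ hψ1 hψ2 hψ3 using step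
  refine ⟨ψ, hψ1, fun y hy y' hy' => ?_⟩
  set b := p (ψ y) y with hb
  set b' := p (ψ y') y'
  have far : ∀ y ∈ S, ∀ n ∈ I y, n ∉ T y (ψ y) → HH δ a b (s/2) 0 (p n y) = 0 := fun y hy n hn hn' => by
    have h1 := off y hy _ (hψ1 y hy) n hn hn'
    unfold HH
    rw [max_eq_left (by linarith [P.tri (p (ψ y) y) a (p n y), P.symm a (p n y), hψ2 y hy]), min_eq_right]
    have := P.nonneg (p n y) b
    positivity
  have e1 := clus (hTI y (ψ y)) (fun n => hsg n y) (h := fun n => HH δ a b (s/2) 0 (p n y)) (h0 := 0) hθs.le (hS y hy).1 (far y hy)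
    (fun n hn => by
      have h1 := ((memT _ _ _).1 hn).2
      rw [sub_zero, abs_le]
      have h2 := P.nonneg (p n y) b
      rw [← hb, P.symm] at h1
      unfold HH
      rw [abs_zero, add_zero]
      exact ⟨by linarith [le_min h2 (le_max_left 0 (s/2 - δ (p n y) a))], (min_le_left _ _).trans h1⟩)
  have hb' : HH δ a b (s/2) 0 b' = δ b' b := by
    unfold HH
    rw [abs_zero, add_zero]
    refine min_eq_left (le_max_of_le_right ?_)
    linarith [P.tri b' a b, P.symm a b, hψ2 y hy, hψ2 y' hy']
  have e2 := clus (hTI y' (ψ y')) (fun n => hsg n y') (h := fun n => HH δ a b (s/2) 0 (p n y')) (h0 := δ b' b) hθs.le (hS y' hy').1 (far y' hy')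
    (fun n hn => by
      rw [← hb']
      exact ((HH_dl P a b (s/2) 0).1 _ _).trans (by rw [P.symm]; exact ((memT _ _ _).1 hn).2))
  have e3 := int_mul_ge (hψ3 y' hy') (P.nonneg b' b)
  have e4 := hH y hy y' hy' a b (s/2) 0
  rw [zero_mul, sub_zero] at e1
  rw [P.symm b b']
  have e5 := (abs_le.1 ((abs_abs_sub_abs_le_abs_sub _ _).trans e2)).1
  have e6 := (abs_le.1 ((abs_abs_sub_abs_le_abs_sub _ _).trans e4)).1
  linarith
lemma pig {ι : Type*} {S : Finset ι} (hS : S.Nonempty) {G : Set RR} {A : ι → Set RR} (h : G ⊆ ⋃ x ∈ S, A x)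
    {c : ℝ} (hc : eR c ≤ volume G) : ∃ x ∈ S, eR (c / S.card) ≤ volume (A x) := by
  refine ENNReal.exists_le_of_sum_le hS (le_trans ?_ (hc.trans ((measure_mono h).trans (measure_biUnion_finset_le _ _))))
  have : (0:ℝ) < S.card := by exact_mod_cast hS.card_pos
  rw [Finset.sum_const, nsmul_eq_mul, ENNReal.ofReal_div_of_pos this, ENNReal.ofReal_natCast]
  exact ENNReal.mul_div_le
lemma sel {C : ℝ} (hC : 0 ≤ C) : ∃ c1 M : ℝ, 0 < c1 ∧ 0 ≤ M ∧ ∀ η > 0, ∃ w0 > 0, ∀ δ L J f g tm, PM δ L J C → Cfg δ f g tm →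
    ∃ w ≥ w0, ∃ K ⊆ Ic ((0:ℝ), (0:ℝ)) (1, 1), eR c1 ≤ volume K ∧ ∃ ψ : RR → RR, ∀ y ∈ K, ∀ y' ∈ K,
      dist y y' * w ≤ δ (ψ y) (ψ y') ∧ δ (ψ y) (ψ y') ≤ (M * dist y y' + η) * w := by
  classical
  obtain ⟨m, M, hM, H⟩ := good hC
  refine ⟨1/128 / ((m * m + 1 : ℕ) : ℝ), M, by positivity, hM, fun η hη => ?_⟩
  obtain ⟨N, hN⟩ := exists_nat_ge (16 + 32 * M)
  obtain ⟨Q, hQ⟩ := exists_nat_ge (64 + 64 * m + 2 * m * N / η)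
  have hN0 : (0:ℝ) < N := by linarith
  have hq0 : 0 ≤ 2 * m * N / η := by positivity
  have hm0 : (0:ℝ) ≤ m := Nat.cast_nonneg m
  have hQ0 : (0:ℝ) < Q := by linarith
  set θ : ℝ := 1 / Q with hθ
  have hθ0 : 0 < θ := by positivity
  have hθ1 : θ ≤ 1/64 := by rw [hθ]; gcongr; linarith
  have hθQ : θ * Q = 1 := by rw [hθ]; field_simp
  refine ⟨θ ^ (m * m) / N, by positivity, fun δ L J f g tm P c => ?_⟩
  obtain ⟨G, I, p, sg, hG1, hG2, hsg, hG3, hG4⟩ := H δ L J f g tm P c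
  set A : ℕ → Set RR := fun k => {y | y ∈ G ∧ ∀ n ∈ I y, ∀ n' ∈ I y, δ (p n y) (p n' y) ≤ θ ^ k → δ (p n y) (p n' y) ≤ θ * θ ^ k} with hA
  have cov : G ⊆ ⋃ k ∈ rg (m * m + 1), A k := by
    intro y hy
    by_contra hcon
    simp only [Set.mem_iUnion, not_exists, hA, Set.mem_ofPred_eq, not_and, not_forall, not_le] at hcon
    have : ∀ k ∈ rg (m * m + 1), ∃ q ∈ I y ×ˢ I y, δ (p q.1 y) (p q.2 y) ≤ θ ^ k ∧ θ * θ ^ k < δ (p q.1 y) (p q.2 y) := by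
      intro k hk
      obtain ⟨n, hn, n', hn', h1, h2⟩ := hcon k hk hy
      exact ⟨(n, n'), Finset.mem_product.2 ⟨hn, hn'⟩, h1, h2⟩
    choose! q hq1 hq2 hq3 using this
    have hcard : (I y ×ˢ I y).card < (rg (m * m + 1)).card := by
      rw [Finset.card_product, Finset.card_range]
      have := Nat.mul_le_mul (hG3 y hy).1 (hG3 y hy).1
      omega
    have key : ∀ k ∈ rg (m * m + 1), ∀ k' ∈ rg (m * m + 1), k < k' → q k ≠ q k' := by
      intro k hk k' hk' hlt he
      have h1 := hq3 k hk
      have h2 := hq2 k' hk'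
      rw [he] at h1
      have h3 : θ ^ k' ≤ θ ^ (k + 1) := pow_le_pow_of_le_one hθ0.le (by linarith) hlt
      rw [pow_succ'] at h3
      linarith
    obtain ⟨k, hk, k', hk', hne, he⟩ := Finset.exists_ne_map_eq_of_card_lt_of_maps_to hcard (f := q) hq1
    rcases lt_or_gt_of_ne hne with h | h
    · exact key k hk k' hk' h he
    · exact key k' hk' k hk h he.symm
  obtain ⟨k, hk, hAk⟩ := pig (by simp) cov hG2
  rw [Finset.card_range] at hAk
  set s : ℝ := θ ^ k with hs
  have hs0 : 0 < s := by positivity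
  have hs1 : s ≤ 1 := pow_le_one₀ hθ0.le (by linarith)
  set n : ℕ := N * Q ^ k with hn
  have hn0 : (0:ℝ) < n := by rw [hn]; push_cast; positivity
  set w : ℝ := s / N with hw
  have hw0 : 0 < w := by positivity
  have hwn : w * n = 1 := by
    rw [hw, hn, hs]; push_cast; rw [show θ ^ k / N * (N * (Q:ℝ) ^ k) = (θ * Q) ^ k by rw [mul_pow]; field_simp, hθQ, one_pow]
  have hw1 : w ≤ 1/16 := by rw [hw, div_le_iff₀ hN0]; nlinarith
  set cell : ℕ × ℕ → Set RR := fun q => {y | y ∈ A k ∧ ⌊(y.1 - (tm - 1/16)) * n⌋₊ = q.1 ∧ ⌊(y.2 - (3/8 - 1/16)) * n⌋₊ = q.2} with hcell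
  have hball : ∀ y ∈ A k, (0 ≤ y.1 - (tm - 1/16) ∧ y.1 - (tm - 1/16) < 1) ∧ (0 ≤ y.2 - (3/8 - 1/16) ∧ y.2 - (3/8 - 1/16) < 1) := by
    intro y hy
    have h := Metric.mem_closedBall.1 (hG1 hy.1)
    rw [Prod.dist_eq, max_le_iff, Real.dist_eq, Real.dist_eq, abs_le, abs_le] at h
    simp only at h
    refine ⟨⟨?_, ?_⟩, ?_, ?_⟩ <;> linarith [h.1.1, h.1.2, h.2.1, h.2.2]
  have cov2 : A k ⊆ ⋃ q ∈ rg n ×ˢ rg n, cell q := by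
    intro y hy
    obtain ⟨⟨a1, a2⟩, b1, b2⟩ := hball y hy
    simp only [Set.mem_iUnion]
    refine ⟨(_, _), Finset.mem_product.2 ⟨?_, ?_⟩, hy, rfl, rfl⟩ <;> refine Finset.mem_range.2 ((Nat.floor_lt (by positivity)).2 ?_) <;> nlinarith
  obtain ⟨q, -, hq⟩ := pig (by simpa using (by exact_mod_cast hn0 : 0 < n).ne') cov2 hAk
  rw [Finset.card_product, Finset.card_range] at hq
  set S := cell q with hS
  have hbd : ∀ y ∈ S, (q.1 ≤ (y.1 - (tm - 1/16)) * n ∧ (y.1 - (tm - 1/16)) * n < q.1 + 1) ∧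
      (q.2 ≤ (y.2 - (3/8 - 1/16)) * n ∧ (y.2 - (3/8 - 1/16)) * n < q.2 + 1) := by
    rintro y ⟨hy, h1, h2⟩
    obtain ⟨⟨a1, a2⟩, b1, b2⟩ := hball y hy
    exact ⟨(Nat.floor_eq_iff (by positivity)).1 h1, (Nat.floor_eq_iff (by positivity)).1 h2⟩
  have hdist : ∀ y ∈ S, ∀ y' ∈ S, dist y y' ≤ w := by
    intro y hy y' hy'
    obtain ⟨⟨a1, a2⟩, b1, b2⟩ := hbd y hy
    obtain ⟨⟨a1', a2'⟩, b1', b2'⟩ := hbd y' hy'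
    rw [Prod.dist_eq, max_le_iff, Real.dist_eq, Real.dist_eq, abs_le, abs_le]
    refine ⟨⟨?_, ?_⟩, ?_, ?_⟩ <;> refine le_of_mul_le_mul_right ?_ hn0 <;> linarith
  obtain ⟨ψ, hψ1, hψ2⟩ := sel1 P (S := S) (m := m) (M := M) (s := s) (θ := θ) hs0 hθ0 hθ1
    (by rw [hθ, mul_one_div, div_le_iff₀ hQ0]; linarith) hsg
    (fun y hy => ⟨(hG3 y hy.1.1).1, (hG3 y hy.1.1).2.2⟩) (fun y hy => hy.1.2)
    (fun y hy y' hy' => (mul_le_mul_of_nonneg_left (hdist y hy y' hy') hM).trans (by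
      rw [hw, mul_div_assoc', div_le_iff₀ hN0]; nlinarith))
    (fun y hy y' hy' => hG4 y hy.1.1 y' hy'.1.1 ((hdist y hy y' hy').trans hw1))
  set o : RR := (tm - 1/16 + q.1 * w, 3/8 - 1/16 + q.2 * w) with ho
  set K : Set RR := (fun u => w • u) ⁻¹' ((fun u => o + u) ⁻¹' S) with hK
  refine ⟨w, ?_, K, ?_, ?_, fun u => p (ψ (o + w • u)) (o + w • u), fun y hy y' hy' => ?_⟩
  · rw [ge_iff_le, hw]
    gcongr
    exact pow_le_pow_of_le_one hθ0.le (by linarith) (by have := Finset.mem_range.1 hk; omega)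
  · intro u hu
    obtain ⟨⟨a1, a2⟩, b1, b2⟩ := hbd _ hu
    simp only [ho, Prod.fst_add, Prod.snd_add, Prod.smul_fst, Prod.smul_snd, smul_eq_mul] at a1 a2 b1 b2
    have e1 : (tm - 1/16 + q.1 * w + w * u.1 - (tm - 1/16)) * n = q.1 + u.1 := by linear_combination (q.1 + u.1) * hwn
    have e2 : (3/8 - 1/16 + q.2 * w + w * u.2 - (3/8 - 1/16)) * n = q.2 + u.2 := by linear_combination (q.2 + u.2) * hwn
    rw [e1] at a1 a2; rw [e2] at b1 b2
    exact ⟨⟨by simpa using a1, by simpa using b1⟩, by simpa using a2.le, by simpa using b2.le⟩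
  · rw [hK, Measure.addHaar_preimage_smul _ hw0.ne', measure_preimage_add]
    refine le_trans ?_ (mul_le_mul_right hq _)
    rw [← ENNReal.ofReal_mul (abs_nonneg _)]
    refine ENNReal.ofReal_le_ofReal (le_of_eq ?_)
    have : (n : ℝ) = w⁻¹ := eq_inv_of_mul_eq_one_right hwn
    simp only [Module.finrank_prod, Module.finrank_self, Nat.cast_mul, this]
    rw [abs_of_pos (by positivity)]
    field_simp
  · have hd : dist (o + w • y) (o + w • y') = dist y y' * w := by
      rw [dist_add_left, dist_smul₀, Real.norm_of_nonneg hw0.le, mul_comm]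
    have f1 := (hG3 _ hy.1.1).2.1 _ (hψ1 _ hy)
    have f2 := (hG3 _ hy'.1.1).2.1 _ (hψ1 _ hy')
    constructor
    · rw [← hd]
      refine (le_of_eq ?_).trans (max_le (c.hf _ _) (c.hg _ _))
      rw [← Real.dist_eq, ← Real.dist_eq]
      exact (congrArg₂ dist f1.symm f2.symm)
    · refine (hψ2 _ hy _ hy').trans ?_
      rw [hd]
      have : 2 * (m * (θ * s)) ≤ η * w := by
        rw [hw, hθ, mul_div_assoc', le_div_iff₀ hN0]
        have : 2 * m * N / η ≤ Q := by linarith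
        rw [div_le_iff₀ hη] at this
        rw [show 2 * (m * (1 / (Q:ℝ) * s)) * N = 2 * m * N * s / Q by ring, div_le_iff₀ hQ0]
        nlinarith
      linarith
lemma inst {X : Type u} {X' : Type u} [MetricSpace X] [MetricSpace X'] {C : ℝ} (hC : 0 ≤ C)
    (hQ : ∀ c : ℝ → X', IsLipLoop c → ∃ φ : RR → X', BoundsLoop φ c ∧ lipArea φ ≤ C * (loopLength c) ^ 2)
    {ι : X → X'} (hι : Isometry ι) {D : ℝ} (hD : 0 < D) (hc : Conf X D) :
    ∃ (Φ : RR → X') (L : ℝ≥0) (J f g : RR → ℝ) (tm : ℝ), PM (fun z w => dist (Φ z) (Φ w) / D) L J (2 * C * 68 ^ 2) ∧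
      Cfg (fun z w => dist (Φ z) (Φ w) / D) f g tm := by
  obtain ⟨σ, l, t, ⟨hl0, hσ⟩, hl, ht1, ht2, -, c, c0, c1, cl, cf⟩ := hc
  have hlp : 0 < l := by linarith
  have ht0 : 0 < t := by linarith
  obtain ⟨γ, hγL, hγ, hγv, -⟩ := poly_loop (X := X') (n := 2) (fun k => if Even k then ι ∘ σ else ι ∘ c)
    (fun k => if Even k then l else 60 * D) two_pos (fun k => by split_ifs <;> linarith)
    (fun k s hs t ht => by
      split_ifs at hs ht ⊢
      · rw [Function.comp_apply, Function.comp_apply, hι.dist_eq, hσ s hs t ht]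
      · rw [Function.comp_apply, Function.comp_apply, hι.dist_eq]; exact cl s hs t ht)
    (fun k => by
      by_cases hk : Even k
      · simp [hk, Nat.even_add_one, c0]
      · simp [hk, Nat.even_add_one, c1])
  have g1 : ∀ s ∈ Ic (0:ℝ) (1/2), γ s = ι (σ (2 * s * l)) := fun s hs => by
    have := hγ 0 two_pos s (by simpa using hs)
    simpa using this
  have g2 : ∀ s ∈ Ic (1/2:ℝ) 1, γ s = ι (c ((2 * s - 1) * (60 * D))) := fun s hs => by
    have := hγ 1 one_lt_two s ⟨by simpa using hs.1, by norm_num; exact hs.2⟩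
    simpa using this
  have hloop : γ 0 = γ 1 := by
    rw [g1 0 (by norm_num), g2 1 (by norm_num)]; norm_num [c1]
  have hlen : loopLength γ ≤ 68 * D := by
    refine ENNReal.toReal_le_of_le_ofReal (by positivity) (hγv.trans (ENNReal.ofReal_le_ofReal ?_))
    simp [Finset.sum_range_succ]; linarith
  have hlen0 : 0 ≤ loopLength γ := ENNReal.toReal_nonneg
  obtain ⟨φ, ⟨⟨K, hK⟩, hφ⟩, hA⟩ := hQ γ ⟨hγL, hloop⟩
  obtain ⟨Φ, L, hL, hΦ, hΦA⟩ := disc_ext hK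
  have hcirc : ∀ s ∈ Ic (0:ℝ) 1, Φ (circ s) = γ s := fun s hs => by rw [hΦ _ (circ_mem s)]; exact hφ s hs
  have dl : ∀ q : X', DL (fun z w => dist (Φ z) (Φ w) / D) fun z => dist q (Φ z) / D := fun q z w => by
    rw [← sub_div, abs_div, abs_of_pos hD]
    have := abs_dist_sub_le (Φ z) (Φ w) q
    simp only [dist_comm q]; exact div_le_div_of_nonneg_right this hD.le
  refine ⟨Φ, L / D.toNNReal, fun z => 2 / D ^ 2 * jac2 (mder Φ z), fun z => dist (ι (σ 0)) (Φ z) / D,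
    fun z => max 0 (1 - dist (ι (σ t)) (Φ z) / D), t / D, ⟨fun z => by simp, fun z w => by rw [dist_comm], fun x y z => ?_, fun z w => ?_,
      (jac_integrable hL).const_mul _, fun z => ?_, ?_, fun u v hu hv => ?_⟩, dl _, fun z w => ?_, t / (2 * l), ⟨by positivity, ?_⟩, ?_, ?_, fun s hs h1 h2 => ?_, fun s hs h1 h2 => ?_⟩
  · rw [← add_div]; gcongr; exact dist_triangle _ _ _
  · rw [NNReal.coe_div, Real.coe_toNNReal _ hD.le, div_mul_eq_mul_div]
    gcongr; exact hL.dist_le_mul z w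
  · unfold jac2; split_ifs <;> positivity
  · rw [integral_const_mul, ← hΦA]
    have : (loopLength γ) ^ 2 ≤ (68 * D) ^ 2 := by gcongr
    calc 2 / D ^ 2 * lipArea φ ≤ 2 / D ^ 2 * (C * (68 * D) ^ 2) := by
          gcongr; exact hA.trans (by gcongr)
      _ = _ := by field_simp
  · have hDu : ∀ u : RR → ℝ, DL (fun z w => dist (Φ z) (Φ w) / D) u → ∀ z w, |D * u z - D * u w| ≤ dist (Φ z) (Φ w) := fun u hu z w => by
      have := hu z w
      rw [le_div_iff₀ hD] at this
      rw [← mul_sub, abs_mul, abs_of_pos hD]; linarith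
    have hDd : ∀ u : RR → ℝ, DL (fun z w => dist (Φ z) (Φ w) / D) u → ∀ᵐ z : RR, DifferentiableAt ℝ u z := fun u hu => by
      have : LipschitzWith (L / D.toNNReal) u := LipschitzWith.of_dist_le_mul fun z w => by
        rw [Real.dist_eq, NNReal.coe_div, Real.coe_toNNReal _ hD.le, div_mul_eq_mul_div]
        exact (hu z w).trans (div_le_div_of_nonneg_right (hL.dist_le_mul z w) hD.le)
      exact this.ae_differentiableAt
    filter_upwards [ae_restrict_of_ae (hDd u hu), ae_restrict_of_ae (hDd v hv)] with z h1 h2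
    have := jac_ge2 hL (hDu u hu) (hDu v hv) (h1.const_mul D) (h2.const_mul D)
    have e : wd (grad (fun z => D * u z) z) (grad (fun z => D * v z) z) = D ^ 2 * wd (grad u z) (grad v z) := by
      simp only [wd, grad, fderiv_const_mul h1, fderiv_const_mul h2, smul_apply, smul_eq_mul]; ring
    rw [e, abs_mul, abs_of_pos (by positivity)] at this
    rw [div_mul_eq_mul_div, le_div_iff₀ (by positivity)]; linarith
  · refine (abs_max_sub_max_le_max _ _ _ _).trans (max_le (by rw [sub_self, abs_zero]; positivity) ?_)
    rw [sub_sub_sub_cancel_left, abs_sub_comm]; exact dl _ z w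
  · rw [div_le_one (by positivity)]; linarith
  · have e : t / (2 * l) ≤ 1/2 := by rw [div_le_iff₀ (by positivity)]; linarith
    rw [hcirc _ ⟨by positivity, by linarith⟩, g1 _ ⟨by positivity, e⟩, show 2 * (t / (2 * l)) * l = t by field_simp]
    simp
  · rw [hcirc 0 (by norm_num), g1 0 (by norm_num), hι.dist_eq, hσ t ⟨by linarith, by linarith⟩ _ (by simpa using hl0), max_eq_left]
    rw [sub_nonpos, one_le_div hD]
    refine le_trans ?_ (le_abs_self _); linarith
  · have h3 : s * (2 * l) ≤ t := by have := hs.2; rwa [le_div_iff₀ (by positivity)] at this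
    have e : s ≤ 1/2 := by nlinarith
    have m1 : 2 * s * l ∈ Ic 0 l := ⟨by have := hs.1; positivity, by linarith⟩
    rw [hcirc s ⟨hs.1, by linarith⟩, g1 s ⟨hs.1, e⟩, hι.dist_eq] at h2 ⊢
    rw [hσ _ ⟨by linarith, by linarith⟩ _ m1, abs_of_nonneg (by linarith)] at h2
    rw [hσ 0 ⟨le_rfl, hl0⟩ _ m1, abs_sub_comm, abs_of_nonneg (by linarith [m1.1])]
    have := (le_max_right _ _).trans_lt h2
    rw [sub_zero]; rw [sub_div] at this; linarith
  · have h3 : t ≤ s * (2 * l) := by have := hs.1; rwa [div_le_iff₀ (by positivity)] at this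
    have s0 : 0 ≤ s := le_trans (by positivity) hs.1
    rcases le_total s (1/2) with e | e
    · have m1 : 2 * s * l ∈ Ic 0 l := ⟨by positivity, by nlinarith⟩
      rw [hcirc s ⟨s0, by linarith⟩, g1 s ⟨s0, e⟩, hι.dist_eq] at h2 ⊢
      rw [hσ _ ⟨by linarith, by linarith⟩ _ m1, abs_sub_comm, abs_of_nonneg (by linarith)] at h2
      rw [hσ 0 ⟨le_rfl, hl0⟩ _ m1, abs_sub_comm, abs_of_nonneg (by linarith [m1.1])]
      have := (le_max_right _ _).trans_lt h2
      rw [sub_zero]; rw [sub_div] at this; linarith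
    · rw [hcirc s ⟨s0, hs.2⟩, g2 s ⟨e, hs.2⟩, hι.dist_eq] at h1
      have := cf ((2 * s - 1) * (60 * D)) ⟨mul_nonneg (by linarith) (by positivity), by nlinarith [hs.2]⟩
      rw [max_eq_left (by rw [sub_nonpos, one_le_div hD]; exact this)] at h1
      exact absurd h1 (lt_irrefl _)
lemma blow {X : Type u} [MetricSpace X] (hX : GeodesicSpace X) (hadm : HasDiscThickeningQII X) (hn : ¬ GromovHyperbolic X) :
    ∃ c1 M : ℝ, 0 < c1 ∧ 0 ≤ M ∧ ∀ θ > 0, ∀ R0 : ℝ, ∃ R ≥ R0, 0 < R ∧ ∃ K ⊆ Ic ((0:ℝ), (0:ℝ)) (1, 1), eR c1 ≤ volume K ∧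
      ∃ ψ : RR → X, ∀ y ∈ K, ∀ y' ∈ K, dist y y' - θ ≤ dist (ψ y) (ψ y') / R ∧ dist (ψ y) (ψ y') / R ≤ M * dist y y' + θ := by
  obtain ⟨X', mX, ι, -, hι, hH, C, hC, hQ⟩ := hadm
  obtain ⟨ρ, hρ, hnear⟩ : ∃ ρ > 0, ∀ x' : X', ∃ x, dist x' (ι x) < ρ := by
    refine ⟨Metric.hausdorffDist Set.univ (Set.range ι) + 1, by have := Metric.hausdorffDist_nonneg (s := (Set.univ : Set X')) (t := Set.range ι); linarith, fun x' => ?_⟩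
    obtain ⟨_, ⟨x, rfl⟩, h⟩ := Metric.exists_dist_lt_of_hausdorffDist_lt (Set.mem_univ x') (lt_add_one (Metric.hausdorffDist Set.univ (Set.range ι)))
      (by rw [Metric.hausdorffEDist_comm]; exact hH)
    exact ⟨x, h⟩
  choose ν hν using hnear
  obtain ⟨c1, M, hc1, hM, H⟩ := sel (C := 2 * C * 68 ^ 2) (by positivity)
  refine ⟨c1, M, hc1, hM, fun θ hθ R0 => ?_⟩
  obtain ⟨w0, hw0, H⟩ := H (θ / 2) (by positivity)
  obtain ⟨D, hD1, hD, hconf⟩ := conf_of_not_hyp hX hn (max (R0 / w0) (4 * ρ / θ / w0))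
  obtain ⟨Φ, L, J, f, g, tm, P, c⟩ := inst hC.le hQ hι hD hconf
  obtain ⟨w, hw, K, hK, hvol, ψ, hψ⟩ := H _ L J f g tm P c
  have hwp : 0 < w := by linarith
  have e1 := (div_le_iff₀ hw0).1 ((le_max_left _ _).trans hD1)
  have e2 := (div_le_iff₀ hw0).1 ((le_max_right _ _).trans hD1)
  have e3 : D * w0 ≤ D * w := by gcongr
  refine ⟨D * w, by linarith, by positivity, K, hK, hvol, fun y => ν (Φ (ψ y)), fun y hy y' hy' => ?_⟩
  obtain ⟨h1, h2⟩ := hψ y hy y' hy'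
  rw [le_div_iff₀ hD] at h1
  rw [div_le_iff₀ hD] at h2
  have h3 : |dist (ν (Φ (ψ y))) (ν (Φ (ψ y'))) - dist (Φ (ψ y)) (Φ (ψ y'))| ≤ 2 * ρ := by
    have := dist_dist_dist_le (Φ (ψ y)) (Φ (ψ y')) (ι (ν (Φ (ψ y)))) (ι (ν (Φ (ψ y'))))
    rw [hι.dist_eq, dist_comm, Real.dist_eq] at this
    linarith [hν (Φ (ψ y)), hν (Φ (ψ y'))]
  have h4 := abs_le.1 h3
  have h5 : 2 * ρ ≤ θ / 2 * (D * w) := by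
    have := (div_le_iff₀ hθ).1 (e2.trans e3); linarith
  rw [le_div_iff₀ (by positivity), div_le_iff₀ (by positivity)]
  have : 0 < θ * (D * w) := by positivity
  constructor <;> nlinarith
def sq (o : RR) (r : ℝ) : Set RR := {y | (o.1 ≤ y.1 ∧ y.1 < o.1 + r) ∧ o.2 ≤ y.2 ∧ y.2 < o.2 + r}
lemma dense_cell {n : ℕ} (hn : 0 < n) : ∀ (k : ℕ) (o : RR) (r : ℝ) (K : Set RR), 0 < r → K ⊆ sq o r →
    eR ((1 - 1 / (n:ℝ) ^ 2) ^ k * r ^ 2) < volume K →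
    ∃ o' r', r / n ^ k ≤ r' ∧ 0 < r' ∧ ∀ z ∈ sq o' r', ∃ y ∈ K, dist z y ≤ r' / n := by
  classical
  have hn0 : (0:ℝ) < n := by exact_mod_cast hn
  have hn1 : (1:ℝ) ≤ n := by exact_mod_cast hn
  intro k
  induction k with
  | zero =>
    intro o r K hr hK h
    have h1 : K ⊆ Metric.closedBall (o.1 + r / 2, o.2 + r / 2) (r / 2) := fun y hy => by
      obtain ⟨⟨a, b⟩, c, d⟩ := hK hy
      rw [Metric.mem_closedBall, Prod.dist_eq, max_le_iff, Real.dist_eq, Real.dist_eq, abs_le, abs_le]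
      refine ⟨⟨?_, ?_⟩, ?_, ?_⟩ <;> simp only <;> linarith
    have h2 := h.trans_le (measure_mono h1)
    rw [vol_cb _ (by positivity), show 4 * (r / 2) ^ 2 = (1 - 1 / (n:ℝ) ^ 2) ^ 0 * r ^ 2 by ring] at h2
    exact absurd h2 (lt_irrefl _)
  | succ k ih =>
    intro o r K hr hK h
    by_cases hz : ∀ z ∈ sq o r, ∃ y ∈ K, dist z y ≤ r / n
    · exact ⟨o, r, div_le_self hr.le (one_le_pow₀ hn1), hr, hz⟩
    push Not at hz
    obtain ⟨z0, hz0, hz1⟩ := hz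
    set F : RR → ℕ × ℕ := fun y => (⌊(y.1 - o.1) * (n / r)⌋₊, ⌊(y.2 - o.2) * (n / r)⌋₊) with hF
    have hcell : ∀ y ∈ sq o r, F y ∈ rg n ×ˢ rg n ∧ y ∈ sq (o.1 + (F y).1 * (r / n), o.2 + (F y).2 * (r / n)) (r / n) := by
      rintro y ⟨⟨a, b⟩, c, d⟩
      have p1 : 0 ≤ (y.1 - o.1) * (n / r) := mul_nonneg (by linarith) (by positivity)
      have p2 : 0 ≤ (y.2 - o.2) * (n / r) := mul_nonneg (by linarith) (by positivity)
      have e : ∀ t : ℝ, t * (n / r) * (r / n) = t := fun t => by field_simp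
      have e1 : r * (n / r) = (n:ℝ) := by field_simp
      have q0 : (0:ℝ) < n / r := by positivity
      have q1 : 0 < r / n := by positivity
      refine ⟨Finset.mem_product.2 ⟨Finset.mem_range.2 ((Nat.floor_lt p1).2 ?_), Finset.mem_range.2 ((Nat.floor_lt p2).2 ?_)⟩, ⟨?_, ?_⟩, ?_, ?_⟩
      · exact (mul_lt_mul_of_pos_right (by linarith) q0).trans_eq e1
      · exact (mul_lt_mul_of_pos_right (by linarith) q0).trans_eq e1
      · have := mul_le_mul_of_nonneg_right (Nat.floor_le p1) q1.le
        rw [e] at this; simp only [hF]; linarith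
      · have := mul_lt_mul_of_pos_right (Nat.lt_floor_add_one ((y.1 - o.1) * (n / r))) q1
        rw [e] at this; simp only [hF]; linarith
      · have := mul_le_mul_of_nonneg_right (Nat.floor_le p2) q1.le
        rw [e] at this; simp only [hF]; linarith
      · have := mul_lt_mul_of_pos_right (Nat.lt_floor_add_one ((y.2 - o.2) * (n / r))) q1
        rw [e] at this; simp only [hF]; linarith
    set S := (rg n ×ˢ rg n).erase (F z0) with hS
    have cov : K ⊆ ⋃ q ∈ S, {y | y ∈ K ∧ F y = q} := by
      intro y hy
      simp only [Set.mem_iUnion]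
      refine ⟨F y, Finset.mem_erase.2 ⟨fun he => ?_, (hcell y (hK hy)).1⟩, hy, rfl⟩
      obtain ⟨⟨a, b⟩, c, d⟩ := (hcell y (hK hy)).2
      obtain ⟨⟨a', b'⟩, c', d'⟩ := (hcell z0 hz0).2
      rw [he] at a b c d
      refine absurd (hz1 y hy) (not_lt.2 ?_)
      rw [Prod.dist_eq, max_le_iff, Real.dist_eq, Real.dist_eq, abs_le, abs_le]
      simp only at *
      refine ⟨⟨?_, ?_⟩, ?_, ?_⟩ <;> linarith
    have hcard : (S.card : ℝ) = (n:ℝ) ^ 2 - 1 := by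
      rw [hS, Finset.card_erase_of_mem (hcell z0 hz0).1, Finset.card_product, Finset.card_range, Nat.cast_sub (by nlinarith)]
      push_cast; ring
    have hb : (0:ℝ) ≤ 1 - 1 / (n:ℝ) ^ 2 := by
      rw [sub_nonneg, div_le_one (by positivity)]; exact one_le_pow₀ hn1
    obtain ⟨q, hq, hlt⟩ : ∃ q ∈ S, eR ((1 - 1 / (n:ℝ) ^ 2) ^ k * (r / n) ^ 2) < volume {y | y ∈ K ∧ F y = q} := by
      by_contra hcon
      push Not at hcon
      refine absurd h (not_lt.2 ((measure_mono cov).trans ((measure_biUnion_finset_le _ _).trans ((Finset.sum_le_card_nsmul _ _ _ hcon).trans ?_))))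
      rw [nsmul_eq_mul, ← ENNReal.ofReal_natCast, ← ENNReal.ofReal_mul (by positivity), hcard]
      refine ENNReal.ofReal_le_ofReal (le_of_eq ?_)
      rw [show (n:ℝ) ^ 2 - 1 = (1 - 1 / (n:ℝ) ^ 2) * n ^ 2 by field_simp, div_pow]
      generalize 1 - 1 / (n:ℝ) ^ 2 = β
      field_simp
      ring
    obtain ⟨o', r', h1, h2, h3⟩ := ih (o.1 + q.1 * (r / n), o.2 + q.2 * (r / n)) (r / n) _ (by positivity)
      (fun y hy => by rw [← hy.2]; exact (hcell y (hK hy.1)).2) hlt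
    refine ⟨o', r', le_trans (le_of_eq ?_) h1, h2, fun z hz => ?_⟩
    · rw [pow_succ']; field_simp
    · obtain ⟨y, hy, h⟩ := h3 z hz
      exact ⟨y, hy.1, h⟩
lemma patt {X : Type u} [MetricSpace X] (hX : GeodesicSpace X) (hadm : HasDiscThickeningQII X) (hn : ¬ GromovHyperbolic X) :
    ∃ M : ℝ, 1 ≤ M ∧ ∀ (A : Finset RR) (η : ℝ), 0 < η → ∀ R0 : ℝ, ∃ R ≥ R0, 0 < R ∧ ∃ x : RR → X,
      ∀ a ∈ A, ∀ b ∈ A, dist a b - η ≤ dist (x a) (x b) / R ∧ dist (x a) (x b) / R ≤ M * dist a b + η := by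
  obtain ⟨c1, M, hc1, hM, H⟩ := blow hX hadm hn
  refine ⟨M + 1, by linarith, fun A η hη R0 => ?_⟩
  set B : ℝ := 1 + ∑ a ∈ A, ‖a‖ with hB
  have hB0 : 0 < B := by positivity
  have hAB : ∀ a ∈ A, ‖a‖ < B := fun a ha => by
    have := Finset.single_le_sum (f := fun a : RR => ‖a‖) (fun i _ => norm_nonneg i) ha
    linarith
  obtain ⟨n, hn⟩ := exists_nat_gt (max 1 (8 * B * (M + 1) / η))
  have hn1 : (1:ℝ) < n := (le_max_left _ _).trans_lt hn
  have hn2 : 8 * B * (M + 1) < n * η := (div_lt_iff₀ hη).1 ((le_max_right _ _).trans_lt hn)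
  have hn0 : (0:ℝ) < n := by linarith
  obtain ⟨k, hk⟩ := exists_pow_lt_of_lt_one (show 0 < c1 / 4 by positivity) (show 1 - 1 / (n:ℝ) ^ 2 < 1 by
    have : 0 < 1 / (n:ℝ) ^ 2 := by positivity
    linarith)
  set r0 : ℝ := 2 / n ^ k with hr0
  have hr0p : 0 < r0 := by positivity
  obtain ⟨R, hR, hRp, K, hK, hvol, ψ, hψ⟩ := H (η * r0 / (4 * B)) (by positivity) (|R0| / (r0 / (2 * B)))
  obtain ⟨o, r, h1, h2, h3⟩ := dense_cell (by exact_mod_cast hn0) k (0, 0) 2 K two_pos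
    (fun y hy => ⟨⟨(hK hy).1.1, by have := (hK hy).2.1; simp only at this ⊢; linarith⟩, (hK hy).1.2, by have := (hK hy).2.2; simp only at this ⊢; linarith⟩)
    (lt_of_lt_of_le ((ENNReal.ofReal_lt_ofReal_iff hc1).2 (by linarith)) hvol)
  set s : ℝ := r / (2 * B) with hs
  have hs0 : 0 < s := by positivity
  have hr : r = 2 * B * s := by rw [hs]; field_simp
  have hr0s : r0 ≤ 2 * B * s := by rw [← hr]; exact h1
  have : ∀ a ∈ A, ∃ y ∈ K, dist (o + s • (a + (B, B))) y ≤ r / n := fun a ha => by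
    refine h3 _ ?_
    have h4 := hAB a ha
    rw [Prod.norm_def, max_lt_iff, Real.norm_eq_abs, Real.norm_eq_abs, abs_lt, abs_lt] at h4
    obtain ⟨⟨a1, a2⟩, a3, a4⟩ := h4
    refine ⟨⟨?_, ?_⟩, ?_, ?_⟩ <;> simp only [Prod.fst_add, Prod.snd_add, Prod.smul_fst, Prod.smul_snd, smul_eq_mul] <;> nlinarith
  choose! y hy1 hy2 using this
  refine ⟨R * s, ?_, by positivity, ψ ∘ y, fun a ha b hb => ?_⟩
  · rw [ge_iff_le, div_le_iff₀ (by positivity)] at hR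
    have : r0 / (2 * B) ≤ s := by rw [div_le_iff₀ (by positivity)]; linarith
    calc R0 ≤ |R0| := le_abs_self _
      _ ≤ _ := hR
      _ ≤ _ := by gcongr
  · obtain ⟨g1, g2⟩ := hψ _ (hy1 a ha) _ (hy1 b hb)
    have hd : dist (o + s • (a + (B, B))) (o + s • (b + (B, B))) = s * dist a b := by
      rw [dist_add_left, dist_smul₀, dist_add_right, Real.norm_of_nonneg hs0.le]
    have h5 : |dist (y a) (y b) - s * dist a b| ≤ 2 * (r / n) := by
      have := dist_dist_dist_le (o + s • (a + (B, B))) (o + s • (b + (B, B))) (y a) (y b)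
      rw [hd, dist_comm, Real.dist_eq] at this
      linarith [hy2 a ha, hy2 b hb]
    have h6 := abs_le.1 h5
    have h7 : η * r0 / (4 * B) ≤ η / 2 * s := by
      rw [div_le_iff₀ (by positivity)]; nlinarith
    have h8 : 2 * (r / n) * (M + 1) ≤ η / 2 * s := by
      rw [hr, mul_div_assoc', div_mul_eq_mul_div, div_le_iff₀ hn0]; nlinarith
    have h9 : 0 ≤ r / n := by positivity
    simp only [Function.comp_apply]
    rw [← div_div, le_div_iff₀ hs0, div_le_iff₀ hs0]
    have h10 : 0 ≤ s * dist a b := by positivity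
    constructor
    · nlinarith
    · have := mul_le_mul_of_nonneg_left (show dist (y a) (y b) ≤ s * dist a b + 2 * (r / n) by linarith) hM
      nlinarith
section tangent
variable {X : Type u} [MetricSpace X] {M : ℝ}
def Fp (X : Type u) [MetricSpace X] (A : Finset RR) (η R0 : ℝ) : Set (RR → RR → ℝ) :=
  {d | ∃ R ≥ R0, 0 < R ∧ ∃ x : RR → X, ∀ a ∈ A, ∀ b ∈ A, |dist (x a) (x b) / R - d a b| ≤ η}
lemma Fp_mono {A A' : Finset RR} {η η' R0 R0' : ℝ} (hA : A ⊆ A') (hη : η' ≤ η) (hR : R0 ≤ R0') : Fp X A' η' R0' ⊆ Fp X A η R0 := by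
  rintro d ⟨R, h1, h2, x, hx⟩
  exact ⟨R, hR.trans h1, h2, x, fun a ha b hb => (hx a (hA ha) b (hA hb)).trans hη⟩
lemma Fp_closure {A : Finset RR} {η R0 : ℝ} (hη : 0 < η) : closure (Fp X A η R0) ⊆ Fp X A (2 * η) R0 := by
  intro d hd
  have ho : IsOpen {d' : RR → RR → ℝ | ∀ a ∈ A, ∀ b ∈ A, |d' a b - d a b| < η} := by
    simp only [Set.ofPred_forall]
    exact isOpen_biInter_finset fun a _ => isOpen_biInter_finset fun b _ => isOpen_lt (by fun_prop) continuous_const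
  obtain ⟨d', h1, R, hR, hRp, x, hx⟩ := mem_closure_iff.1 hd _ ho (fun a _ b _ => by simpa using hη)
  refine ⟨R, hR, hRp, x, fun a ha b hb => ?_⟩
  have := abs_add_le (dist (x a) (x b) / R - d' a b) (d' a b - d a b)
  rw [sub_add_sub_cancel] at this
  linarith [hx a ha b hb, h1 a ha b hb]
def Pd (M : ℝ) : Set (RR → RR → ℝ) := {d | ∀ x y, d x y ∈ Ic (dist x y) (M * dist x y)}
lemma Pd_compact : IsCompact (Pd M) := by
  have : Pd M = Set.pi Set.univ fun x => Set.pi Set.univ fun y => Ic (dist x y) (M * dist x y) := by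
    ext d; exact ⟨fun h x _ y _ => h x y, fun h x y => h x trivial y trivial⟩
  rw [this]
  exact isCompact_univ_pi fun x => isCompact_univ_pi fun y => isCompact_Icc
def S0 (X : Type u) [MetricSpace X] (M : ℝ) : Set (RR → RR → ℝ) := {d | d ∈ Pd M ∧ ∀ A η, 0 < η → ∀ R0, d ∈ Fp X A η R0}
noncomputable def tr (a : RR) (s : ℝ) (d : RR → RR → ℝ) : RR → RR → ℝ := fun x y => d (a + s • x) (a + s • y) / s
lemma S0_eq : S0 X M = ⋂ i : Finset RR × ℕ, (Pd M ∩ closure (Fp X i.1 (1 / ((i.2:ℝ) + 1)) i.2)) := by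
  ext d
  rw [Set.mem_iInter]
  refine ⟨fun h i => ⟨h.1, subset_closure (h.2 _ _ (by positivity) _)⟩, fun h => ⟨(h (∅, 0)).1, fun A η hη R0 => ?_⟩⟩
  obtain ⟨k, hk⟩ := exists_nat_ge (max R0 (2 / η))
  refine Fp_mono (subset_refl A) ?_ ((le_max_left _ _).trans hk) (Fp_closure (by positivity) (h (A, k)).2)
  have := (div_le_iff₀ hη).1 ((le_max_right _ _).trans hk)
  rw [mul_one_div, div_le_iff₀ (by positivity)]; nlinarith
lemma S0_closed : IsClosed (S0 X M) := by
  rw [S0_eq]; exact isClosed_iInter fun i => Pd_compact.isClosed.inter isClosed_closure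
lemma S0_nonempty (hM : 1 ≤ M) (h : ∀ (A : Finset RR) (η : ℝ), 0 < η → ∀ R0 : ℝ, ∃ R ≥ R0, 0 < R ∧ ∃ x : RR → X,
    ∀ a ∈ A, ∀ b ∈ A, dist a b - η ≤ dist (x a) (x b) / R ∧ dist (x a) (x b) / R ≤ M * dist a b + η) : (S0 X M).Nonempty := by
  classical
  rw [S0_eq]
  refine IsCompact.nonempty_iInter_of_directed_nonempty_isCompact_isClosed _ (fun i j => ⟨(i.1 ∪ j.1, max i.2 j.2), ?_, ?_⟩) (fun i => ?_)
    (fun i => Pd_compact.inter_right isClosed_closure) fun i => Pd_compact.isClosed.inter isClosed_closure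
  · refine Set.inter_subset_inter_right _ (closure_mono (Fp_mono Finset.subset_union_left ?_ (by exact_mod_cast le_max_left _ _)))
    gcongr; exact le_max_left _ _
  · refine Set.inter_subset_inter_right _ (closure_mono (Fp_mono Finset.subset_union_right ?_ (by exact_mod_cast le_max_right _ _)))
    gcongr; exact le_max_right _ _
  · obtain ⟨R, hR, hRp, x, hx⟩ := h i.1 (1 / ((i.2:ℝ) + 1)) (by positivity) i.2
    refine ⟨fun a b => max (dist a b) (min (M * dist a b) (dist (x a) (x b) / R)), fun a b => ⟨le_max_left _ _, max_le ?_ (min_le_left _ _)⟩,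
      subset_closure ⟨R, hR, hRp, x, fun a ha b hb => ?_⟩⟩
    · have : 0 ≤ dist a b := dist_nonneg
      nlinarith
    · obtain ⟨h1, h2⟩ := hx a ha b hb
      have h0 : 0 < 1 / ((i.2:ℝ) + 1) := by positivity
      have h3 : 0 ≤ dist a b := dist_nonneg
      rw [abs_le]
      constructor
      · have := max_le (a := dist a b) (b := min (M * dist a b) (dist (x a) (x b) / R)) (c := dist (x a) (x b) / R + 1 / ((i.2:ℝ) + 1)) (by linarith)
          ((min_le_right _ _).trans (by linarith))
        linarith
      · have := le_min (a := M * dist a b) (b := dist (x a) (x b) / R) (c := dist (x a) (x b) / R - 1 / ((i.2:ℝ) + 1)) (by linarith) (by linarith)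
        linarith [le_max_right (dist a b) (min (M * dist a b) (dist (x a) (x b) / R))]
lemma S0_tr {d : RR → RR → ℝ} (hd : d ∈ S0 X M) (a : RR) {s : ℝ} (hs : 0 < s) : tr a s d ∈ S0 X M := by
  classical
  refine ⟨fun x y => ?_, fun A η hη R0 => ?_⟩
  · have := hd.1 (a + s • x) (a + s • y)
    rw [dist_add_left, dist_smul₀, Real.norm_of_nonneg hs.le] at this
    refine ⟨(le_div_iff₀ hs).2 (by linarith [this.1]), (div_le_iff₀ hs).2 (by linarith [this.2])⟩
  · obtain ⟨R, hR, hRp, x, hx⟩ := hd.2 (A.image fun y => a + s • y) (η * s) (by positivity) (R0 / s)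
    refine ⟨R * s, (div_le_iff₀ hs).1 hR, by positivity, fun y => x (a + s • y), fun b hb c hc => ?_⟩
    have := hx _ (Finset.mem_image_of_mem _ hb) _ (Finset.mem_image_of_mem _ hc)
    unfold tr
    rw [← div_div, ← sub_div, abs_div, abs_of_pos hs, div_le_iff₀ hs]
    exact this
lemma S0_symm {d : RR → RR → ℝ} (hd : d ∈ S0 X M) (x y : RR) : d x y = d y x := by
  classical
  have : ∀ x y, d x y ≤ d y x := fun x y => le_of_forall_pos_le_add fun ε hε => by
    obtain ⟨R, hR, hRp, z, hz⟩ := hd.2 {x, y} (ε / 2) (by positivity) 0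
    have h1 := abs_le.1 (hz x (by simp) y (by simp))
    have h2 := abs_le.1 (hz y (by simp) x (by simp))
    rw [dist_comm (z y)] at h2; linarith [h1.1, h2.2]
  exact le_antisymm (this x y) (this y x)
lemma S0_tri {d : RR → RR → ℝ} (hd : d ∈ S0 X M) (x y w : RR) : d x w ≤ d x y + d y w := by
  classical
  refine le_of_forall_pos_le_add fun ε hε => ?_
  obtain ⟨R, hR, hRp, z, hz⟩ := hd.2 {x, y, w} (ε / 3) (by positivity) 0
  have h1 := abs_le.1 (hz x (by simp) y (by simp))
  have h2 := abs_le.1 (hz y (by simp) w (by simp))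
  have h3 := abs_le.1 (hz x (by simp) w (by simp))
  have h4 : dist (z x) (z w) / R ≤ dist (z x) (z y) / R + dist (z y) (z w) / R := by
    rw [← add_div]; gcongr; exact dist_triangle _ _ _
  linarith [h1.2, h2.2, h3.1]
lemma exists_min (hne : (S0 X M).Nonempty) : ∃ T ⊆ S0 X M, IsClosed T ∧ T.Nonempty ∧ (∀ d ∈ T, ∀ a s, 0 < s → tr a s d ∈ T) ∧
    ∀ T' ⊆ T, IsClosed T' → T'.Nonempty → (∀ d ∈ T', ∀ a s, 0 < s → tr a s d ∈ T') → T ⊆ T' := by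
  have Z := zorn_superset_nonempty {T | T ⊆ S0 X M ∧ IsClosed T ∧ T.Nonempty ∧ ∀ d ∈ T, ∀ a s, 0 < s → tr a s d ∈ T}
    (fun c hc hch hcn => ?_) (S0 X M) ⟨subset_rfl, S0_closed, hne, fun d hd a s hs => S0_tr hd a hs⟩
  · obtain ⟨T, hT, hmin⟩ := Z
    obtain ⟨h1, h2, h3, h4⟩ := hmin.1
    exact ⟨T, h1, h2, h3, h4, fun T' a b c d => hmin.2 ⟨a.trans h1, b, c, d⟩ a⟩
  · have : Nonempty c := hcn.to_subtype
    obtain ⟨T0, hT0⟩ := hcn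
    refine ⟨⋂₀ c, ⟨(Set.sInter_subset_of_mem hT0).trans (hc hT0).1, isClosed_sInter fun t ht => (hc ht).2.1, ?_, fun d hd a s hs => ?_⟩,
      fun s hs => Set.sInter_subset_of_mem hs⟩
    · exact IsCompact.nonempty_sInter_of_directed_nonempty_isCompact_isClosed (fun a ha b hb => (hch.total ha hb).elim (fun h => ⟨a, ha, subset_rfl, h⟩) fun h => ⟨b, hb, h, subset_rfl⟩) (fun U hU => (hc hU).2.2.1)
        (fun U hU => Pd_compact.of_isClosed_subset (hc hU).2.1 fun d hd => ((hc hU).1 hd).1) fun U hU => (hc hU).2.1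
    · exact fun t ht => (hc ht).2.2.2 d (hd t ht) a s hs
lemma linear {T : Set (RR → RR → ℝ)} (hT : T ⊆ S0 X M) (hcl : IsClosed T) (hne : T.Nonempty) (hinv : ∀ d ∈ T, ∀ a s, 0 < s → tr a s d ∈ T)
    (hmin : ∀ T' ⊆ T, IsClosed T' → T'.Nonempty → (∀ d ∈ T', ∀ a s, 0 < s → tr a s d ∈ T') → T ⊆ T') (v : RR) :
    ∃ m, ∀ d ∈ T, ∀ x, ∀ t : ℝ, 0 ≤ t → d x (x + t • v) = t * m := by
  classical
  have hcpt : IsCompact T := Pd_compact.of_isClosed_subset hcl fun d hd => (hT hd).1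
  obtain ⟨d0, hd0, hmax⟩ := hcpt.exists_isMaxOn hne (f := fun d => d 0 v) (by fun_prop)
  have self : ∀ d ∈ T, ∀ x, d x x = 0 := fun d hd x => by
    have := (hT hd).1 x x
    rw [dist_self, mul_zero] at this; exact le_antisymm this.2 this.1
  set m := d0 0 v with hm
  have ub : ∀ d ∈ T, ∀ x, ∀ t : ℝ, 0 ≤ t → d x (x + t • v) ≤ t * m := by
    intro d hd x t ht
    rcases ht.eq_or_lt with rfl | ht
    · simp [self d hd]
    · have : tr x t d 0 v ≤ m := hmax (hinv d hd x t ht)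
      unfold tr at this
      rw [smul_zero, add_zero, div_le_iff₀ ht] at this; linarith
  have ne : (⋂ i : Finset RR × ℕ, {d | d ∈ T ∧ ∀ x ∈ i.1, ((i.2:ℝ) + 1) * m - 1 / ((i.2:ℝ) + 1) ≤ d x (x + ((i.2:ℝ) + 1) • v)}).Nonempty := by
    have mono : ∀ (A B : Finset RR) (n k : ℕ), A ⊆ B → n ≤ k → {d | d ∈ T ∧ ∀ x ∈ B, ((k:ℝ) + 1) * m - 1 / ((k:ℝ) + 1) ≤ d x (x + ((k:ℝ) + 1) • v)} ⊆
        {d | d ∈ T ∧ ∀ x ∈ A, ((n:ℝ) + 1) * m - 1 / ((n:ℝ) + 1) ≤ d x (x + ((n:ℝ) + 1) • v)} := by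
      rintro A B n k hAB hnk d ⟨hd, h⟩
      refine ⟨hd, fun x hx => ?_⟩
      have h1 := h x (hAB hx)
      have hnk' : (n:ℝ) ≤ k := by exact_mod_cast hnk
      have h2 := ub d hd (x + ((n:ℝ) + 1) • v) (k - n) (by linarith)
      rw [add_assoc, ← add_smul, show (n:ℝ) + 1 + (k - n) = k + 1 by ring] at h2
      have h3 := S0_tri (hT hd) x (x + ((n:ℝ) + 1) • v) (x + ((k:ℝ) + 1) • v)
      have h4 : 1 / ((k:ℝ) + 1) ≤ 1 / ((n:ℝ) + 1) := by gcongr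
      nlinarith
    have cl : ∀ i : Finset RR × ℕ, IsClosed {d | d ∈ T ∧ ∀ x ∈ i.1, ((i.2:ℝ) + 1) * m - 1 / ((i.2:ℝ) + 1) ≤ d x (x + ((i.2:ℝ) + 1) • v)} := fun i => by
      refine hcl.inter (?_ : IsClosed {d : RR → RR → ℝ | ∀ x ∈ i.1, _})
      simp only [Set.ofPred_forall]
      exact isClosed_biInter fun x _ => isClosed_le continuous_const (by fun_prop)
    refine IsCompact.nonempty_iInter_of_directed_nonempty_isCompact_isClosed _ (fun i j => ⟨(i.1 ∪ j.1, max i.2 j.2),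
      mono _ _ _ _ Finset.subset_union_left (le_max_left _ _), mono _ _ _ _ Finset.subset_union_right (le_max_right _ _)⟩) (fun i => ?_)
      (fun i => hcpt.of_isClosed_subset (cl i) fun d hd => hd.1) cl
    obtain ⟨A, n⟩ := i
    simp only
    set l : ℝ := (n:ℝ) + 1 with hl
    have hl0 : 0 < l := by positivity
    obtain ⟨J, hJ⟩ := exists_nat_gt (max 1 (l * ∑ x ∈ A, 2 * (M * ‖x‖)))
    have hJ0 : (0:ℝ) < J := by linarith [(le_max_left _ _).trans_lt hJ]
    have hJ1 := (le_max_right _ _).trans_lt hJ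
    set d1 := tr 0 (1 / (J * l)) d0 with hd1
    have hd1T : d1 ∈ T := hinv d0 hd0 _ _ (by positivity)
    have hd1v : d1 0 ((J * l) • v) = J * l * m := by
      rw [hd1, tr, smul_zero, zero_add, zero_add, smul_smul, one_div_mul_cancel (by positivity), one_smul, ← hm]; field_simp
    have step : ∀ x, ∀ k : ℕ, d1 x (x + (k * l) • v) ≤ ∑ j ∈ rg k, d1 (x + (j * l) • v) (x + (j * l) • v + l • v) := by
      intro x k
      induction k with
      | zero => simp [self d1 hd1T]
      | succ k ih =>
        rw [Finset.sum_range_succ]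
        have := S0_tri (hT hd1T) x (x + (k * l) • v) (x + (k * l) • v + l • v)
        rw [show ((k + 1 : ℕ) : ℝ) * l = k * l + l by push_cast; ring, add_smul, ← add_assoc]
        linarith
    have tot : ∀ x, ∑ j ∈ rg J, (l * m - d1 (x + (j * l) • v) (x + (j * l) • v + l • v)) ≤ 2 * (M * ‖x‖) := by
      intro x
      rw [Finset.sum_sub_distrib, Finset.sum_const, Finset.card_range, nsmul_eq_mul]
      have h1 := step x J
      have h2 := S0_tri (hT hd1T) 0 x ((J * l) • v)
      have h3 := S0_tri (hT hd1T) x (x + (J * l) • v) ((J * l) • v)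
      have h4 := ((hT hd1T).1 0 x).2
      have h5 := ((hT hd1T).1 (x + (J * l) • v) ((J * l) • v)).2
      rw [dist_zero_left] at h4
      rw [dist_add_self_left] at h5
      linarith
    obtain ⟨j, -, hj⟩ : ∃ j ∈ rg J, ∑ x ∈ A, (l * m - d1 (x + (j * l) • v) (x + (j * l) • v + l • v)) ≤ 1 / l := by
      refine Finset.exists_le_of_sum_le (by simpa using fun h => by simp [h] at hJ0) ?_
      rw [Finset.sum_comm, Finset.sum_const, Finset.card_range, nsmul_eq_mul, mul_one_div, le_div_iff₀ hl0]
      have := Finset.sum_le_sum fun x (_ : x ∈ A) => tot x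
      nlinarith
    refine ⟨tr ((j * l) • v) 1 d1, hinv d1 hd1T _ _ one_pos, fun x hx => ?_⟩
    have h1 := Finset.single_le_sum (f := fun x => l * m - d1 (x + (j * l) • v) (x + (j * l) • v + l • v))
      (fun x _ => sub_nonneg.2 (ub d1 hd1T (x + (j * l) • v) l hl0.le)) hx
    unfold tr
    rw [one_smul, one_smul, div_one, ← add_assoc, add_comm _ x]
    linarith
  have hT' := hmin {d | d ∈ T ∧ ∀ x, ∀ t : ℝ, 0 ≤ t → t * m ≤ d x (x + t • v)} (fun d hd => hd.1) (by
      refine hcl.inter (?_ : IsClosed {d : RR → RR → ℝ | ∀ x, _})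
      simp only [Set.ofPred_forall]
      exact isClosed_iInter fun x => isClosed_iInter fun t => isClosed_iInter fun _ => isClosed_le continuous_const (by fun_prop))
    (by
      obtain ⟨d, hd⟩ := ne
      rw [Set.mem_iInter] at hd
      refine ⟨d, (hd (∅, 0)).1, fun x t ht => le_of_forall_pos_le_add fun ε hε => ?_⟩
      obtain ⟨n, hn⟩ := exists_nat_ge (max t (1 / ε))
      have h1 := (hd ({x}, n)).2 x (by simp)
      have hdT := (hd (∅, 0)).1
      have hnt := (le_max_left _ _).trans hn
      simp only at h1
      have h2 := ub d hdT (x + t • v) (n + 1 - t) (by linarith)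
      rw [add_assoc, ← add_smul, show t + ((n:ℝ) + 1 - t) = n + 1 by ring] at h2
      have h3 := S0_tri (hT hdT) x (x + t • v) (x + ((n:ℝ) + 1) • v)
      have h4 : 1 / ((n:ℝ) + 1) ≤ ε := by
        have := (div_le_iff₀ hε).1 ((le_max_right _ _).trans hn)
        rw [div_le_iff₀ (by positivity)]; nlinarith
      nlinarith)
    (fun d hd a s hs => ⟨hinv d hd.1 a s hs, fun x t ht => by
      have := hd.2 (a + s • x) (s * t) (by positivity)
      unfold tr
      rw [smul_add, smul_smul, ← add_assoc, le_div_iff₀ hs]; linarith⟩)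
  exact ⟨m, fun d hd x t ht => le_antisymm (ub d hd x t ht) ((hT' hd).2 x t ht)⟩
lemma tangent_norm (hM : 1 ≤ M) (hne : (S0 X M).Nonempty) : ∃ N, IsNm N ∧ (∀ x, ‖x‖ ≤ N x) ∧ (∀ x, N x ≤ M * ‖x‖) ∧ Approx X N := by
  classical
  obtain ⟨T, hT, hcl, ⟨d, hd⟩, hinv, hmin⟩ := exists_min hne
  choose N hN using linear hT hcl ⟨d, hd⟩ hinv hmin
  have hdN : ∀ x v, d x (x + v) = N v := fun x v => by simpa using hN v d hd x 1 zero_le_one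
  have hS := hT hd
  have hl : ∀ x, ‖x‖ ≤ N x ∧ N x ≤ M * ‖x‖ := fun x => by
    have := hS.1 0 (0 + x)
    rwa [hdN, zero_add, dist_zero_left] at this
  have hneg : ∀ x, N (-x) = N x := fun x => by
    rw [← hdN x, ← hdN 0 x, S0_symm hS]; simp
  have hadd : ∀ x y, N (x + y) ≤ N x + N y := fun x y => by
    rw [← hdN 0, ← hdN 0 x, ← hdN (0 + x) y, ← add_assoc]; exact S0_tri hS _ _ _
  have hpos : ∀ t : ℝ, 0 ≤ t → ∀ x, N (t • x) = t * N x := fun t ht x => by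
    rw [← hdN 0, hN x d hd 0 t ht]
  refine ⟨N, ⟨fun x hx => (norm_pos_iff.2 hx).trans_le (hl x).1, hadd, fun t x => ?_, ?_⟩, fun x => (hl x).1, fun x => (hl x).2, fun n y η hη R0 => ?_⟩
  · rcases le_total 0 t with h | h
    · rw [hpos t h, abs_of_nonneg h]
    · rw [← hneg, ← neg_smul, hpos _ (by linarith), abs_of_nonpos h]
  · refine (LipschitzWith.of_dist_le_mul (K := M.toNNReal) fun x y => ?_).continuous
    rw [Real.coe_toNNReal _ (by linarith), Real.dist_eq, abs_le, dist_eq_norm]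
    have h1 := hadd (x - y) y
    have h2 := hadd (y - x) x
    have h3 := (hl (x - y)).2
    have h4 := hneg (x - y)
    rw [neg_sub] at h4
    rw [sub_add_cancel] at h1 h2
    constructor <;> linarith
  · obtain ⟨R, hR, hRp, x, hx⟩ := hS.2 ((rg n).image y) η hη R0
    refine ⟨R, hR, hRp, x ∘ y, fun i hi j hj => ?_⟩
    have := hx _ (Finset.mem_image_of_mem y (Finset.mem_range.2 hi)) _ (Finset.mem_image_of_mem y (Finset.mem_range.2 hj))
    rwa [show d (y i) (y j) = N (y i - y j) by rw [S0_symm hS, ← hdN (y j)]; simp] at this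
end tangent

theorem isop_general_case {X : Type u} [MetricSpace X] (x₀ : X)
    (hX : GeodesicSpace X) (hadm : HasDiscThickeningQII X)
    (h : ∃ ε > (0:ℝ), ∃ s₀ > (0:ℝ), ∀ γ : ℝ → X, IsLipLoop γ → s₀ ≤ loopLength γ →
      ∃ φ : ℝ × ℝ → Linfty X, BoundsLoop φ (fun s => kuratowski X x₀ (γ s)) ∧
        lipArea φ ≤ (1 - ε) / (4 * Real.pi) * (loopLength γ) ^ 2) :
    GromovHyperbolic X := by
  by_contra hn
  obtain ⟨ε, hε, s₀, hs, h⟩ := h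
  obtain ⟨M, hM, hp⟩ := patt hX hadm hn
  obtain ⟨N, hN, hl, hu, hA⟩ := tangent_norm hM (S0_nonempty hM hp)
  refine poly_contra hN hl hu (lt_min hε one_pos) (polyIneq_of_approx (ε := min ε 1) (s₀ := s₀) x₀ hX (min_le_right _ _) (fun γ h1 h2 => ?_) hN hl hA)
  obtain ⟨φ, h3, h4⟩ := h γ h1 h2
  refine ⟨φ, h3, h4.trans ?_⟩
  have := Real.pi_pos
  gcongr
  exact min_le_left _ _

end SharpIsop
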